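/- Suppose s ≥ 3, c is a nonzero integer, and 𝒞*(x₂,…,x_s) is an integral cubic form not of the shape a(b₂x₂+⋯+b_sx_s)³ for rationals a, b₂,…,b_s. Let 𝒫(x) = c·x₁³ + 𝒞*(x₂,…,x_s), and for P ≥ 2 let N_𝒫(P) = Σ μ(|𝒫(x)|)² over integer vectors x with |x_j| ≤ P for all 1 ≤ j ≤ s. Then N_𝒫(P) = 2^s·P^s·𝔖_𝒫 + E₃ where, for every ε > 0, |E₃| ≤ C·P^{s − 1/(8s−2) + ε} for a constant C depending only on 𝒫 and ε; here 𝔖_𝒫 = ∏_p (1 − ρ_𝒫(p²)/p^{2s}). -/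

import Mathlib

open MvPolynomial

/-- The divisor bound `d(n) ≪ n ^ ε`. -/
theorem card_divisors_le_rpow {ε : ℝ} (hε : 0 < ε) :
    ∃ K : ℝ, 1 ≤ K ∧ ∀ n : ℕ, n ≠ 0 → (n.divisors.card : ℝ) ≤ K * (n : ℝ) ^ ε := by
  set C : ℝ := 1 + 1 / (ε * Real.log 2) with hC
  have hl : 0 < Real.log 2 := Real.log_pos (by norm_num)
  have hC1 : 1 ≤ C := by rw [hC]; have : 0 < 1 / (ε * Real.log 2) := by positivity
                         linarith
  set B : ℕ := ⌈(2 : ℝ) ^ (1 / ε)⌉₊ with hB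
  have small : ∀ p e : ℕ, 2 ≤ p → ((e : ℝ) + 1) ≤ C * (p : ℝ) ^ (ε * e) := by
    intro p e hp
    have h2 : (2 : ℝ) ^ (ε * e) ≤ (p : ℝ) ^ (ε * e) :=
      Real.rpow_le_rpow (by norm_num) (by exact_mod_cast hp) (by positivity)
    have h3 : 1 + Real.log 2 * (ε * e) ≤ (2 : ℝ) ^ (ε * e) := by
      rw [Real.rpow_def_of_pos (by norm_num)]
      linarith [Real.add_one_le_exp (Real.log 2 * (ε * e))]
    have h4 : ((e : ℝ) + 1) ≤ C * (1 + Real.log 2 * (ε * e)) := by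
      have : C * (1 + Real.log 2 * (ε * e)) =
          1 + Real.log 2 * (ε * e) + 1 / (ε * Real.log 2) + e := by
        rw [hC]; field_simp; ring
      rw [this]
      have : 0 ≤ Real.log 2 * (ε * e) := by positivity
      have : 0 ≤ 1 / (ε * Real.log 2) := by positivity
      linarith
    nlinarith
  have large : ∀ p e : ℕ, B ≤ p → ((e : ℝ) + 1) ≤ (p : ℝ) ^ (ε * e) := by
    intro p e hp
    have h1 : (2 : ℝ) ^ (1 / ε) ≤ p := (Nat.le_ceil _).trans (by exact_mod_cast hp)
    have h2 : (2 : ℝ) ≤ (p : ℝ) ^ ε := by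
      calc (2 : ℝ) = ((2 : ℝ) ^ (1 / ε)) ^ ε := by
            rw [← Real.rpow_mul (by norm_num), one_div_mul_cancel hε.ne', Real.rpow_one]
        _ ≤ _ := Real.rpow_le_rpow (by positivity) h1 hε.le
    rw [Real.rpow_mul (by positivity), Real.rpow_natCast]
    calc ((e : ℝ) + 1) ≤ 2 ^ e := by exact_mod_cast Nat.lt_two_pow_self
      _ ≤ _ := pow_le_pow_left₀ (by norm_num) h2 _
  refine ⟨C ^ B, one_le_pow₀ hC1, fun n hn => ?_⟩
  have hfac : (n : ℝ) ^ ε = ∏ p ∈ n.primeFactors, (p : ℝ) ^ (ε * n.factorization p) := by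
    conv_lhs => rw [← Nat.prod_factorization_pow_eq_self hn]
    rw [Finsupp.prod, Nat.support_factorization, Nat.cast_prod,
      ← Real.finsetProd_rpow _ _ (fun _ _ => by positivity)]
    refine Finset.prod_congr rfl fun p _ => ?_
    rw [Nat.cast_pow, ← Real.rpow_natCast, ← Real.rpow_mul (by positivity), mul_comm]
  rw [Nat.card_divisors hn, Nat.cast_prod, hfac]
  calc ∏ p ∈ n.primeFactors, ((n.factorization p + 1 : ℕ) : ℝ)
      ≤ ∏ p ∈ n.primeFactors, ((if p < B then C else 1) * (p : ℝ) ^ (ε * n.factorization p)) := by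
        refine Finset.prod_le_prod (fun _ _ => by positivity) fun p hp => ?_
        push_cast
        split_ifs with h
        · exact small p _ (Nat.prime_of_mem_primeFactors hp).two_le
        · rw [one_mul]; exact large p _ (not_lt.mp h)
    _ = (∏ p ∈ n.primeFactors, (if p < B then C else 1)) *
        ∏ p ∈ n.primeFactors, (p : ℝ) ^ (ε * n.factorization p) := Finset.prod_mul_distrib
    _ ≤ _ := by
        refine mul_le_mul_of_nonneg_right ?_ (Finset.prod_nonneg fun _ _ => by positivity)
        rw [Finset.prod_ite, Finset.prod_const, Finset.prod_const_one, mul_one]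
        refine pow_le_pow_right₀ hC1 ?_
        calc _ ≤ (Finset.range B).card := Finset.card_le_card fun p hp => by
              simpa using (Finset.mem_filter.mp hp).2
          _ = B := Finset.card_range B

/-- The points of `ℤ × ℤ` with both coordinates at most `B` in absolute value. -/
noncomputable def intBox (B : ℕ) : Finset (ℤ × ℤ) :=
  Finset.Icc (-(B : ℤ)) B ×ˢ Finset.Icc (-(B : ℤ)) B

theorem mem_intBox {B : ℕ} {p : ℤ × ℤ} : p ∈ intBox B ↔ |p.1| ≤ B ∧ |p.2| ≤ B := by
  simp [intBox, abs_le]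

theorem pell_two_mul_le {Δ u v u' v' : ℤ} (hΔ : 0 < Δ) (hu : 0 ≤ u) (hv : 0 < v) (hu' : 0 ≤ u')
    (h : u ^ 2 - Δ * v ^ 2 = 1) (h' : u' ^ 2 - Δ * v' ^ 2 = 1) (hlt : v < v') :
    2 * v ≤ v' := by
  have hpos : 0 < u := by nlinarith [mul_pos hΔ (mul_pos hv hv)]
  have hpos' : 0 < u' := by nlinarith [mul_pos hΔ (mul_pos hv (hv.trans hlt))]
  have hvu : v ≤ u := by nlinarith [mul_pos hv hv]
  have h1 : 1 ≤ u * v' - u' * v := by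
    have : (u' * v) ^ 2 < (u * v') ^ 2 := by
      have : (u * v') ^ 2 - (u' * v) ^ 2 = v' ^ 2 - v ^ 2 := by
        linear_combination v' ^ 2 * h - v ^ 2 * h'
      nlinarith
    have := lt_of_pow_lt_pow_left₀ 2 (by nlinarith [mul_pos hpos (hv.trans hlt)]) this
    linarith
  have h2 : 1 ≤ u * u' - Δ * v * v' := by
    have : (Δ * v * v') ^ 2 < (u * u') ^ 2 := by
      have : (u * u') ^ 2 - (Δ * v * v') ^ 2 = 1 + Δ * v ^ 2 + Δ * v' ^ 2 := by
        linear_combination u' ^ 2 * h + (Δ * v ^ 2 + 1) * h'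
      nlinarith [mul_pos hΔ (mul_pos hv hv), mul_nonneg hΔ.le (sq_nonneg v')]
    have := lt_of_pow_lt_pow_left₀ 2 (by positivity) this
    linarith
  have h3 : v' = u * (u * v' - u' * v) + v * (u * u' - Δ * v * v') := by
    linear_combination -v' * h
  nlinarith

theorem card_pell_units_le {Δ : ℤ} (hΔ : Δ ≠ 0) (B : ℕ) :
    ((intBox B).filter fun p => p.1 ^ 2 - Δ * p.2 ^ 2 = 1).card ≤ 9 * (Nat.log 2 B + 1) := by
  have hcard : ((Finset.Icc (-1 : ℤ) 1 ×ˢ Finset.Icc (-1 : ℤ) 1) ×ˢ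
      Finset.range (Nat.log 2 B + 1)).card = 9 * (Nat.log 2 B + 1) := by
    simp
  have sgn : ∀ x : ℤ, x.sign ∈ Finset.Icc (-1 : ℤ) 1 := by
    intro x
    rcases lt_trichotomy x 0 with h | h | h
    · simp [Int.sign_eq_neg_one_of_neg h]
    · simp [h]
    · simp [Int.sign_eq_one_of_pos h]
  rw [← hcard]
  refine Finset.card_le_card_of_injOn
    (fun p => ((p.1.sign, p.2.sign), Nat.log 2 p.2.natAbs)) ?_ ?_
  · intro p hp
    simp only [Finset.coe_filter, Set.mem_ofPred_eq, mem_intBox] at hp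
    have : p.2.natAbs ≤ B := by have := hp.1.2; rw [Int.abs_eq_natAbs] at this; omega
    simp only [Finset.coe_product, Set.mem_prod, Finset.mem_coe]
    exact ⟨⟨sgn _, sgn _⟩, Finset.mem_range.mpr (Nat.lt_succ_of_le (Nat.log_mono_right this))⟩
  · have key : ∀ u v u' v' : ℤ, u ^ 2 - Δ * v ^ 2 = 1 → u' ^ 2 - Δ * v' ^ 2 = 1 →
        v.sign = v'.sign → Nat.log 2 v.natAbs = Nat.log 2 v'.natAbs → ¬ v.natAbs < v'.natAbs := by
      intro u v u' v' h h' hs hl hlt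
      have hv' : v' ≠ 0 := by rintro rfl; simp at hlt
      have hv : v ≠ 0 := by
        rintro rfl
        rw [Int.sign_zero] at hs
        exact hv' (Int.sign_eq_zero_iff_zero.mp hs.symm)
      have habs : |v| < |v'| := by rw [Int.abs_eq_natAbs, Int.abs_eq_natAbs]; omega
      have hvp : 0 < |v| := abs_pos.mpr hv
      rcases lt_or_gt_of_ne hΔ with hneg | hpos
      · have h4 : 4 ≤ |v'| ^ 2 := by nlinarith
        rw [sq_abs] at h4
        nlinarith [sq_nonneg u']
      · have h2 : 2 * |v| ≤ |v'| := by
          refine pell_two_mul_le (u := |u|) (u' := |u'|) hpos (abs_nonneg _) hvp (abs_nonneg _)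
            ?_ ?_ habs
          · rw [sq_abs, sq_abs]; exact h
          · rw [sq_abs, sq_abs]; exact h'
        have h3 : v.natAbs * 2 ≤ v'.natAbs := by
          rw [Int.abs_eq_natAbs, Int.abs_eq_natAbs] at h2; omega
        have h5 := Nat.log_mono_right (b := 2) h3
        rw [Nat.log_mul_base (by norm_num) (by omega)] at h5
        omega
    intro p hp q hq hpq
    simp only [Finset.coe_filter, Set.mem_ofPred_eq] at hp hq
    simp only [Prod.mk.injEq] at hpq
    obtain ⟨⟨h1, h2⟩, h3⟩ := hpq
    have h4 : p.2.natAbs = q.2.natAbs := le_antisymm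
      (not_lt.mp (key _ _ _ _ hq.2 hp.2 h2.symm h3.symm)) (not_lt.mp (key _ _ _ _ hp.2 hq.2 h2 h3))
    have h5 : p.2 = q.2 := by
      rw [← Int.sign_mul_natAbs p.2, ← Int.sign_mul_natAbs q.2, h2, h4]
    have h6 : p.1.natAbs = q.1.natAbs := by
      rw [Int.natAbs_eq_iff_sq_eq]
      have := hp.2; have := hq.2; rw [h5] at *; linarith
    refine Prod.ext ?_ h5
    rw [← Int.sign_mul_natAbs p.1, ← Int.sign_mul_natAbs q.1, h1, h6]

theorem dvd_two_of_sq_dvd_four_mul {e Δ : ℤ} (hΔ : Squarefree Δ) (h : e ^ 2 ∣ 4 * Δ) : e ∣ 2 := by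
  rcases Int.even_or_odd' e with ⟨k, rfl | rfl⟩
  · have : k * k ∣ Δ := by
      have h' : 4 * (k * k) ∣ 4 * Δ := by convert h using 1; ring
      exact Int.dvd_of_mul_dvd_mul_left (by norm_num) h'
    have := hΔ k this
    simpa using mul_dvd_mul_left 2 (this.dvd (a := 1))
  · have hc : IsCoprime (2 * k + 1) (2 : ℤ) := ⟨1, -k, by ring⟩
    have hc2 : IsCoprime ((2 * k + 1) ^ 2) (4 : ℤ) := by
      have : (4 : ℤ) = 2 ^ 2 := by norm_num
      rw [this]; exact hc.pow
    have := hc2.dvd_of_dvd_mul_left h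
    exact (hΔ _ (by rwa [sq] at this)).dvd

theorem card_sqrt_mod_le {Δ : ℤ} (hΔ : Squarefree Δ) {m : ℕ} (hm : m ≠ 0) :
    ((Finset.Ico (0 : ℤ) m).filter fun z => (m : ℤ) ∣ z ^ 2 - Δ).card ≤ m.divisors.card * 2 := by
  set R := (Finset.Ico (0 : ℤ) m).filter fun z => (m : ℤ) ∣ z ^ 2 - Δ with hR
  rcases R.eq_empty_or_nonempty with h0 | ⟨z₀, hz₀⟩
  · rw [h0]; simp
  have hm' : (m : ℤ) ≠ 0 := by exact_mod_cast hm
  have hcard : (m.divisors ×ˢ (Finset.univ : Finset Bool)).card = m.divisors.card * 2 := by simp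
  have hz₀m : (m : ℤ) ∣ z₀ ^ 2 - Δ := (Finset.mem_filter.mp hz₀).2
  have fact : ∀ z ∈ R, ∃ d₂ : ℤ, (m : ℤ) = Int.gcd (z - z₀) m * d₂ ∧ d₂ ∣ z + z₀ := by
    intro z hz
    have hzm := (Finset.mem_filter.mp hz).2
    obtain ⟨d₂, hd₂⟩ : ((Int.gcd (z - z₀) m : ℕ) : ℤ) ∣ m := Int.gcd_dvd_right ..
    obtain ⟨w, hw⟩ : ((Int.gcd (z - z₀) m : ℕ) : ℤ) ∣ z - z₀ := Int.gcd_dvd_left ..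
    have hg0 : ((Int.gcd (z - z₀) m : ℕ) : ℤ) ≠ 0 := by
      intro h; rw [h, zero_mul] at hd₂; exact hm' hd₂
    refine ⟨d₂, hd₂, ?_⟩
    have hcop : IsCoprime w d₂ := by
      refine ⟨Int.gcdA (z - z₀) m, Int.gcdB (z - z₀) m, ?_⟩
      have := Int.gcd_eq_gcd_ab (z - z₀) m
      refine mul_left_cancel₀ hg0 ?_
      rw [mul_one]
      conv_rhs => rw [this]
      linear_combination -(z - z₀).gcdA m * hw - (z - z₀).gcdB m * hd₂
    have hdiv : (m : ℤ) ∣ (z - z₀) * (z + z₀) := by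
      have := dvd_sub hzm hz₀m
      rwa [show z ^ 2 - Δ - (z₀ ^ 2 - Δ) = (z - z₀) * (z + z₀) by ring] at this
    rw [hw] at hdiv
    nth_rewrite 1 [hd₂] at hdiv
    rw [mul_assoc] at hdiv
    exact hcop.symm.dvd_of_dvd_mul_left (Int.dvd_of_mul_dvd_mul_left hg0 hdiv)
  rw [← hcard]
  refine Finset.card_le_card_of_injOn (fun z => (Int.gcd (z - z₀) m, decide (2 * z < m))) ?_ ?_
  · intro z _
    simp only [Finset.coe_product, Set.mem_prod, Finset.mem_coe, Finset.mem_univ, and_true]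
    exact Nat.mem_divisors.mpr ⟨Int.gcd_dvd_natAbs_right _ _, hm⟩
  · intro z hz z' hz' heq
    simp only [Prod.mk.injEq, decide_eq_decide] at heq
    obtain ⟨d₂, hmd, hd₂⟩ := fact z hz
    obtain ⟨d₂', hmd', hd₂'⟩ := fact z' hz'
    set d₁ : ℤ := ((Int.gcd (z - z₀) m : ℕ) : ℤ) with hd₁
    have hd₁' : ((Int.gcd (z' - z₀) m : ℕ) : ℤ) = d₁ := by rw [hd₁, heq.1]
    rw [hd₁'] at hmd'
    have hd0 : d₁ ≠ 0 := by rintro h; rw [h, zero_mul] at hmd; exact hm' hmd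
    have : d₂' = d₂ := mul_left_cancel₀ hd0 (hmd'.symm.trans hmd)
    subst this
    have hdz : d₁ ∣ z - z₀ := Int.gcd_dvd_left ..
    have hdz' : d₁ ∣ z' - z₀ := by rw [← hd₁']; exact Int.gcd_dvd_left ..
    have hA : d₁ ∣ z - z' := by simpa using dvd_sub hdz hdz'
    have hB : d₂' ∣ z - z' := by simpa using dvd_sub hd₂ hd₂'
    have he2 : ((Int.gcd d₁ d₂' : ℕ) : ℤ) ∣ 2 := by
      set e : ℤ := ((Int.gcd d₁ d₂' : ℕ) : ℤ) with he
      have e1 : e ∣ d₁ := Int.gcd_dvd_left ..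
      have e2 : e ∣ d₂' := Int.gcd_dvd_right ..
      have h1 : e ∣ 2 * z₀ := by
        have := dvd_sub (e2.trans hd₂) (e1.trans hdz)
        rwa [show z + z₀ - (z - z₀) = 2 * z₀ by ring] at this
      have h2 : e ^ 2 ∣ z₀ ^ 2 - Δ := by
        refine dvd_trans ?_ hz₀m
        rw [hmd, sq]; exact mul_dvd_mul e1 e2
      refine dvd_two_of_sq_dvd_four_mul hΔ ?_
      have := dvd_sub (pow_dvd_pow_of_dvd h1 2) (h2.mul_left 4)
      rwa [show (2 * z₀) ^ 2 - 4 * (z₀ ^ 2 - Δ) = 4 * Δ by ring] at this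
    have hm2 : (m : ℤ) ∣ 2 * (z - z') := by
      have hl : ((Int.lcm d₁ d₂' : ℕ) : ℤ) ∣ z - z' := Int.coe_lcm_dvd hA hB
      have : ((Int.gcd d₁ d₂' : ℕ) : ℤ) * ((Int.lcm d₁ d₂' : ℕ) : ℤ) ∣ 2 * (z - z') :=
        mul_dvd_mul he2 hl
      refine dvd_trans ?_ this
      have h3 := Int.gcd_mul_lcm d₁ d₂'
      rw [← Nat.cast_mul, h3, ← Int.natAbs_mul, ← hmd]
      simp
    have hzI := Finset.mem_Ico.mp (Finset.mem_filter.mp hz).1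
    have hzI' := Finset.mem_Ico.mp (Finset.mem_filter.mp hz').1
    have : 2 * (z - z') = 0 := by
      refine Int.eq_zero_of_abs_lt_dvd hm2 ?_
      rw [abs_lt]
      by_cases hc : 2 * z < m
      · have := heq.2.mp hc; constructor <;> linarith [hzI.1, hzI'.1]
      · have : ¬ 2 * z' < m := fun h => hc (heq.2.mpr h)
        push Not at hc this
        constructor <;> linarith [hzI.2, hzI'.2]
    linarith

theorem card_pell_primitive_le {Δ N : ℤ} (hΔ0 : Δ ≠ 0) (hΔ : Squarefree Δ) (hN : N ≠ 0) (L : ℕ) :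
    ((intBox L).filter fun p => p.1 ^ 2 - Δ * p.2 ^ 2 = N ∧ IsCoprime p.1 p.2).card ≤
      9 * (Nat.log 2 (L ^ 2 * (1 + Δ.natAbs)) + 1) * (N.natAbs.divisors.card * 2) := by
  set m := N.natAbs with hm
  have hm0 : m ≠ 0 := by simpa [hm] using hN
  have hmpos : (0 : ℤ) < m := by exact_mod_cast Nat.pos_of_ne_zero hm0
  have hmN : (m : ℤ) ∣ N := by rw [hm]; exact Int.natAbs_dvd.mpr dvd_rfl
  have hNm : N ∣ (m : ℤ) := by rw [hm]; exact Int.dvd_natAbs.mpr dvd_rfl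
  set S := (intBox L).filter fun p => p.1 ^ 2 - Δ * p.2 ^ 2 = N ∧ IsCoprime p.1 p.2 with hS
  have root : ∀ p : ℤ × ℤ, ∃ z : ℤ, p ∈ S →
      z ∈ Finset.Ico (0 : ℤ) m ∧ (m : ℤ) ∣ z ^ 2 - Δ ∧ (m : ℤ) ∣ p.1 - z * p.2 := by
    intro p
    by_cases hp : p ∈ S
    swap
    · exact ⟨0, fun h => absurd h hp⟩
    obtain ⟨_, heq, hcop⟩ := Finset.mem_filter.mp hp
    have hc : IsCoprime p.2 (m : ℤ) := by
      have h1 : IsCoprime p.2 N := by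
        rw [← heq, show p.1 ^ 2 - Δ * p.2 ^ 2 = p.1 ^ 2 + p.2 * (-(Δ * p.2)) by ring]
        exact (hcop.symm.pow_right).add_mul_left_right _
      exact h1.of_isCoprime_of_dvd_right hmN
    obtain ⟨a, b, hab⟩ := hc
    refine ⟨(p.1 * a) % m, fun _ => ⟨Finset.mem_Ico.mpr
      ⟨Int.emod_nonneg _ hmpos.ne', Int.emod_lt_of_pos _ hmpos⟩, ?_⟩⟩
    have hz : (m : ℤ) ∣ p.1 * a - (p.1 * a) % m := Int.dvd_self_sub_emod
    have h2 : (m : ℤ) ∣ p.1 - (p.1 * a) % m * p.2 := by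
      obtain ⟨k, hk⟩ := hz
      exact ⟨k * p.2 + p.1 * b, by linear_combination p.2 * hk - p.1 * hab⟩
    refine ⟨?_, h2⟩
    obtain ⟨k, hk⟩ := h2
    obtain ⟨j, hj⟩ := hmN
    have h3 : (m : ℤ) ∣ p.2 ^ 2 * (((p.1 * a) % m) ^ 2 - Δ) := by
      refine ⟨j - k * (p.1 + (p.1 * a) % m * p.2), ?_⟩
      linear_combination heq + hj - (p.1 + (p.1 * a) % m * p.2) * hk
    refine IsCoprime.dvd_of_dvd_mul_left ?_ h3
    exact (IsCoprime.pow_left ⟨a, b, hab⟩ : IsCoprime (p.2 ^ 2) (m : ℤ)).symm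
  choose z hz using root
  refine (Finset.card_le_mul_card_image (f := z) S (9 * (Nat.log 2 (L ^ 2 * (1 + Δ.natAbs)) + 1))
    ?_).trans ?_
  · intro t _
    rcases (S.filter fun p => z p = t).eq_empty_or_nonempty with h0 | ⟨q, hq⟩
    · rw [h0]; simp
    obtain ⟨hqS, hqt⟩ := Finset.mem_filter.mp hq
    obtain ⟨hqB, hqe, _⟩ := Finset.mem_filter.mp hqS
    refine le_trans ?_ (card_pell_units_le hΔ0 (L ^ 2 * (1 + Δ.natAbs)))
    have hdiv : ∀ p ∈ S, z p = t → ∃ U V : ℤ,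
        p.1 * q.1 - Δ * p.2 * q.2 = N * U ∧ p.1 * q.2 - p.2 * q.1 = N * V := by
      intro p hp hpt
      have h1 := (hz p hp).2.2
      have h2 := (hz q hqS).2.2
      rw [hpt] at h1
      rw [hqt] at h2
      have hV : N ∣ p.1 * q.2 - p.2 * q.1 := by
        have := hNm.trans (dvd_sub (h1.mul_left q.2) (h2.mul_left p.2))
        rwa [show q.2 * (p.1 - t * p.2) - p.2 * (q.1 - t * q.2) = p.1 * q.2 - p.2 * q.1 by ring]
          at this
      have hU : N ^ 2 ∣ (p.1 * q.1 - Δ * p.2 * q.2) ^ 2 := by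
        have : (p.1 * q.1 - Δ * p.2 * q.2) ^ 2 = N ^ 2 + Δ * (p.1 * q.2 - p.2 * q.1) ^ 2 := by
          have hpe := (Finset.mem_filter.mp hp).2.1
          linear_combination (q.1 ^ 2 - Δ * q.2 ^ 2) * hpe + N * hqe
        rw [this]
        exact dvd_add dvd_rfl ((pow_dvd_pow_of_dvd hV 2).mul_left _)
      obtain ⟨U, hU⟩ := (Int.pow_dvd_pow_iff two_ne_zero).mp hU
      obtain ⟨V, hV⟩ := hV
      exact ⟨U, V, hU, hV⟩
    refine Finset.card_le_card_of_injOn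
      (fun p => ((p.1 * q.1 - Δ * p.2 * q.2) / N, (p.1 * q.2 - p.2 * q.1) / N)) ?_ ?_
    · intro p hp
      obtain ⟨hpS, hpt⟩ := Finset.mem_filter.mp (Finset.mem_coe.mp hp)
      obtain ⟨hpB, hpe, _⟩ := Finset.mem_filter.mp hpS
      obtain ⟨U, V, hU, hV⟩ := hdiv p hpS hpt
      simp only [hU, hV, Int.mul_ediv_cancel_left _ hN]
      have hN2 : N ^ 2 ≠ 0 := pow_ne_zero 2 hN
      rw [Finset.mem_coe, Finset.mem_filter, mem_intBox]
      rw [mem_intBox] at hpB hqB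
      have hN1 : 1 ≤ |N| := Int.one_le_abs hN
      have hD1 : 1 ≤ |Δ| := Int.one_le_abs hΔ0
      have hLn : (0 : ℤ) ≤ L := by positivity
      have ab : ∀ {a b : ℤ}, |a| ≤ L → |b| ≤ L → |a * b| ≤ (L : ℤ) ^ 2 := by
        intro a b ha hb
        rw [abs_mul, sq]
        exact mul_le_mul ha hb (abs_nonneg _) hLn
      have hB : ((L ^ 2 * (1 + Δ.natAbs) : ℕ) : ℤ) = (L : ℤ) ^ 2 * (1 + |Δ|) := by
        push_cast; rfl
      rw [hB]
      refine ⟨⟨?_, ?_⟩, ?_⟩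
      · calc |U| ≤ |N| * |U| := le_mul_of_one_le_left (abs_nonneg _) hN1
          _ = |p.1 * q.1 - Δ * p.2 * q.2| := by rw [hU, abs_mul]
          _ ≤ |p.1 * q.1| + |Δ * p.2 * q.2| := abs_sub _ _
          _ ≤ _ := by
            rw [mul_assoc, abs_mul Δ]
            nlinarith [ab hpB.1 hqB.1, ab hpB.2 hqB.2, abs_nonneg Δ]
      · calc |V| ≤ |N| * |V| := le_mul_of_one_le_left (abs_nonneg _) hN1
          _ = |p.1 * q.2 - p.2 * q.1| := by rw [hV, abs_mul]
          _ ≤ |p.1 * q.2| + |p.2 * q.1| := abs_sub _ _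
          _ ≤ _ := by
            nlinarith [ab hpB.1 hqB.2, ab hpB.2 hqB.1, sq_nonneg (L : ℤ)]
      · refine mul_left_cancel₀ hN2 ?_
        linear_combination (q.1 ^ 2 - Δ * q.2 ^ 2) * hpe + N * hqe -
          (p.1 * q.1 - Δ * p.2 * q.2 + N * U) * hU + Δ * (p.1 * q.2 - p.2 * q.1 + N * V) * hV
    · intro p hp p' hp' heq
      obtain ⟨hpS, hpt⟩ := Finset.mem_filter.mp (Finset.mem_coe.mp hp)
      obtain ⟨hpS', hpt'⟩ := Finset.mem_filter.mp (Finset.mem_coe.mp hp')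
      obtain ⟨U, V, hU, hV⟩ := hdiv p hpS hpt
      obtain ⟨U', V', hU', hV'⟩ := hdiv p' hpS' hpt'
      simp only [hU, hV, hU', hV', Int.mul_ediv_cancel_left _ hN, Prod.mk.injEq] at heq
      obtain ⟨rfl, rfl⟩ := heq
      refine Prod.ext (mul_left_cancel₀ hN ?_) (mul_left_cancel₀ hN ?_)
      · linear_combination (p'.1 - p.1) * hqe + q.1 * (hU - hU') - Δ * q.2 * (hV - hV')
      · linear_combination (p'.2 - p.2) * hqe + q.2 * (hU - hU') - q.1 * (hV - hV')
  · refine Nat.mul_le_mul_left _ (le_trans (Finset.card_le_card fun t ht => ?_)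
      (card_sqrt_mod_le hΔ hm0))
    obtain ⟨p, hp, rfl⟩ := Finset.mem_image.mp ht
    exact Finset.mem_filter.mpr ⟨(hz p hp).1, (hz p hp).2.1⟩

theorem card_pell_squarefree_le {Δ N : ℤ} (hΔ0 : Δ ≠ 0) (hΔ : Squarefree Δ) (hN : N ≠ 0) (L : ℕ) :
    ((intBox L).filter fun p => p.1 ^ 2 - Δ * p.2 ^ 2 = N).card ≤
      9 * (Nat.log 2 (L ^ 2 * (1 + Δ.natAbs)) + 1) * (N.natAbs.divisors.card * 2) *
        N.natAbs.divisors.card := by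
  set S := (intBox L).filter fun p => p.1 ^ 2 - Δ * p.2 ^ 2 = N with hS
  have hdvd : ∀ p ∈ S, ((Int.gcd p.1 p.2 : ℕ) : ℤ) ^ 2 ∣ N := by
    intro p hp
    rw [← (Finset.mem_filter.mp hp).2]
    exact dvd_sub (pow_dvd_pow_of_dvd (Int.gcd_dvd_left ..) 2)
      ((pow_dvd_pow_of_dvd (Int.gcd_dvd_right ..) 2).mul_left _)
  refine (Finset.card_le_mul_card_image (f := fun p => Int.gcd p.1 p.2) S
    (9 * (Nat.log 2 (L ^ 2 * (1 + Δ.natAbs)) + 1) * (N.natAbs.divisors.card * 2)) ?_).trans ?_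
  · intro g hg
    obtain ⟨q, hq, rfl⟩ := Finset.mem_image.mp hg
    obtain ⟨N', hN'⟩ := hdvd q hq
    set g := Int.gcd q.1 q.2 with hgdef
    have hN'0 : N' ≠ 0 := by rintro rfl; simp at hN'; exact hN hN'
    have hg0 : (g : ℤ) ≠ 0 := by intro h; rw [h] at hN'; simp at hN'; exact hN hN'
    have hgpos : (1 : ℤ) ≤ g := by omega
    refine (le_trans ?_ (card_pell_primitive_le hΔ0 hΔ hN'0 L)).trans ?_
    · refine Finset.card_le_card_of_injOn (fun p => (p.1 / g, p.2 / g)) ?_ ?_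
      · intro p hp
        obtain ⟨hpS, hpg⟩ := Finset.mem_filter.mp (Finset.mem_coe.mp hp)
        obtain ⟨hpB, hpe⟩ := Finset.mem_filter.mp hpS
        have h1 : (g : ℤ) ∣ p.1 := by rw [← hpg]; exact Int.gcd_dvd_left ..
        have h2 : (g : ℤ) ∣ p.2 := by rw [← hpg]; exact Int.gcd_dvd_right ..
        have hcop : IsCoprime (p.1 / (g : ℤ)) (p.2 / (g : ℤ)) := by
          rw [Int.isCoprime_iff_gcd_eq_one, ← hpg]
          exact Int.gcd_ediv_gcd_ediv_gcd (by rw [hpg]; omega)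
        obtain ⟨a, ha⟩ := h1
        obtain ⟨b, hb⟩ := h2
        simp only [ha, hb, Int.mul_ediv_cancel_left _ hg0] at hcop ⊢
        rw [mem_intBox, ha, hb] at hpB
        rw [Finset.mem_coe, Finset.mem_filter, mem_intBox]
        have hle : ∀ x : ℤ, |(g : ℤ) * x| ≤ L → |x| ≤ L := by
          intro x hx
          rw [abs_mul, abs_of_pos (by omega)] at hx
          nlinarith [abs_nonneg x]
        refine ⟨⟨hle _ hpB.1, hle _ hpB.2⟩, ?_, hcop⟩
        refine mul_left_cancel₀ (pow_ne_zero 2 hg0) ?_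
        rw [← hN', ← hpe, ha, hb]; ring
      · intro p hp p' hp' heq
        obtain ⟨-, hpg⟩ := Finset.mem_filter.mp (Finset.mem_coe.mp hp)
        obtain ⟨-, hpg'⟩ := Finset.mem_filter.mp (Finset.mem_coe.mp hp')
        have h1 : (g : ℤ) ∣ p.1 := by rw [← hpg]; exact Int.gcd_dvd_left ..
        have h2 : (g : ℤ) ∣ p.2 := by rw [← hpg]; exact Int.gcd_dvd_right ..
        have h3 : (g : ℤ) ∣ p'.1 := by rw [← hpg']; exact Int.gcd_dvd_left ..
        have h4 : (g : ℤ) ∣ p'.2 := by rw [← hpg']; exact Int.gcd_dvd_right ..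
        simp only [Prod.mk.injEq] at heq
        exact Prod.ext ((Int.ediv_left_inj h1 h3).mp heq.1) ((Int.ediv_left_inj h2 h4).mp heq.2)
    · refine Nat.mul_le_mul_left _ (Nat.mul_le_mul_right _ (Finset.card_le_card ?_))
      refine Nat.divisors_subset_of_dvd (by simpa using hN) (Int.natAbs_dvd_natAbs.mpr ?_)
      exact ⟨(g : ℤ) ^ 2, by rw [hN']; ring⟩
  · refine Nat.mul_le_mul_left _ (Finset.card_le_card fun t ht => ?_)
    obtain ⟨p, hp, rfl⟩ := Finset.mem_image.mp ht
    refine Nat.mem_divisors.mpr ⟨?_, by simpa using hN⟩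
    have := (Dvd.intro_left _ (sq _).symm : ((Int.gcd p.1 p.2 : ℕ) : ℤ) ∣ _).trans (hdvd p hp)
    exact Int.natCast_dvd.mp this

theorem card_pell_le {Δ N : ℤ} (hΔ : Δ ≠ 0) (hN : N ≠ 0) {L : ℕ} (hL : Δ.natAbs ≤ L) :
    ((intBox L).filter fun p => p.1 ^ 2 - Δ * p.2 ^ 2 = N).card ≤
      9 * (Nat.log 2 (L ^ 4 * (1 + L)) + 1) * (N.natAbs.divisors.card * 2) *
        N.natAbs.divisors.card := by
  obtain ⟨a, b, hab, ha⟩ := Nat.sq_mul_squarefree Δ.natAbs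
  have hΔn : Δ.natAbs ≠ 0 := by simpa using hΔ
  have ha0 : a ≠ 0 := by rintro rfl; simp at hab; exact hΔn hab.symm
  have hb0 : b ≠ 0 := by rintro rfl; simp at hab; exact hΔn hab.symm
  set Δ₀ : ℤ := Δ.sign * a with hΔ₀
  have hΔeq : Δ = b ^ 2 * Δ₀ := by
    conv_lhs => rw [← Int.sign_mul_natAbs Δ, ← hab]
    rw [hΔ₀]; push_cast; ring
  have habs : Δ₀.natAbs = a := by
    rw [hΔ₀, Int.natAbs_mul, Int.natAbs_sign_of_ne_zero hΔ]; simp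
  have hΔ₀0 : Δ₀ ≠ 0 := by rw [← Int.natAbs_ne_zero, habs]; exact ha0
  have hsq : Squarefree Δ₀ := by rw [← Int.squarefree_natAbs, habs]; exact ha
  have hbL : b ≤ L := by
    refine le_trans ?_ hL
    rw [← hab]; nlinarith [Nat.pos_of_ne_zero ha0, Nat.pos_of_ne_zero hb0]
  have haL : a ≤ L := by
    refine le_trans ?_ hL
    rw [← hab]; exact Nat.le_mul_of_pos_left a (by positivity)
  refine (le_trans ?_ (card_pell_squarefree_le hΔ₀0 hsq hN (L ^ 2))).trans ?_
  · refine Finset.card_le_card_of_injOn (fun p => (p.1, b * p.2)) ?_ ?_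
    · intro p hp
      obtain ⟨hpB, hpe⟩ := Finset.mem_filter.mp (Finset.mem_coe.mp hp)
      rw [mem_intBox] at hpB
      rw [Finset.mem_coe, Finset.mem_filter, mem_intBox]
      have hb' : (b : ℤ) ≤ L := by exact_mod_cast hbL
      have hb1 : (1 : ℤ) ≤ b := by omega
      refine ⟨⟨?_, ?_⟩, ?_⟩
      · push_cast; nlinarith [hpB.1]
      · push_cast
        rw [abs_mul, Nat.abs_cast, sq]
        exact mul_le_mul hb' hpB.2 (abs_nonneg _) (by positivity)
      · rw [← hpe, hΔeq]; ring
    · intro p _ p' _ heq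
      simp only [Prod.mk.injEq] at heq
      exact Prod.ext heq.1 (mul_left_cancel₀ (by exact_mod_cast hb0) heq.2)
  · refine Nat.mul_le_mul_right _ (Nat.mul_le_mul_right _ (Nat.mul_le_mul_left _
      (Nat.add_le_add_right (Nat.log_mono_right ?_) 1)))
    rw [habs, ← pow_mul]
    exact Nat.mul_le_mul_left _ (Nat.add_le_add_left haL 1)

theorem natLog_le_rpow {ε : ℝ} (hε : 0 < ε) :
    ∃ K : ℝ, 1 ≤ K ∧ ∀ n : ℕ, n ≠ 0 → ((Nat.log 2 n : ℝ) + 1) ≤ K * (n : ℝ) ^ ε := by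
  refine ⟨1 / (ε * Real.log 2) + 1, by
    have := Real.log_pos one_lt_two
    linarith [show 0 < 1 / (ε * Real.log 2) by positivity], fun n hn => ?_⟩
  have hl := Real.log_pos one_lt_two
  have hn1 : (1 : ℝ) ≤ n := by exact_mod_cast Nat.one_le_iff_ne_zero.mpr hn
  have h1 : (Nat.log 2 n : ℝ) ≤ Real.log n / Real.log 2 := by
    have := Real.natLog_le_logb n 2
    simpa [Real.logb] using this
  have h2 := Real.log_le_rpow_div (by positivity : (0 : ℝ) ≤ n) hε
  have h3 : (1 : ℝ) ≤ (n : ℝ) ^ ε := Real.one_le_rpow hn1 hε.le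
  calc (Nat.log 2 n : ℝ) + 1 ≤ ((n : ℝ) ^ ε / ε) / Real.log 2 + (n : ℝ) ^ ε := by
        gcongr; exact h1.trans (by gcongr)
    _ = _ := by field_simp

theorem card_pell_le_rpow {ε : ℝ} (hε : 0 < ε) :
    ∃ K : ℝ, 0 ≤ K ∧ ∀ (L : ℕ) (Δ N : ℤ), Δ ≠ 0 → N ≠ 0 → Δ.natAbs ≤ L → N.natAbs ≤ L →
      (((intBox L).filter fun p => p.1 ^ 2 - Δ * p.2 ^ 2 = N).card : ℝ) ≤ K * (L : ℝ) ^ ε := by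
  obtain ⟨K₁, hK₁, h₁⟩ := card_divisors_le_rpow (show 0 < ε / 3 by positivity)
  obtain ⟨K₂, hK₂, h₂⟩ := natLog_le_rpow (show 0 < ε / 18 by positivity)
  refine ⟨9 * (K₂ * 2 ^ (ε / 18)) * (K₁ * 2) * K₁, by positivity, fun L Δ N hΔ hN hL hL' => ?_⟩
  have hL0 : L ≠ 0 := by
    rintro rfl; exact hN (by simpa using hL')
  have hL1 : (1 : ℝ) ≤ L := by exact_mod_cast Nat.one_le_iff_ne_zero.mpr hL0
  have hd : (N.natAbs.divisors.card : ℝ) ≤ K₁ * (L : ℝ) ^ (ε / 3) := by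
    refine (h₁ _ (by simpa using hN)).trans ?_
    gcongr
  have hlog : ((Nat.log 2 (L ^ 4 * (1 + L)) : ℝ) + 1) ≤ K₂ * 2 ^ (ε / 18) * (L : ℝ) ^ (ε / 3) := by
    refine (h₂ _ (by positivity)).trans ?_
    rw [mul_assoc]
    gcongr
    calc (((L ^ 4 * (1 + L) : ℕ) : ℝ)) ^ (ε / 18) ≤ (2 * (L : ℝ) ^ 6) ^ (ε / 18) := by
          refine Real.rpow_le_rpow (by positivity) ?_ (by positivity)
          push_cast
          nlinarith [pow_le_pow_left₀ (by norm_num) hL1 4,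
            pow_le_pow_right₀ hL1 (show 5 ≤ 6 by norm_num),
            pow_le_pow_right₀ hL1 (show 4 ≤ 5 by norm_num)]
      _ = _ := by
          rw [Real.mul_rpow (by norm_num) (by positivity), ← Real.rpow_natCast,
            ← Real.rpow_mul (by positivity)]
          congr 2; push_cast; ring
  have hcard := card_pell_le hΔ hN hL
  calc (((intBox L).filter fun p => p.1 ^ 2 - Δ * p.2 ^ 2 = N).card : ℝ)
      ≤ ((9 * (Nat.log 2 (L ^ 4 * (1 + L)) + 1) * (N.natAbs.divisors.card * 2) *
        N.natAbs.divisors.card : ℕ) : ℝ) := by exact_mod_cast hcard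
    _ = 9 * ((Nat.log 2 (L ^ 4 * (1 + L)) : ℝ) + 1) * (N.natAbs.divisors.card * 2) *
        N.natAbs.divisors.card := by push_cast; ring
    _ ≤ 9 * (K₂ * 2 ^ (ε / 18) * (L : ℝ) ^ (ε / 3)) * (K₁ * (L : ℝ) ^ (ε / 3) * 2) *
        (K₁ * (L : ℝ) ^ (ε / 3)) := by gcongr
    _ = 9 * (K₂ * 2 ^ (ε / 18)) * (K₁ * 2) * K₁ *
        ((L : ℝ) ^ (ε / 3) * (L : ℝ) ^ (ε / 3) * (L : ℝ) ^ (ε / 3)) := by ring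
    _ = _ := by
        rw [← Real.rpow_add (by positivity), ← Real.rpow_add (by positivity)]
        congr 2; ring

theorem card_conic_le_rpow {ε : ℝ} (hε : 0 < ε) :
    ∃ K : ℝ, 0 ≤ K ∧ ∀ (H Q : ℕ) (A B E D F G : ℤ), 1 ≤ H → Q ≤ H →
      |A| ≤ H → |B| ≤ H → |E| ≤ H → |D| ≤ H → |F| ≤ H → |G| ≤ H →
      A ≠ 0 → B ^ 2 - 4 * A * E ≠ 0 →
      A * F ^ 2 - B * D * F + E * D ^ 2 + G * (B ^ 2 - 4 * A * E) ≠ 0 →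
      (((intBox Q).filter fun p => A * p.1 ^ 2 + B * (p.1 * p.2) + E * p.2 ^ 2 + D * p.1 +
        F * p.2 + G = 0).card : ℝ) ≤ K * (H : ℝ) ^ ε := by
  obtain ⟨K, hK, h⟩ := card_pell_le_rpow (ε := ε / 4) (by positivity)
  refine ⟨K * 32 ^ (ε / 4), by positivity, fun H Q A B E D F G hH hQ hA hB hE hD hF hG hA0 hΔ hd => ?_⟩
  have hH' : (1 : ℤ) ≤ H := by exact_mod_cast hH
  have hQ' : (Q : ℤ) ≤ H := by exact_mod_cast hQ
  have m2 : ∀ {x y : ℤ} {m n : ℕ} , |x| ≤ (H : ℤ) ^ m → |y| ≤ (H : ℤ) ^ n →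
      |x * y| ≤ (H : ℤ) ^ (m + n) := by
    intro x y m n hx hy
    rw [abs_mul, pow_add]
    exact mul_le_mul hx hy (abs_nonneg _) (by positivity)
  rw [← pow_one (H : ℤ)] at hA hB hE hD hF hG
  have hBB : |B * B| ≤ (H : ℤ) ^ 2 := m2 hB hB
  have hAE : |A * E| ≤ (H : ℤ) ^ 2 := m2 hA hE
  have hAF : |A * F| ≤ (H : ℤ) ^ 2 := m2 hA hF
  have hBD : |B * D| ≤ (H : ℤ) ^ 2 := m2 hB hD
  have hDD : |D * D| ≤ (H : ℤ) ^ 2 := m2 hD hD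
  have hAFF : |A * F * F| ≤ (H : ℤ) ^ 3 := m2 hAF hF
  have hBDF : |B * D * F| ≤ (H : ℤ) ^ 3 := m2 hBD hF
  have hEDD : |E * (D * D)| ≤ (H : ℤ) ^ 3 := m2 hE hDD
  have hGBB : |G * (B * B)| ≤ (H : ℤ) ^ 3 := m2 hG hBB
  have hGAE : |G * (A * E)| ≤ (H : ℤ) ^ 3 := m2 hG hAE
  have h12 : (H : ℤ) ≤ (H : ℤ) ^ 2 := by nlinarith
  have h23 : (H : ℤ) ^ 2 ≤ (H : ℤ) ^ 3 := by nlinarith [sq_nonneg (H : ℤ)]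
  have h34 : (H : ℤ) ^ 3 ≤ (H : ℤ) ^ 4 := by nlinarith [pow_nonneg (by linarith : (0 : ℤ) ≤ H) 3]
  have hΔb : |B ^ 2 - 4 * A * E| ≤ 5 * (H : ℤ) ^ 2 := by
    rw [show B ^ 2 - 4 * A * E = B * B - 4 * (A * E) by ring]
    rw [abs_le] at hBB hAE ⊢; constructor <;> linarith
  have hdb : |A * F ^ 2 - B * D * F + E * D ^ 2 + G * (B ^ 2 - 4 * A * E)| ≤ 8 * (H : ℤ) ^ 3 := by
    rw [show A * F ^ 2 - B * D * F + E * D ^ 2 + G * (B ^ 2 - 4 * A * E) =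
      A * F * F - B * D * F + E * (D * D) + G * (B * B) - 4 * (G * (A * E)) by ring]
    rw [abs_le] at hAFF hBDF hEDD hGBB hGAE ⊢
    constructor <;> linarith
  set L : ℕ := 32 * H ^ 4 with hL
  have hLz : (L : ℤ) = 32 * (H : ℤ) ^ 4 := by rw [hL]; push_cast; ring
  set Δ := B ^ 2 - 4 * A * E with hΔd
  set disc := A * F ^ 2 - B * D * F + E * D ^ 2 + G * Δ with hdisc
  have hLΔ : Δ.natAbs ≤ L := by
    zify; rw [hLz]; linarith [pow_nonneg (by linarith : (0 : ℤ) ≤ H) 4]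
  have hLN : (4 * A * disc).natAbs ≤ L := by
    zify; rw [hLz, abs_mul, abs_mul]
    have : |A| * |disc| ≤ (H : ℤ) ^ 1 * (8 * (H : ℤ) ^ 3) :=
      mul_le_mul hA hdb (abs_nonneg _) (by positivity)
    norm_num
    linarith [show (H : ℤ) ^ 1 * (8 * (H : ℤ) ^ 3) = 8 * (H : ℤ) ^ 4 by ring]
  have key := h L Δ (4 * A * disc) hΔ (by positivity) hLΔ hLN
  calc _ ≤ (((intBox L).filter fun p => p.1^2 - Δ*p.2^2 = 4 * A * disc).card:ℝ) := by
        norm_cast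
        refine Finset.card_le_card_of_injOn
          (fun p => (Δ * p.2 - (2 * A * F - B * D), 2 * A * p.1 + B * p.2 + D)) ?_ ?_
        · intro p hp
          obtain ⟨hpB, hpe⟩ := Finset.mem_filter.mp (Finset.mem_coe.mp hp)
          rw [mem_intBox] at hpB
          rw [Finset.mem_coe, Finset.mem_filter, mem_intBox]
          refine ⟨⟨?_, ?_⟩, ?_⟩
          · have : |Δ * p.2| ≤ 5 * (H : ℤ) ^ 2 * H := by
              rw [abs_mul]
              exact mul_le_mul hΔb (hpB.2.trans hQ') (abs_nonneg _) (by positivity)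
            rw [hLz]
            simp only [mul_assoc 2 A F]
            rw [show 5 * (H : ℤ) ^ 2 * H = 5 * (H : ℤ) ^ 3 by ring] at this
            rw [abs_le] at this hAF hBD ⊢
            constructor <;> linarith
          · have h1 : |A * p.1| ≤ (H : ℤ) ^ 2 := m2 hA (show |p.1| ≤ (H : ℤ) ^ 1 by linarith [hpB.1])
            have h2 : |B * p.2| ≤ (H : ℤ) ^ 2 := m2 hB (show |p.2| ≤ (H : ℤ) ^ 1 by linarith [hpB.2])
            rw [hLz]
            simp only [mul_assoc 2 A p.1]
            rw [abs_le] at h1 h2 hD ⊢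
            rw [pow_one] at hD
            constructor <;> linarith
          · simp only [hdisc, hΔd]
            linear_combination (-4 * A * (B ^ 2 - 4 * A * E)) * hpe
        · intro p _ p' _ hpp
          simp only [Prod.mk.injEq] at hpp
          obtain ⟨h1, h2⟩ := hpp
          have e2 : p.2 = p'.2 := mul_left_cancel₀ hΔ (by linarith)
          rw [e2] at h2
          have e1 : p.1 = p'.1 := mul_left_cancel₀ (mul_ne_zero two_ne_zero hA0) (by linarith)
          exact Prod.ext e1 e2
    _ ≤ K * (L : ℝ) ^ (ε / 4) := key
    _ = _ := by
        rw [hL]; push_cast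
        rw [Real.mul_rpow (by norm_num) (by positivity), ← Real.rpow_natCast (H : ℝ) 4,
          ← Real.rpow_mul (by positivity), mul_assoc]
        congr 3; push_cast; ring

theorem card_roots_filter_le {p : Polynomial ℤ} {d : ℕ} (hp : p ≠ 0) (hd : p.natDegree ≤ d)
    (S : Finset ℤ) (P : ℤ → Prop) [DecidablePred P] (h : ∀ x, P x → p.eval x = 0) :
    (S.filter P).card ≤ d := by
  refine le_trans (Finset.card_le_card ?_) ((Multiset.toFinset_card_le _).trans
    ((Polynomial.card_roots' p).trans hd))
  intro x hx
  rw [Multiset.mem_toFinset, Polynomial.mem_roots hp]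
  exact h x (Finset.mem_filter.mp hx).2

theorem card_degenerate_conic_le (Q : ℕ) (A B E D F G : ℤ) (h : A ≠ 0 ∨ B ≠ 0) :
    ((intBox Q).filter fun p => A * p.1 ^ 2 + B * (p.1 * p.2) + E * p.2 ^ 2 + D * p.1 +
        F * p.2 + G = 0).card ≤ 2 * (2 * Q + 1) := by
  set I := Finset.Icc (-(Q : ℤ)) Q with hI
  have hIc : I.card = 2 * Q + 1 := by rw [hI, Int.card_Icc]; omega
  set S := (intBox Q).filter fun p => A * p.1 ^ 2 + B * (p.1 * p.2) + E * p.2 ^ 2 + D * p.1 +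
        F * p.2 + G = 0 with hS
  have hmem : ∀ p ∈ S, p.2 ∈ I := fun p hp =>
    (Finset.mem_product.mp (Finset.mem_filter.mp hp).1).2
  have hfib : ∀ b, (S.filter fun p => p.2 = b).card ≤
      (I.filter fun a => A * a ^ 2 + B * (a * b) + E * b ^ 2 + D * a + F * b + G = 0).card := by
    intro b
    refine Finset.card_le_card_of_injOn Prod.fst ?_ ?_
    · intro p hp
      obtain ⟨hpS, rfl⟩ := Finset.mem_filter.mp (Finset.mem_coe.mp hp)
      obtain ⟨hpB, hpe⟩ := Finset.mem_filter.mp hpS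
      exact Finset.mem_coe.mpr (Finset.mem_filter.mpr ⟨(Finset.mem_product.mp hpB).1, hpe⟩)
    · intro p hp p' hp' hpp
      exact Prod.ext hpp ((Finset.mem_filter.mp hp).2.trans (Finset.mem_filter.mp hp').2.symm)
  rw [Finset.card_eq_sum_card_fiberwise hmem]
  by_cases hA : A = 0
  · have hB : B ≠ 0 := by tauto
    have hb : ∀ b, (S.filter fun p => p.2 = b).card ≤ 1 + if B * b + D = 0 then 2 * Q + 1 else 0 := by
      intro b
      refine (hfib b).trans ?_
      split_ifs with h0
      · exact (Finset.card_filter_le _ _).trans (by omega)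
      · have hp : (Polynomial.C (B * b + D) * Polynomial.X +
            Polynomial.C (E * b ^ 2 + F * b + G)) ≠ (0 : Polynomial ℤ) := by
          intro h
          have h1 : (Polynomial.C (B * b + D) * Polynomial.X +
            Polynomial.C (E * b ^ 2 + F * b + G) : Polynomial ℤ).coeff 1 = B * b + D := by
            compute_degree!
          rw [h, Polynomial.coeff_zero] at h1
          exact h0 h1.symm
        refine card_roots_filter_le hp (d := 1) (by compute_degree) _ _ fun x hx => ?_
        simp only [Polynomial.eval_add, Polynomial.eval_mul, Polynomial.eval_C, Polynomial.eval_X]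
        rw [hA] at hx
        linear_combination hx
    refine (Finset.sum_le_sum fun b _ => hb b).trans ?_
    rw [Finset.sum_add_distrib, ← Finset.sum_filter, Finset.sum_const, Finset.sum_const, hIc]
    have : (I.filter fun b => B * b + D = 0).card ≤ 1 := by
      rw [Finset.card_le_one]
      intro x hx y hy
      have := (Finset.mem_filter.mp hx).2
      have := (Finset.mem_filter.mp hy).2
      exact mul_left_cancel₀ hB (by linarith)
    simp only [smul_eq_mul]
    nlinarith
  · refine (Finset.sum_le_card_nsmul _ _ 2 fun b _ => ?_).trans (by rw [hIc, smul_eq_mul, mul_comm])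
    refine (hfib b).trans ?_
    have hp : (Polynomial.C A * Polynomial.X ^ 2 + Polynomial.C (B * b + D) * Polynomial.X +
        Polynomial.C (E * b ^ 2 + F * b + G)) ≠ (0 : Polynomial ℤ) := by
      intro h
      have h1 : (Polynomial.C A * Polynomial.X ^ 2 + Polynomial.C (B * b + D) * Polynomial.X +
        Polynomial.C (E * b ^ 2 + F * b + G) : Polynomial ℤ).coeff 2 = A := by
        compute_degree!
      rw [h, Polynomial.coeff_zero] at h1
      exact hA h1.symm
    refine card_roots_filter_le hp (d := 2) (by compute_degree) _ _ fun x hx => ?_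
    simp only [Polynomial.eval_add, Polynomial.eval_mul, Polynomial.eval_C, Polynomial.eval_X,
      Polynomial.eval_pow]
    linear_combination hx

/-- A binary cubic polynomial with given coefficients. -/
noncomputable def binCubic (α β γ κ q₁ q₂ q₃ l₁ l₂ k : ℤ) (p : ℤ × ℤ) : ℤ :=
  α * p.1 ^ 3 + β * (p.1 ^ 2 * p.2) + γ * (p.1 * p.2 ^ 2) + κ * p.2 ^ 3 + q₁ * p.1 ^ 2 +
    q₂ * (p.1 * p.2) + q₃ * p.2 ^ 2 + l₁ * p.1 + l₂ * p.2 + k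

theorem card_filter_intBox_le {d Q : ℕ} (P : ℤ × ℤ → Prop) [DecidablePred P]
    (h : ∀ b, ∃ p : Polynomial ℤ, p ≠ 0 ∧ p.natDegree ≤ d ∧ ∀ x, P (x, b) → p.eval x = 0) :
    ((intBox Q).filter P).card ≤ d * (2 * Q + 1) := by
  set I := Finset.Icc (-(Q : ℤ)) Q with hI
  have hIc : I.card = 2 * Q + 1 := by rw [hI, Int.card_Icc]; omega
  have hmem : ∀ p ∈ (intBox Q).filter P, p.2 ∈ I := fun p hp =>
    (Finset.mem_product.mp (Finset.mem_filter.mp hp).1).2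
  rw [Finset.card_eq_sum_card_fiberwise hmem]
  refine (Finset.sum_le_card_nsmul _ _ d fun b _ => ?_).trans (by rw [hIc, smul_eq_mul, mul_comm])
  obtain ⟨p, hp0, hpd, hp⟩ := h b
  refine le_trans ?_ (card_roots_filter_le hp0 hpd I (fun x => P (x, b)) hp)
  refine Finset.card_le_card_of_injOn Prod.fst ?_ ?_
  · intro p hp
    obtain ⟨hpS, rfl⟩ := Finset.mem_filter.mp (Finset.mem_coe.mp hp)
    obtain ⟨hpB, hpe⟩ := Finset.mem_filter.mp hpS
    exact Finset.mem_coe.mpr (Finset.mem_filter.mpr ⟨(Finset.mem_product.mp hpB).1, hpe⟩)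
  · intro p hp p' hp' hpp
    exact Prod.ext hpp ((Finset.mem_filter.mp hp).2.trans (Finset.mem_filter.mp hp').2.symm)

theorem card_bad_shift_le {α β γ κ : ℤ} (hα : α ≠ 0) (hH : β ^ 2 - 3 * α * γ ≠ 0)
    (q₁ q₂ q₃ l₁ l₂ : ℤ) (Q : ℕ) :
    ((intBox Q).filter fun h => 3 * α * h.1 + β * h.2 = 0 ∨
      4 * ((β ^ 2 - 3 * α * γ) * h.1 ^ 2 + (β * γ - 9 * α * κ) * (h.1 * h.2) +
        (γ ^ 2 - 3 * β * κ) * h.2 ^ 2) = 0 ∨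
      (3 * α * h.1 + β * h.2) * (β * h.1 ^ 2 + 2 * γ * (h.1 * h.2) + 3 * κ * h.2 ^ 2 + q₂ * h.1 +
        2 * q₃ * h.2) ^ 2 - (2 * β * h.1 + 2 * γ * h.2) * (3 * α * h.1 ^ 2 + 2 * β * (h.1 * h.2) +
        γ * h.2 ^ 2 + 2 * q₁ * h.1 + q₂ * h.2) * (β * h.1 ^ 2 + 2 * γ * (h.1 * h.2) +
        3 * κ * h.2 ^ 2 + q₂ * h.1 + 2 * q₃ * h.2) + (γ * h.1 + 3 * κ * h.2) *
        (3 * α * h.1 ^ 2 + 2 * β * (h.1 * h.2) + γ * h.2 ^ 2 + 2 * q₁ * h.1 + q₂ * h.2) ^ 2 +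
        (α * h.1 ^ 3 + β * (h.1 ^ 2 * h.2) + γ * (h.1 * h.2 ^ 2) + κ * h.2 ^ 3 + q₁ * h.1 ^ 2 +
          q₂ * (h.1 * h.2) + q₃ * h.2 ^ 2 + l₁ * h.1 + l₂ * h.2) *
        (4 * ((β ^ 2 - 3 * α * γ) * h.1 ^ 2 + (β * γ - 9 * α * κ) * (h.1 * h.2) +
        (γ ^ 2 - 3 * β * κ) * h.2 ^ 2)) = 0).card ≤ 8 * (2 * Q + 1) := by
  refine card_filter_intBox_le _ fun b => ?_
  set pA : Polynomial ℤ := Polynomial.C (3 * α) * Polynomial.X + Polynomial.C (β * b) with hpA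
  set pB : Polynomial ℤ := Polynomial.C (2 * β) * Polynomial.X + Polynomial.C (2 * γ * b) with hpB
  set pE : Polynomial ℤ := Polynomial.C γ * Polynomial.X + Polynomial.C (3 * κ * b) with hpE
  set pD : Polynomial ℤ := Polynomial.C (3 * α) * Polynomial.X ^ 2 +
    Polynomial.C (2 * β * b + 2 * q₁) * Polynomial.X +
    Polynomial.C (γ * b ^ 2 + q₂ * b) with hpD
  set pF : Polynomial ℤ := Polynomial.C β * Polynomial.X ^ 2 +
    Polynomial.C (2 * γ * b + q₂) * Polynomial.X +
    Polynomial.C (3 * κ * b ^ 2 + 2 * q₃ * b) with hpF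
  set pG : Polynomial ℤ := Polynomial.C α * Polynomial.X ^ 3 +
    Polynomial.C (β * b + q₁) * Polynomial.X ^ 2 +
    Polynomial.C (γ * b ^ 2 + q₂ * b + l₁) * Polynomial.X +
    Polynomial.C (κ * b ^ 3 + q₃ * b ^ 2 + l₂ * b) with hpG
  set pΔ : Polynomial ℤ := Polynomial.C (4 * (β ^ 2 - 3 * α * γ)) * Polynomial.X ^ 2 +
    Polynomial.C (4 * (β * γ - 9 * α * κ) * b) * Polynomial.X +
    Polynomial.C (4 * (γ ^ 2 - 3 * β * κ) * b ^ 2) with hpΔ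
  set pd : Polynomial ℤ := pA * pF ^ 2 - pB * pD * pF + pE * pD ^ 2 + pG * pΔ with hpd
  have cA : pA.coeff 1 = 3 * α := by rw [hpA]; compute_degree!
  have cΔ : pΔ.coeff 2 = 4 * (β ^ 2 - 3 * α * γ) := by rw [hpΔ]; compute_degree!
  have dA : pA.natDegree ≤ 1 := by rw [hpA]; compute_degree
  have dB : pB.natDegree ≤ 1 := by rw [hpB]; compute_degree
  have dE : pE.natDegree ≤ 1 := by rw [hpE]; compute_degree
  have dD : pD.natDegree ≤ 2 := by rw [hpD]; compute_degree
  have dF : pF.natDegree ≤ 2 := by rw [hpF]; compute_degree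
  have dG : pG.natDegree ≤ 3 := by rw [hpG]; compute_degree
  have dΔ : pΔ.natDegree ≤ 2 := by rw [hpΔ]; compute_degree
  have dd : pd.natDegree ≤ 5 := by
    rw [hpd, hpA, hpB, hpE, hpD, hpF, hpG, hpΔ]; compute_degree
  have cd : pd.coeff 5 = α * (β ^ 2 - 3 * α * γ) := by
    have : pd.coeff 5 = 3 * α * β ^ 2 - 2 * β * (3 * α) * β + γ * (3 * α) ^ 2 +
        α * (4 * (β ^ 2 - 3 * α * γ)) := by
      rw [hpd, hpA, hpB, hpE, hpD, hpF, hpG, hpΔ]; compute_degree <;> norm_num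
    rw [this]; ring
  have hA0 : pA ≠ 0 := fun h => by rw [h, Polynomial.coeff_zero] at cA; omega
  have hΔ0 : pΔ ≠ 0 := fun h => by
    rw [h, Polynomial.coeff_zero] at cΔ; exact hH (by linarith)
  have hd0 : pd ≠ 0 := fun h => by
    rw [h, Polynomial.coeff_zero] at cd; exact mul_ne_zero hα hH cd.symm
  have hprod : pA * pΔ * pd ≠ 0 := mul_ne_zero (mul_ne_zero hA0 hΔ0) hd0
  have hdeg : (pA * pΔ * pd).natDegree ≤ 8 := by
    refine Polynomial.natDegree_mul_le.trans ?_
    have := Polynomial.natDegree_mul_le (p := pA) (q := pΔ)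
    omega
  refine ⟨_, hprod, hdeg, fun x hx => ?_⟩
  have eA : pA.eval x = 3 * α * x + β * b := by simp [hpA]
  have eB : pB.eval x = 2 * β * x + 2 * γ * b := by simp [hpB]
  have eE : pE.eval x = γ * x + 3 * κ * b := by simp [hpE]
  have eD : pD.eval x = 3 * α * x ^ 2 + 2 * β * (x * b) +
      γ * b ^ 2 + 2 * q₁ * x + q₂ * b := by simp [hpD]; ring
  have eF : pF.eval x = β * x ^ 2 + 2 * γ * (x * b) +
      3 * κ * b ^ 2 + q₂ * x + 2 * q₃ * b := by simp [hpF]; ring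
  have eG : pG.eval x = α * x ^ 3 + β * (x ^ 2 * b) + γ * (x * b ^ 2) + κ * b ^ 3 +
      q₁ * x ^ 2 + q₂ * (x * b) + q₃ * b ^ 2 + l₁ * x + l₂ * b := by simp [hpG]; ring
  have eΔ : pΔ.eval x = 4 * ((β ^ 2 - 3 * α * γ) * x ^ 2 +
      (β * γ - 9 * α * κ) * (x * b) + (γ ^ 2 - 3 * β * κ) * b ^ 2) := by simp [hpΔ]; ring
  have ed : pd.eval x = pA.eval x * pF.eval x ^ 2 - pB.eval x * pD.eval x * pF.eval x
      + pE.eval x * pD.eval x ^ 2 + pG.eval x * pΔ.eval x := by simp [hpd]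
  rw [Polynomial.eval_mul, Polynomial.eval_mul, mul_eq_zero, mul_eq_zero, ed, eA, eB, eE, eD, eF,
    eG, eΔ, or_assoc]
  exact hx

theorem card_intBox (Q : ℕ) : (intBox Q).card = (2 * Q + 1) ^ 2 := by
  rw [intBox, Finset.card_product, Int.card_Icc, sq]
  congr 1 <;> omega

theorem card_binCubic_shift_le {ε : ℝ} (hε : 0 < ε) {α β γ κ : ℤ} (M : ℕ) (hM1 : 1 ≤ M)
    (hαM : |α| ≤ M) (hβM : |β| ≤ M) (hγM : |γ| ≤ M) (hκM : |κ| ≤ M) :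
    ∃ K : ℝ, 0 ≤ K ∧ ∀ (Q : ℕ) (q₁ q₂ q₃ l₁ l₂ : ℤ), 1 ≤ Q → |q₁| ≤ M * (Q : ℤ) ^ 2 →
      |q₂| ≤ M * (Q : ℤ) ^ 2 → |q₃| ≤ M * (Q : ℤ) ^ 2 → |l₁| ≤ M * (Q : ℤ) ^ 2 →
      |l₂| ≤ M * (Q : ℤ) ^ 2 → ∀ (i j : ℤ), |i| ≤ 2 * Q → |j| ≤ 2 * Q →
      3 * α * i + β * j ≠ 0 →
      4 * ((β ^ 2 - 3 * α * γ) * i ^ 2 + (β * γ - 9 * α * κ) * (i * j) +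
        (γ ^ 2 - 3 * β * κ) * j ^ 2) ≠ 0 →
      (3 * α * i + β * j) * (β * i ^ 2 + 2 * γ * (i * j) + 3 * κ * j ^ 2 + q₂ * i +
        2 * q₃ * j) ^ 2 - (2 * β * i + 2 * γ * j) * (3 * α * i ^ 2 + 2 * β * (i * j) +
        γ * j ^ 2 + 2 * q₁ * i + q₂ * j) * (β * i ^ 2 + 2 * γ * (i * j) +
        3 * κ * j ^ 2 + q₂ * i + 2 * q₃ * j) + (γ * i + 3 * κ * j) *
        (3 * α * i ^ 2 + 2 * β * (i * j) + γ * j ^ 2 + 2 * q₁ * i + q₂ * j) ^ 2 +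
        (α * i ^ 3 + β * (i ^ 2 * j) + γ * (i * j ^ 2) + κ * j ^ 3 + q₁ * i ^ 2 +
          q₂ * (i * j) + q₃ * j ^ 2 + l₁ * i + l₂ * j) *
        (4 * ((β ^ 2 - 3 * α * γ) * i ^ 2 + (β * γ - 9 * α * κ) * (i * j) +
        (γ ^ 2 - 3 * β * κ) * j ^ 2)) ≠ 0 →
      (((intBox Q).filter fun p => (3 * α * i + β * j) * p.1 ^ 2 +
        (2 * β * i + 2 * γ * j) * (p.1 * p.2) + (γ * i + 3 * κ * j) * p.2 ^ 2 +
        (3 * α * i ^ 2 + 2 * β * (i * j) + γ * j ^ 2 + 2 * q₁ * i + q₂ * j) * p.1 +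
        (β * i ^ 2 + 2 * γ * (i * j) + 3 * κ * j ^ 2 + q₂ * i + 2 * q₃ * j) * p.2 +
        (α * i ^ 3 + β * (i ^ 2 * j) + γ * (i * j ^ 2) + κ * j ^ 3 + q₁ * i ^ 2 +
          q₂ * (i * j) + q₃ * j ^ 2 + l₁ * i + l₂ * j) = 0).card : ℝ) ≤ K * (Q : ℝ) ^ ε := by
  obtain ⟨K, hK, h⟩ := card_conic_le_rpow (ε := ε / 4) (by positivity)
  refine ⟨K * (48 * M : ℝ) ^ (ε / 4), by positivity, ?_⟩
  intro Q q₁ q₂ q₃ l₁ l₂ hQ h₁ h₂ h₃ h₄ h₅ i j hi hj hA hΔ hd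
  have hQ' : (1 : ℤ) ≤ Q := by exact_mod_cast hQ
  have hM' : (1 : ℤ) ≤ M := by exact_mod_cast hM1
  have p12 : (Q : ℤ) ≤ (Q : ℤ) ^ 2 := by nlinarith
  have p23 : (Q : ℤ) ^ 2 ≤ (Q : ℤ) ^ 3 := by nlinarith [sq_nonneg (Q : ℤ)]
  have p34 : (Q : ℤ) ^ 3 ≤ (Q : ℤ) ^ 4 := by nlinarith [pow_nonneg (by linarith : (0 : ℤ) ≤ Q) 3]
  have mm : ∀ {x y a b : ℤ}, |x| ≤ a → |y| ≤ b → |x * y| ≤ a * b := by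
    intro x y a b hx hy
    rw [abs_mul]
    exact mul_le_mul hx hy (abs_nonneg _) ((abs_nonneg _).trans hx)
  have hm1 : ∀ {c x : ℤ}, |c| ≤ M → |x| ≤ 2 * Q → |c * x| ≤ 2 * (M * (Q : ℤ) ^ 4) := by
    intro c x hc hx
    have := mm hc hx
    nlinarith
  have hm2 : ∀ {c x y : ℤ}, |c| ≤ M → |x| ≤ 2 * Q → |y| ≤ 2 * Q →
      |c * (x * y)| ≤ 4 * (M * (Q : ℤ) ^ 4) := by
    intro c x y hc hx hy
    have := mm hc (mm hx hy)
    nlinarith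
  have hm3 : ∀ {c x y z : ℤ}, |c| ≤ M → |x| ≤ 2 * Q → |y| ≤ 2 * Q → |z| ≤ 2 * Q →
      |c * (x * y * z)| ≤ 8 * (M * (Q : ℤ) ^ 4) := by
    intro c x y z hc hx hy hz
    have := mm hc (mm (mm hx hy) hz)
    nlinarith
  have hq1 : ∀ {c x : ℤ}, |c| ≤ M * (Q : ℤ) ^ 2 → |x| ≤ 2 * Q →
      |c * x| ≤ 2 * (M * (Q : ℤ) ^ 4) := by
    intro c x hc hx
    have := mm hc hx
    nlinarith
  have hq2 : ∀ {c x y : ℤ}, |c| ≤ M * (Q : ℤ) ^ 2 → |x| ≤ 2 * Q → |y| ≤ 2 * Q →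
      |c * (x * y)| ≤ 4 * (M * (Q : ℤ) ^ 4) := by
    intro c x y hc hx hy
    have := mm hc (mm hx hy)
    nlinarith
  have hH : ((48 * M * Q ^ 4 : ℕ) : ℤ) = 48 * (M * (Q : ℤ) ^ 4) := by push_cast; ring
  have hMQ : 0 ≤ (M : ℤ) * (Q : ℤ) ^ 4 := by positivity
  have hΔe : (2 * β * i + 2 * γ * j) ^ 2 - 4 * (3 * α * i + β * j) * (γ * i + 3 * κ * j) =
    4 * ((β ^ 2 - 3 * α * γ) * i ^ 2 + (β * γ - 9 * α * κ) * (i * j) +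
        (γ ^ 2 - 3 * β * κ) * j ^ 2) := by ring
  refine (h (48 * M * Q ^ 4) Q _ _ _ _ _ _ ?_ ?_ ?_ ?_ ?_ ?_ ?_ ?_ hA (by rwa [hΔe])
    (by rwa [hΔe])).trans_eq ?_
  · have : 0 < M * Q ^ 4 := by positivity
    nlinarith
  · have : (Q : ℤ) ≤ ((48 * M * Q ^ 4 : ℕ) : ℤ) := by rw [hH]; nlinarith
    exact_mod_cast this
  · rw [hH]
    have e1 := abs_le.mp (hm1 hαM hi)
    have e2 := abs_le.mp (hm1 hβM hj)
    exact abs_le.mpr ⟨by linarith, by linarith⟩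
  · rw [hH]
    have e1 := abs_le.mp (hm1 hβM hi)
    have e2 := abs_le.mp (hm1 hγM hj)
    exact abs_le.mpr ⟨by linarith, by linarith⟩
  · rw [hH]
    have e1 := abs_le.mp (hm1 hγM hi)
    have e2 := abs_le.mp (hm1 hκM hj)
    exact abs_le.mpr ⟨by linarith, by linarith⟩
  · rw [hH]
    have e1 := abs_le.mp (hm2 hαM hi hi)
    have e2 := abs_le.mp (hm2 hβM hi hj)
    have e3 := abs_le.mp (hm2 hγM hj hj)
    have e4 := abs_le.mp (hq1 h₁ hi)
    have e5 := abs_le.mp (hq1 h₂ hj)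
    exact abs_le.mpr ⟨by linarith, by linarith⟩
  · rw [hH]
    have e1 := abs_le.mp (hm2 hβM hi hi)
    have e2 := abs_le.mp (hm2 hγM hi hj)
    have e3 := abs_le.mp (hm2 hκM hj hj)
    have e4 := abs_le.mp (hq1 h₂ hi)
    have e5 := abs_le.mp (hq1 h₃ hj)
    exact abs_le.mpr ⟨by linarith, by linarith⟩
  · rw [hH]
    have e1 := abs_le.mp (hm3 hαM hi hi hi)
    have e2 := abs_le.mp (hm3 hβM hi hi hj)
    have e3 := abs_le.mp (hm3 hγM hi hj hj)
    have e4 := abs_le.mp (hm3 hκM hj hj hj)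
    have e5 := abs_le.mp (hq2 h₁ hi hi)
    have e6 := abs_le.mp (hq2 h₂ hi hj)
    have e7 := abs_le.mp (hq2 h₃ hj hj)
    have e8 := abs_le.mp (hq1 h₄ hi)
    have e9 := abs_le.mp (hq1 h₅ hj)
    exact abs_le.mpr ⟨by linarith, by linarith⟩
  · push_cast
    rw [Real.mul_rpow (by positivity) (by positivity), ← Real.rpow_natCast (Q : ℝ) 4,
      ← Real.rpow_mul (by positivity), mul_assoc]
    congr 3; push_cast; ring

theorem card_binCubic_eq_le {ε : ℝ} (hε : 0 < ε) {α β γ κ : ℤ} (hα : α ≠ 0)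
    (hH : β ^ 2 - 3 * α * γ ≠ 0) (M : ℕ) :
    ∃ K : ℝ, 0 ≤ K ∧ ∀ (Q : ℕ) (q₁ q₂ q₃ l₁ l₂ k : ℤ), 1 ≤ Q → |q₁| ≤ M * (Q : ℤ) ^ 2 →
      |q₂| ≤ M * (Q : ℤ) ^ 2 → |q₃| ≤ M * (Q : ℤ) ^ 2 → |l₁| ≤ M * (Q : ℤ) ^ 2 →
      |l₂| ≤ M * (Q : ℤ) ^ 2 →
      (((intBox Q ×ˢ intBox Q).filter fun z => binCubic α β γ κ q₁ q₂ q₃ l₁ l₂ k z.1 =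
        binCubic α β γ κ q₁ q₂ q₃ l₁ l₂ k z.2).card : ℝ) ≤ K * (Q : ℝ) ^ (2 + ε) := by
  set N : ℕ := M + 1 + α.natAbs + β.natAbs + γ.natAbs + κ.natAbs with hN
  obtain ⟨K, hK, h⟩ := card_binCubic_shift_le hε (α := α) (β := β) (γ := γ) (κ := κ) N (by omega)
    (by rw [hN, Int.abs_eq_natAbs]; omega) (by rw [hN, Int.abs_eq_natAbs]; omega)
    (by rw [hN, Int.abs_eq_natAbs]; omega) (by rw [hN, Int.abs_eq_natAbs]; omega)
  refine ⟨25 * K + 249, by positivity, ?_⟩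
  intro Q q₁ q₂ q₃ l₁ l₂ k hQ h₁ h₂ h₃ h₄ h₅
  have hMN : (M : ℤ) * (Q : ℤ) ^ 2 ≤ N * (Q : ℤ) ^ 2 :=
    mul_le_mul_of_nonneg_right (by exact_mod_cast (show M ≤ N by omega)) (by positivity)
  have key := fun i j => h Q q₁ q₂ q₃ l₁ l₂ hQ (h₁.trans hMN) (h₂.trans hMN) (h₃.trans hMN)
    (h₄.trans hMN) (h₅.trans hMN) i j
  clear h h₁ h₂ h₃ h₄ h₅
  set g := binCubic α β γ κ q₁ q₂ q₃ l₁ l₂ k with hg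
  set cond : ℤ × ℤ → ℤ × ℤ → Prop := fun h p => (3 * α * h.1 + β * h.2) * p.1 ^ 2 +
        (2 * β * h.1 + 2 * γ * h.2) * (p.1 * p.2) + (γ * h.1 + 3 * κ * h.2) * p.2 ^ 2 +
        (3 * α * h.1 ^ 2 + 2 * β * (h.1 * h.2) + γ * h.2 ^ 2 + 2 * q₁ * h.1 + q₂ * h.2) * p.1 +
        (β * h.1 ^ 2 + 2 * γ * (h.1 * h.2) + 3 * κ * h.2 ^ 2 + q₂ * h.1 + 2 * q₃ * h.2) * p.2 +
        (α * h.1 ^ 3 + β * (h.1 ^ 2 * h.2) + γ * (h.1 * h.2 ^ 2) + κ * h.2 ^ 3 + q₁ * h.1 ^ 2 +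
          q₂ * (h.1 * h.2) + q₃ * h.2 ^ 2 + l₁ * h.1 + l₂ * h.2) = 0 with hcond
  have hcg : ∀ p p' : ℤ × ℤ, g p = g p' → cond (p' - p) p := by
    intro p p' hpp
    simp only [hcond, Prod.fst_sub, Prod.snd_sub]
    simp only [hg, binCubic] at hpp
    linear_combination -hpp
  classical
  set S := (intBox Q ×ˢ intBox Q).filter fun z => g z.1 = g z.2 with hS
  have hmem : ∀ z ∈ S, z.2 - z.1 ∈ intBox (2 * Q) := by
    intro z hz
    have hz := Finset.mem_product.mp (Finset.mem_filter.mp hz).1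
    rw [mem_intBox, mem_intBox] at hz
    rw [mem_intBox, Prod.fst_sub, Prod.snd_sub]
    push_cast
    simp only [abs_le] at *
    constructor <;> constructor <;> linarith
  have hfib : ∀ h, (S.filter fun z => z.2 - z.1 = h).card ≤ ((intBox Q).filter (cond h)).card := by
    intro h
    refine Finset.card_le_card_of_injOn Prod.fst ?_ ?_
    · intro z hz
      obtain ⟨hzS, rfl⟩ := Finset.mem_filter.mp (Finset.mem_coe.mp hz)
      obtain ⟨hzB, hze⟩ := Finset.mem_filter.mp hzS
      exact Finset.mem_coe.mpr (Finset.mem_filter.mpr ⟨(Finset.mem_product.mp hzB).1, hcg _ _ hze⟩)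
    · intro z hz z' hz' hzz
      have e1 := (Finset.mem_filter.mp hz).2
      have e2 := (Finset.mem_filter.mp hz').2
      refine Prod.ext hzz ?_
      have : z.2 = h + z.1 := by rw [← e1]; abel
      rw [this, hzz, ← e2]; abel
  obtain ⟨bd, hbdc, hbd⟩ : ∃ bd : Finset (ℤ × ℤ), bd.card ≤ 8 * (2 * (2 * Q) + 1) ∧
      ∀ h ∈ intBox (2 * Q), h ∉ bd →
        (((intBox Q).filter (cond h)).card : ℝ) ≤ K * (Q : ℝ) ^ ε := by
    refine ⟨_, card_bad_shift_le (κ := κ) hα hH q₁ q₂ q₃ l₁ l₂ (2 * Q), fun h hh hb => ?_⟩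
    have hh' := mem_intBox.mp hh
    push_cast at hh'
    have hb' := fun hc => hb (Finset.mem_filter.mpr ⟨hh, hc⟩)
    simp only [imp_false, not_or] at hb'
    refine le_of_eq_of_le ?_ (key h.1 h.2 hh'.1 hh'.2 hb'.1 hb'.2.1 hb'.2.2)
    congr!
  have hQ1 : (1 : ℝ) ≤ Q := by exact_mod_cast hQ
  have hQε : (1 : ℝ) ≤ (Q : ℝ) ^ ε := Real.one_le_rpow hQ1 hε.le
  have hsum : (S.card : ℝ) ≤ ∑ h ∈ intBox (2 * Q), (K * (Q : ℝ) ^ ε + ((if h = 0 then ((2 * Q + 1) ^ 2 : ℝ) else 0)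
      + if h ∈ bd then (2 * (2 * Q + 1) : ℝ) else 0)) := by
    rw [Finset.card_eq_sum_card_fiberwise hmem]
    push_cast
    refine Finset.sum_le_sum fun h hh => ?_
    refine (Nat.cast_le.mpr (hfib h)).trans ?_
    have hKQ : 0 ≤ K * (Q : ℝ) ^ ε := by positivity
    by_cases h0 : h = 0
    · rw [if_pos h0]
      have : ((((intBox Q).filter (cond h)).card : ℕ) : ℝ) ≤ (2 * Q + 1) ^ 2 := by
        have := Finset.card_filter_le (intBox Q) (cond h)
        rw [card_intBox] at this
        exact_mod_cast this
      have : (0:ℝ) ≤ if h ∈ bd then (2 * (2 * Q + 1) : ℝ) else 0 := by positivity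
      linarith
    rw [if_neg h0]
    by_cases hb : h ∈ bd
    · rw [if_pos hb]
      have : ((intBox Q).filter (cond h)).card ≤ 2 * (2 * Q + 1) := by
        refine card_degenerate_conic_le Q _ _ _ _ _ _ ?_
        by_contra! hAB
        obtain ⟨hA, hB⟩ := hAB
        have hB' : β * h.1 + γ * h.2 = 0 := by linarith
        have e2 : h.2 = 0 := by
          have : (β ^ 2 - 3 * α * γ) * h.2 = 0 := by linear_combination β * hA - 3 * α * hB'
          exact (mul_eq_zero.mp this).resolve_left hH
        have e1 : h.1 = 0 := by
          rw [e2, mul_zero, add_zero] at hA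
          exact (mul_eq_zero.mp hA).resolve_left (mul_ne_zero three_ne_zero hα)
        exact h0 (Prod.ext e1 e2)
      have : ((((intBox Q).filter (cond h)).card : ℕ) : ℝ) ≤ 2 * (2 * Q + 1) := by exact_mod_cast this
      linarith
    · rw [if_neg hb, add_zero, add_zero]
      exact hbd h hh hb
  refine hsum.trans ?_
  rw [Finset.sum_add_distrib, Finset.sum_add_distrib, Finset.sum_ite_eq', Finset.sum_ite_mem,
    Finset.sum_const, Finset.sum_const, card_intBox, nsmul_eq_mul, nsmul_eq_mul,
    Real.rpow_add (by positivity), Real.rpow_two]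
  have h1 : ((((2 * (2 * Q) + 1) ^ 2 : ℕ)) : ℝ) ≤ 25 * (Q : ℝ) ^ 2 := by push_cast; nlinarith
  have h2 : (if (0 : ℤ × ℤ) ∈ intBox (2 * Q) then ((2 * Q + 1) ^ 2 : ℝ) else 0) ≤ 9 * (Q : ℝ) ^ 2 := by
    split_ifs
    · nlinarith
    · positivity
  have h3 : (((intBox (2 * Q) ∩ bd).card : ℕ) : ℝ) ≤ 40 * Q := by
    have h4 : (intBox (2 * Q) ∩ bd).card ≤ 8 * (2 * (2 * Q) + 1) :=
      (Finset.card_le_card Finset.inter_subset_right).trans hbdc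
    have : (((intBox (2 * Q) ∩ bd).card : ℕ) : ℝ) ≤ 8 * (2 * (2 * Q) + 1) := by exact_mod_cast h4
    linarith
  have h5 : (((intBox (2 * Q) ∩ bd).card : ℕ) : ℝ) * (2 * (2 * Q + 1)) ≤ 240 * (Q : ℝ) ^ 2 := by
    calc _ ≤ (40 * (Q : ℝ)) * (6 * Q) := mul_le_mul h3 (by linarith) (by positivity) (by positivity)
      _ = _ := by ring
  have h6 : ((((2 * (2 * Q) + 1) ^ 2 : ℕ)) : ℝ) * (K * (Q : ℝ) ^ ε) ≤
      25 * (Q : ℝ) ^ 2 * (K * (Q : ℝ) ^ ε) := mul_le_mul_of_nonneg_right h1 (by positivity)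
  have h7 : 249 * (Q : ℝ) ^ 2 ≤ 249 * (Q : ℝ) ^ 2 * (Q : ℝ) ^ ε :=
    le_mul_of_one_le_right (by positivity) hQε
  linarith

/-- The number of pairs in `A` with equal values of `φ`. -/
def energy {ι τ : Type*} [DecidableEq τ] (A : Finset ι) (φ : ι → τ) : ℕ :=
  ((A ×ˢ A).filter fun z => φ z.1 = φ z.2).card

theorem card_filter_eq_sum_fibers {ι κ τ : Type*} [DecidableEq τ] (A : Finset ι) (B : Finset κ)
    (φ : ι → τ) (ψ : κ → τ) (T : Finset τ) (hT : ∀ a ∈ A, φ a ∈ T) :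
    ((A ×ˢ B).filter fun z => φ z.1 = ψ z.2).card =
      ∑ t ∈ T, (A.filter fun a => φ a = t).card * (B.filter fun b => ψ b = t).card := by
  rw [Finset.card_eq_sum_card_fiberwise (f := fun z => φ z.1) (t := T)
    (fun z hz => hT _ (Finset.mem_product.mp (Finset.mem_filter.mp hz).1).1)]
  refine Finset.sum_congr rfl fun t _ => ?_
  rw [← Finset.card_product]
  congr 1
  ext z
  simp only [Finset.mem_filter, Finset.mem_product]
  constructor
  · rintro ⟨⟨⟨h1, h2⟩, h3⟩, h4⟩
    exact ⟨⟨h1, h4⟩, h2, h3 ▸ h4⟩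
  · rintro ⟨⟨h1, h4⟩, h2, h3⟩
    exact ⟨⟨⟨h1, h2⟩, h4.trans h3.symm⟩, h4⟩

theorem energy_eq_sum {ι τ : Type*} [DecidableEq τ] (A : Finset ι) (φ : ι → τ) (T : Finset τ)
    (hT : ∀ a ∈ A, φ a ∈ T) : energy A φ = ∑ t ∈ T, (A.filter fun a => φ a = t).card ^ 2 := by
  rw [energy, card_filter_eq_sum_fibers A A φ φ T hT]
  simp only [sq]

theorem card_filter_sq_le_energy_mul_energy {ι κ τ : Type*} [DecidableEq τ] (A : Finset ι)
    (B : Finset κ) (φ : ι → τ) (ψ : κ → τ) :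
    ((A ×ˢ B).filter fun z => φ z.1 = ψ z.2).card ^ 2 ≤ energy A φ * energy B ψ := by
  classical
  set T := A.image φ ∪ B.image ψ
  have hA : ∀ a ∈ A, φ a ∈ T := fun a ha =>
    Finset.mem_union_left _ (Finset.mem_image_of_mem _ ha)
  have hB : ∀ b ∈ B, ψ b ∈ T := fun b hb =>
    Finset.mem_union_right _ (Finset.mem_image_of_mem _ hb)
  rw [card_filter_eq_sum_fibers A B φ ψ T hA, energy_eq_sum A φ T hA, energy_eq_sum B ψ T hB]
  exact Finset.sum_mul_sq_le_sq_mul_sq _ _ _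

theorem energy_le_card_mul_energy {ι τ σ : Type*} [DecidableEq τ] [DecidableEq σ] (A : Finset ι)
    (ψ : ι → τ) (l : ι → σ) (L : Finset σ) (hL : ∀ a ∈ A, l a ∈ L) :
    energy A ψ ≤ L.card * energy A fun a => (l a, ψ a) := by
  classical
  have h1 : ∀ a ∈ A, ψ a ∈ A.image ψ := fun a ha => Finset.mem_image_of_mem _ ha
  rw [energy_eq_sum A ψ (A.image ψ) h1, energy_eq_sum A _ (L ×ˢ A.image ψ)
    (fun a ha => Finset.mem_product.mpr ⟨hL a ha, h1 a ha⟩), Finset.sum_product_right,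
    Finset.mul_sum]
  refine Finset.sum_le_sum fun t _ => ?_
  have : (A.filter fun a => ψ a = t).card = ∑ x ∈ L, (A.filter fun a => (l a, ψ a) = (x, t)).card := by
    rw [Finset.card_eq_sum_card_fiberwise (f := l) (t := L)
      (fun a ha => hL a (Finset.mem_filter.mp ha).1)]
    refine Finset.sum_congr rfl fun x _ => ?_
    congr 1
    ext a
    simp only [Finset.mem_filter, Prod.mk.injEq]
    tauto
  rw [this]
  exact sq_sum_le_card_mul_sum_sq

theorem card_signed_divisors {n : ℤ} (hn : n ≠ 0) :
    ∃ S : Finset ℤ, S.card ≤ 2 * n.natAbs.divisors.card ∧ ∀ d : ℤ, d ∣ n → d ∈ S := by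
  classical
  refine ⟨n.natAbs.divisors.image (fun d : ℕ => (d : ℤ)) ∪
    n.natAbs.divisors.image (fun d : ℕ => -(d : ℤ)), ?_, fun d hd => ?_⟩
  · refine (Finset.card_union_le _ _).trans ?_
    rw [two_mul]
    exact add_le_add Finset.card_image_le Finset.card_image_le
  · have h : d.natAbs ∈ n.natAbs.divisors :=
      Nat.mem_divisors.mpr ⟨Int.natAbs_dvd_natAbs.mpr hd, Int.natAbs_ne_zero.mpr hn⟩
    rw [Finset.mem_union, Finset.mem_image, Finset.mem_image]
    rcases Int.natAbs_eq d with h1 | h1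
    · exact Or.inl ⟨_, h, h1.symm⟩
    · exact Or.inr ⟨_, h, h1.symm⟩

theorem card_cube_diff_le_of_ne {c n : ℤ} (hn : n ≠ 0) (I : Finset ℤ) :
    (((I ×ˢ I) ×ˢ (I ×ˢ I)).filter fun z => z.1.2 - z.1.1 = z.2.2 - z.2.1 ∧
      3 * c * (z.1.2 - z.1.1) * (z.1.1 - z.2.1) * (z.1.2 + z.2.1) = n).card ≤
      (2 * n.natAbs.divisors.card) ^ 2 := by
  obtain ⟨S, hS, hSd⟩ := card_signed_divisors hn
  refine le_trans ?_ (Nat.pow_le_pow_left hS 2)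
  rw [sq, ← Finset.card_product]
  refine Finset.card_le_card_of_injOn (fun z => (z.1.2 - z.1.1, z.1.1 - z.2.1)) ?_ ?_
  · intro z hz
    obtain ⟨_, _, h⟩ := Finset.mem_filter.mp (Finset.mem_coe.mp hz)
    refine Finset.mem_coe.mpr (Finset.mem_product.mpr ⟨hSd _ ?_, hSd _ ?_⟩)
    · exact ⟨3 * c * (z.1.1 - z.2.1) * (z.1.2 + z.2.1), by rw [← h]; ring⟩
    · exact ⟨3 * c * (z.1.2 - z.1.1) * (z.1.2 + z.2.1), by rw [← h]; ring⟩
  · intro z hz z' hz' hzz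
    obtain ⟨_, h1, h⟩ := Finset.mem_filter.mp (Finset.mem_coe.mp hz)
    obtain ⟨_, h1', h'⟩ := Finset.mem_filter.mp (Finset.mem_coe.mp hz')
    simp only [Prod.mk.injEq] at hzz
    obtain ⟨e1, e2⟩ := hzz
    rw [← e1, ← e2] at h'
    have h0 : 3 * c * (z.1.2 - z.1.1) * (z.1.1 - z.2.1) ≠ 0 := by
      intro h0; rw [h0, zero_mul] at h; exact hn h.symm
    have e3 := mul_left_cancel₀ h0 (h.trans h'.symm)
    refine Prod.ext (Prod.ext ?_ ?_) (Prod.ext ?_ ?_) <;> linarith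

theorem card_cube_diff_le_of_eq {c : ℤ} (hc : c ≠ 0) (I : Finset ℤ) :
    (((I ×ˢ I) ×ˢ (I ×ˢ I)).filter fun z => z.1.2 - z.1.1 = z.2.2 - z.2.1 ∧
      3 * c * (z.1.2 - z.1.1) * (z.1.1 - z.2.1) * (z.1.2 + z.2.1) = 0).card ≤ 3 * I.card ^ 2 := by
  classical
  have : (((I ×ˢ I) ×ˢ (I ×ˢ I)).filter fun z => z.1.2 - z.1.1 = z.2.2 - z.2.1 ∧
      3 * c * (z.1.2 - z.1.1) * (z.1.1 - z.2.1) * (z.1.2 + z.2.1) = 0) ⊆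
      ((I ×ˢ I).image (fun p => ((p.1, p.1), (p.2, p.2))) ∪
      (I ×ˢ I).image (fun p => ((p.1, p.2), (p.1, p.2)))) ∪
      (I ×ˢ I).image (fun p => ((p.1, p.2), (-p.2, -p.1))) := by
    rintro ⟨⟨x, x'⟩, ⟨y, y'⟩⟩ hz
    obtain ⟨hzI, h1, h⟩ := Finset.mem_filter.mp hz
    simp only [Finset.mem_product] at hzI
    simp only at h1 h
    simp only [Finset.mem_union, Finset.mem_image, Finset.mem_product, Prod.mk.injEq, Prod.exists]
    rcases mul_eq_zero.mp h with h | h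
    · rcases mul_eq_zero.mp h with h | h
      · have h := (mul_eq_zero.mp h).resolve_left (by positivity)
        exact Or.inl (Or.inl ⟨x, y, ⟨hzI.1.1, hzI.2.1⟩, ⟨rfl, by linarith⟩, rfl, by linarith⟩)
      · exact Or.inl (Or.inr ⟨x, x', hzI.1, ⟨rfl, rfl⟩, by linarith, by linarith⟩)
    · exact Or.inr ⟨x, x', hzI.1, ⟨rfl, rfl⟩, by linarith, by linarith⟩
  refine (Finset.card_le_card this).trans ((Finset.card_union_le _ _).trans
    ((add_le_add ((Finset.card_union_le _ _).trans (add_le_add Finset.card_image_le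
      Finset.card_image_le)) Finset.card_image_le).trans ?_))
  rw [Finset.card_product]
  nlinarith

theorem energy_cube_diff_le {ι : Type*} [DecidableEq ι] {c : ℤ} (hc : c ≠ 0) (I : Finset ℤ)
    (J : Finset ι) (g : ι → ℤ) (D : ℕ)
    (hD : ∀ v ∈ J, ∀ w ∈ J, g v ≠ g w → (g w - g v).natAbs.divisors.card ≤ D) :
    energy ((I ×ˢ I) ×ˢ J) (fun z => (z.1.2 - z.1.1, c * z.1.2 ^ 3 - c * z.1.1 ^ 3 + g z.2)) ≤
      3 * I.card ^ 2 * energy J g + J.card ^ 2 * (2 * D) ^ 2 := by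
  rw [energy, Finset.card_eq_sum_card_fiberwise (f := fun z => (z.1.2, z.2.2)) (t := J ×ˢ J)
    (fun z hz => by
      have := (Finset.mem_filter.mp hz).1
      simp only [Finset.mem_product] at this
      exact Finset.mem_coe.mpr (Finset.mem_product.mpr ⟨this.1.2, this.2.2⟩))]
  have key : ∀ p ∈ J ×ˢ J, ((((((I ×ˢ I) ×ˢ J) ×ˢ ((I ×ˢ I) ×ˢ J)).filter fun z =>
      (z.1.1.2 - z.1.1.1, c * z.1.1.2 ^ 3 - c * z.1.1.1 ^ 3 + g z.1.2) =
      (z.2.1.2 - z.2.1.1, c * z.2.1.2 ^ 3 - c * z.2.1.1 ^ 3 + g z.2.2))).filter fun z =>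
        (z.1.2, z.2.2) = p).card ≤
      (if g p.1 = g p.2 then 3 * I.card ^ 2 else 0) + (2 * D) ^ 2 := by
    intro p hp
    have hp := Finset.mem_product.mp hp
    have h1 : ((((((I ×ˢ I) ×ˢ J) ×ˢ ((I ×ˢ I) ×ˢ J)).filter fun z =>
      (z.1.1.2 - z.1.1.1, c * z.1.1.2 ^ 3 - c * z.1.1.1 ^ 3 + g z.1.2) =
      (z.2.1.2 - z.2.1.1, c * z.2.1.2 ^ 3 - c * z.2.1.1 ^ 3 + g z.2.2))).filter fun z =>
        (z.1.2, z.2.2) = p).card ≤ (((I ×ˢ I) ×ˢ (I ×ˢ I)).filter fun z =>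
          z.1.2 - z.1.1 = z.2.2 - z.2.1 ∧ 3 * c * (z.1.2 - z.1.1) * (z.1.1 - z.2.1) *
          (z.1.2 + z.2.1) = g p.2 - g p.1).card := by
      refine Finset.card_le_card_of_injOn (fun z => (z.1.1, z.2.1)) ?_ ?_
      · intro z hz
        simp only [Finset.coe_filter, Set.mem_ofPred_eq, Finset.mem_filter, Finset.mem_product,
          Prod.mk.injEq] at hz ⊢
        obtain ⟨⟨hm, h1, h2⟩, rfl⟩ := hz
        refine ⟨⟨hm.1.1, hm.2.1⟩, h1, ?_⟩
        have e : z.1.1.2 = z.1.1.1 + z.2.1.2 - z.2.1.1 := by linarith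
        rw [e] at h2 ⊢
        linear_combination h2
      · intro z hz z' hz' hzz
        have e1 := (Finset.mem_filter.mp hz).2
        have e2 := (Finset.mem_filter.mp hz').2
        simp only [Prod.mk.injEq] at hzz
        rw [← e2, Prod.mk.injEq] at e1
        exact Prod.ext (Prod.ext hzz.1 e1.1) (Prod.ext hzz.2 e1.2)
    refine h1.trans ?_
    split_ifs with h
    · rw [h, sub_self]
      exact (card_cube_diff_le_of_eq hc I).trans (Nat.le_add_right _ _)
    · rw [zero_add]
      refine (card_cube_diff_le_of_ne (sub_ne_zero.mpr (Ne.symm h)) I).trans ?_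
      exact Nat.pow_le_pow_left (Nat.mul_le_mul_left 2 (hD _ hp.1 _ hp.2 h)) 2
  refine (Finset.sum_le_sum key).trans_eq ?_
  rw [Finset.sum_add_distrib, Finset.sum_const, ← Finset.sum_filter, Finset.sum_const,
    Finset.card_product, energy]
  simp only [smul_eq_mul]
  ring

theorem energy_cube_add_sq_le {ι : Type*} [DecidableEq ι] {c : ℤ} (hc : c ≠ 0) (Q : ℕ)
    (J : Finset ι) (g : ι → ℤ) (D : ℕ)
    (hD : ∀ v ∈ J, ∀ w ∈ J, g v ≠ g w → (g w - g v).natAbs.divisors.card ≤ D) :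
    energy (Finset.Icc (-(Q : ℤ)) Q ×ˢ J) (fun z => c * z.1 ^ 3 + g z.2) ^ 2 ≤
      energy J g * ((4 * Q + 1) * (3 * (2 * Q + 1) ^ 2 * energy J g + J.card ^ 2 * (2 * D) ^ 2)) := by
  set I := Finset.Icc (-(Q : ℤ)) Q with hI
  have hIc : I.card = 2 * Q + 1 := by rw [hI, Int.card_Icc]; omega
  have h1 := energy_cube_diff_le hc I J g D hD
  rw [hIc] at h1
  have h2 := energy_le_card_mul_energy ((I ×ˢ I) ×ˢ J)
    (fun z => c * z.1.2 ^ 3 - c * z.1.1 ^ 3 + g z.2) (fun z => z.1.2 - z.1.1)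
    (Finset.Icc (-(2 * Q : ℤ)) (2 * Q)) (by
      intro z hz
      simp only [Finset.mem_product, hI, Finset.mem_Icc] at hz ⊢
      constructor <;> linarith)
  have h3 : (Finset.Icc (-(2 * Q : ℤ)) (2 * Q)).card = 4 * Q + 1 := by rw [Int.card_Icc]; omega
  rw [h3] at h2
  refine le_trans ?_ (Nat.mul_le_mul_left _ (h2.trans (Nat.mul_le_mul_left _ h1)))
  refine le_trans (Nat.pow_le_pow_left ?_ 2) (card_filter_sq_le_energy_mul_energy _ _ _ _)
  refine Finset.card_le_card_of_injOn (fun z => (z.1.2, ((z.1.1, z.2.1), z.2.2))) ?_ ?_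
  · intro z hz
    simp only [Finset.coe_filter, Set.mem_ofPred_eq, Finset.mem_product] at hz ⊢
    exact ⟨⟨hz.1.1.2, ⟨hz.1.1.1, hz.1.2.1⟩, hz.1.2.2⟩, by linarith [hz.2]⟩
  · rintro ⟨⟨a, b⟩, ⟨c, d⟩⟩ _ ⟨⟨a', b'⟩, ⟨c', d'⟩⟩ _ hzz
    simp only [Prod.mk.injEq] at hzz ⊢
    tauto

theorem card_cube_add_mem_pow_le {ι : Type*} [DecidableEq ι] {c : ℤ} (hc : c ≠ 0) (Q : ℕ)
    (J : Finset ι) (g : ι → ℤ) (D : ℕ)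
    (hD : ∀ v ∈ J, ∀ w ∈ J, g v ≠ g w → (g w - g v).natAbs.divisors.card ≤ D) (T : Finset ℤ) :
    ((Finset.Icc (-(Q : ℤ)) Q ×ˢ J).filter fun z => c * z.1 ^ 3 + g z.2 ∈ T).card ^ 4 ≤
      T.card ^ 2 * (energy J g * ((4 * Q + 1) * (3 * (2 * Q + 1) ^ 2 * energy J g +
        J.card ^ 2 * (2 * D) ^ 2))) := by
  have h1 := energy_cube_add_sq_le hc Q J g D hD
  have h2 := card_filter_sq_le_energy_mul_energy (Finset.Icc (-(Q : ℤ)) Q ×ˢ J) T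
    (fun z => c * z.1 ^ 3 + g z.2) id
  have h3 : energy T id = T.card := by
    rw [energy, ← Finset.card_image_of_injective T (f := fun t => (t, t))
      (fun a b h => (Prod.mk.inj h).1)]
    congr 1
    ext z
    simp only [Finset.mem_filter, Finset.mem_product, Finset.mem_image, id]
    constructor
    · rintro ⟨⟨h, _⟩, e⟩
      exact ⟨z.1, h, Prod.ext rfl e⟩
    · rintro ⟨t, ht, rfl⟩
      exact ⟨⟨ht, ht⟩, rfl⟩
  rw [h3] at h2
  have h4 : ((Finset.Icc (-(Q : ℤ)) Q ×ˢ J).filter fun z => c * z.1 ^ 3 + g z.2 ∈ T).card ≤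
      (((Finset.Icc (-(Q : ℤ)) Q ×ˢ J) ×ˢ T).filter fun z =>
        c * z.1.1 ^ 3 + g z.1.2 = id z.2).card := by
    refine Finset.card_le_card_of_injOn (fun z => (z, c * z.1 ^ 3 + g z.2)) ?_ ?_
    · intro z hz
      obtain ⟨h5, h6⟩ := Finset.mem_filter.mp (Finset.mem_coe.mp hz)
      exact Finset.mem_coe.mpr (Finset.mem_filter.mpr ⟨Finset.mem_product.mpr ⟨h5, h6⟩, rfl⟩)
    · intro z _ z' _ h
      exact (Prod.mk.inj h).1
  calc _ ≤ _ := Nat.pow_le_pow_left h4 4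
    _ = (_ ^ 2) ^ 2 := by rw [← pow_mul]
    _ ≤ _ := Nat.pow_le_pow_left h2 2
    _ = T.card ^ 2 * _ ^ 2 := by rw [mul_pow, mul_comm]
    _ ≤ _ := Nat.mul_le_mul_left _ h1

theorem abs_binCubic_sub_le {α β γ κ q₁ q₂ q₃ l₁ l₂ k : ℤ} {M Q : ℕ} (hQ : 1 ≤ Q)
    (hα : |α| ≤ M) (hβ : |β| ≤ M) (hγ : |γ| ≤ M) (hκ : |κ| ≤ M)
    (h₁ : |q₁| ≤ M * (Q : ℤ) ^ 2) (h₂ : |q₂| ≤ M * (Q : ℤ) ^ 2) (h₃ : |q₃| ≤ M * (Q : ℤ) ^ 2)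
    (h₄ : |l₁| ≤ M * (Q : ℤ) ^ 2) (h₅ : |l₂| ≤ M * (Q : ℤ) ^ 2) {p : ℤ × ℤ} (hp : p ∈ intBox Q) :
    |binCubic α β γ κ q₁ q₂ q₃ l₁ l₂ k p - k| ≤ 9 * (M * (Q : ℤ) ^ 4) := by
  have hQ' : (1 : ℤ) ≤ Q := by exact_mod_cast hQ
  obtain ⟨h6, h7⟩ := mem_intBox.mp hp
  have p34 : (Q : ℤ) ^ 3 ≤ (Q : ℤ) ^ 4 := by nlinarith [pow_nonneg (by linarith : (0 : ℤ) ≤ Q) 3]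
  have mm : ∀ {x y a b : ℤ}, |x| ≤ a → |y| ≤ b → |x * y| ≤ a * b := by
    intro x y a b hx hy
    rw [abs_mul]
    exact mul_le_mul hx hy (abs_nonneg _) ((abs_nonneg _).trans hx)
  have hM3 : (M : ℤ) * (Q * Q * Q) ≤ M * (Q : ℤ) ^ 4 :=
    mul_le_mul_of_nonneg_left (by linarith) (by positivity)
  have hM4 : (M : ℤ) * (Q : ℤ) ^ 2 * (Q * Q) ≤ M * (Q : ℤ) ^ 4 := le_of_eq (by ring)
  have hM5 : (M : ℤ) * (Q : ℤ) ^ 2 * Q ≤ M * (Q : ℤ) ^ 4 := by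
    calc (M : ℤ) * (Q : ℤ) ^ 2 * Q = M * (Q * Q * Q) := by ring
      _ ≤ _ := hM3
  have e1 := abs_le.mp ((mm hα (mm (mm h6 h6) h6)).trans hM3)
  have e2 := abs_le.mp ((mm hβ (mm (mm h6 h6) h7)).trans hM3)
  have e3 := abs_le.mp ((mm hγ (mm (mm h6 h7) h7)).trans hM3)
  have e4 := abs_le.mp ((mm hκ (mm (mm h7 h7) h7)).trans hM3)
  have e5 := abs_le.mp ((mm h₁ (mm h6 h6)).trans hM4)
  have e6 := abs_le.mp ((mm h₂ (mm h6 h7)).trans hM4)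
  have e7 := abs_le.mp ((mm h₃ (mm h7 h7)).trans hM4)
  have e8 := abs_le.mp ((mm h₄ h6).trans hM5)
  have e9 := abs_le.mp ((mm h₅ h7).trans hM5)
  rw [binCubic]
  exact abs_le.mpr ⟨by linarith, by linarith⟩

/-- The number of values of `c x ^ 3 + g(a, b)` in a set `T` is at most about
`Q ^ (7 / 4) * |T| ^ (1 / 2)`, for a binary cubic `g` with nonvanishing Hessian. -/
theorem card_cube_add_binCubic_mem_le {ε : ℝ} (hε : 0 < ε) {c α β γ κ : ℤ} (hc : c ≠ 0)
    (hα : α ≠ 0) (hH : β ^ 2 - 3 * α * γ ≠ 0) (M : ℕ) :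
    ∃ K : ℝ, 0 ≤ K ∧ ∀ (Q : ℕ) (q₁ q₂ q₃ l₁ l₂ k : ℤ), 1 ≤ Q → |q₁| ≤ M * (Q : ℤ) ^ 2 →
      |q₂| ≤ M * (Q : ℤ) ^ 2 → |q₃| ≤ M * (Q : ℤ) ^ 2 → |l₁| ≤ M * (Q : ℤ) ^ 2 →
      |l₂| ≤ M * (Q : ℤ) ^ 2 → ∀ T : Finset ℤ,
      ((((Finset.Icc (-(Q : ℤ)) Q ×ˢ intBox Q).filter fun z =>
        c * z.1 ^ 3 + binCubic α β γ κ q₁ q₂ q₃ l₁ l₂ k z.2 ∈ T).card : ℕ) : ℝ) ^ 4 ≤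
      K * (T.card : ℝ) ^ 2 * (Q : ℝ) ^ (7 + ε) := by
  have hη : 0 < ε / 3 := by positivity
  obtain ⟨K₁, hK₁, h1⟩ := card_binCubic_eq_le (κ := κ) hη hα hH M
  obtain ⟨K₂, hK₂, h2⟩ := card_divisors_le_rpow (ε := ε / 3 / 4) (by positivity)
  set N : ℕ := M + 1 + α.natAbs + β.natAbs + γ.natAbs + κ.natAbs with hN
  set K₃ : ℝ := K₂ * (18 * N) ^ (ε / 3 / 4) with hK₃
  have hK₂' : 0 ≤ K₂ := by linarith
  have hK₃0 : 0 ≤ K₃ := by positivity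
  refine ⟨5 * K₁ * (27 * K₁ + 324 * K₃ ^ 2), by positivity, ?_⟩
  intro Q q₁ q₂ q₃ l₁ l₂ k hQ h₁ h₂ h₃ h₄ h₅ T
  have hMN : (M : ℤ) * (Q : ℤ) ^ 2 ≤ N * (Q : ℤ) ^ 2 :=
    mul_le_mul_of_nonneg_right (by exact_mod_cast (show M ≤ N by omega)) (by positivity)
  have hE := h1 Q q₁ q₂ q₃ l₁ l₂ k hQ h₁ h₂ h₃ h₄ h₅
  have hb := fun p => abs_binCubic_sub_le (k := k) (p := p) (α := α) (β := β) (γ := γ) (κ := κ) hQ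
    (by rw [hN, Int.abs_eq_natAbs]; omega) (by rw [hN, Int.abs_eq_natAbs]; omega)
    (by rw [hN, Int.abs_eq_natAbs]; omega) (by rw [hN, Int.abs_eq_natAbs]; omega)
    (h₁.trans hMN) (h₂.trans hMN) (h₃.trans hMN) (h₄.trans hMN) (h₅.trans hMN)
  set g := binCubic α β γ κ q₁ q₂ q₃ l₁ l₂ k with hg
  set X : ℝ := (Q : ℝ) ^ (ε / 3) with hX
  have hQ1 : (1 : ℝ) ≤ Q := by exact_mod_cast hQ
  have hX1 : 1 ≤ X := Real.one_le_rpow hQ1 hη.le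
  have hD := card_cube_add_mem_pow_le hc Q (intBox Q) g ⌊K₃ * X⌋₊ (by
    intro v hv w hw hvw
    refine Nat.le_floor ?_
    have hne : g w - g v ≠ 0 := sub_ne_zero.mpr (Ne.symm hvw)
    refine (h2 _ (Int.natAbs_ne_zero.mpr hne)).trans ?_
    have hle : (((g w - g v).natAbs : ℕ) : ℝ) ≤ 18 * N * (Q : ℝ) ^ 4 := by
      have hv := abs_le.mp (hb v hv)
      have hw := abs_le.mp (hb w hw)
      have : |g w - g v| ≤ 18 * N * (Q : ℤ) ^ 4 := abs_le.mpr ⟨by linarith, by linarith⟩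
      rw [Int.abs_eq_natAbs] at this
      exact_mod_cast this
    calc K₂ * (((g w - g v).natAbs : ℕ) : ℝ) ^ (ε / 3 / 4)
        ≤ K₂ * (18 * N * (Q : ℝ) ^ 4) ^ (ε / 3 / 4) := by gcongr
      _ = K₃ * X := by
        rw [Real.mul_rpow (by positivity) (by positivity), ← Real.rpow_natCast (Q : ℝ) 4,
          ← Real.rpow_mul (by positivity), hK₃, hX, mul_assoc]
        congr 3; push_cast; ring) T
  have hfl : ((⌊K₃ * X⌋₊ : ℕ) : ℝ) ≤ K₃ * X := Nat.floor_le (by positivity)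
  have hE' : ((energy (intBox Q) g : ℕ) : ℝ) ≤ K₁ * ((Q : ℝ) ^ 2 * X) := by
    rw [Real.rpow_add (by positivity), Real.rpow_two] at hE
    exact hE
  rw [card_intBox] at hD
  have hD' : ((((Finset.Icc (-(Q : ℤ)) Q ×ˢ intBox Q).filter fun z =>
        c * z.1 ^ 3 + g z.2 ∈ T).card : ℕ) : ℝ) ^ 4 ≤ (T.card : ℝ) ^ 2 *
        ((energy (intBox Q) g : ℕ) * ((4 * Q + 1) * (3 * (2 * Q + 1) ^ 2 * (energy (intBox Q) g : ℕ) +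
        ((2 * Q + 1) ^ 2) ^ 2 * (2 * (⌊K₃ * X⌋₊ : ℕ)) ^ 2))) := by exact_mod_cast hD
  refine hD'.trans ?_
  have hpow : (Q : ℝ) ^ (7 + ε) = (Q : ℝ) ^ 7 * X ^ 3 := by
    rw [Real.rpow_add (by positivity), hX, ← Real.rpow_natCast ((Q : ℝ) ^ (ε / 3)) 3,
      ← Real.rpow_mul (by positivity)]
    congr 1
    · norm_cast
    · congr 1; push_cast; ring
  have s1 : (2 * Q + 1 : ℝ) ≤ 3 * Q := by linarith
  calc _ ≤ (T.card : ℝ) ^ 2 * ((K₁ * ((Q : ℝ) ^ 2 * X)) * ((5 * Q) * (3 * (3 * Q) ^ 2 *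
        (K₁ * ((Q : ℝ) ^ 2 * X)) + ((3 * Q) ^ 2) ^ 2 * (2 * (K₃ * X)) ^ 2))) := by
        gcongr
        linarith
    _ = (T.card : ℝ) ^ 2 * (Q : ℝ) ^ 7 * (5 * K₁ * (27 * K₁ * X ^ 2 + 324 * K₃ ^ 2 * X ^ 3)) := by
        ring
    _ ≤ (T.card : ℝ) ^ 2 * (Q : ℝ) ^ 7 * (5 * K₁ * (27 * K₁ * X ^ 3 + 324 * K₃ ^ 2 * X ^ 3)) := by
        gcongr
        · norm_num
    _ = _ := by rw [hpow]; ring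

/-- The trilinear form with coefficients `t`. -/
def triForm {n : ℕ} (t : Fin n → Fin n → Fin n → ℤ) (x y z : Fin n → ℤ) : ℤ :=
  ∑ i, ∑ j, ∑ k, t i j k * x i * y j * z k

section triForm
variable {n : ℕ} (t : Fin n → Fin n → Fin n → ℤ) (x x' y z : Fin n → ℤ) (a : ℤ)

theorem triForm_add₁ : triForm t (x + x') y z = triForm t x y z + triForm t x' y z := by
  simp only [triForm, ← Finset.sum_add_distrib, Pi.add_apply]
  exact Finset.sum_congr rfl fun i _ => Finset.sum_congr rfl fun j _ =>
    Finset.sum_congr rfl fun k _ => by ring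

theorem triForm_add₂ : triForm t y (x + x') z = triForm t y x z + triForm t y x' z := by
  simp only [triForm, ← Finset.sum_add_distrib, Pi.add_apply]
  exact Finset.sum_congr rfl fun i _ => Finset.sum_congr rfl fun j _ =>
    Finset.sum_congr rfl fun k _ => by ring

theorem triForm_add₃ : triForm t y z (x + x') = triForm t y z x + triForm t y z x' := by
  simp only [triForm, ← Finset.sum_add_distrib, Pi.add_apply]
  exact Finset.sum_congr rfl fun i _ => Finset.sum_congr rfl fun j _ =>
    Finset.sum_congr rfl fun k _ => by ring

theorem triForm_smul₁ : triForm t (a • x) y z = a * triForm t x y z := by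
  simp only [triForm, Finset.mul_sum, Pi.smul_apply, smul_eq_mul]
  exact Finset.sum_congr rfl fun i _ => Finset.sum_congr rfl fun j _ =>
    Finset.sum_congr rfl fun k _ => by ring

theorem triForm_smul₂ : triForm t y (a • x) z = a * triForm t y x z := by
  simp only [triForm, Finset.mul_sum, Pi.smul_apply, smul_eq_mul]
  exact Finset.sum_congr rfl fun i _ => Finset.sum_congr rfl fun j _ =>
    Finset.sum_congr rfl fun k _ => by ring

theorem triForm_smul₃ : triForm t y z (a • x) = a * triForm t y z x := by
  simp only [triForm, Finset.mul_sum, Pi.smul_apply, smul_eq_mul]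
  exact Finset.sum_congr rfl fun i _ => Finset.sum_congr rfl fun j _ =>
    Finset.sum_congr rfl fun k _ => by ring

/-- The part of the cubic form on the span of `x` and `y` of degree two in `x`. -/
def triForm₂₁ : ℤ := triForm t x x y + triForm t x y x + triForm t y x x

theorem triForm_diag_add_smul (w e₁ e₂ : Fin n → ℤ) (p : ℤ × ℤ) :
    triForm t (w + p.1 • e₁ + p.2 • e₂) (w + p.1 • e₁ + p.2 • e₂) (w + p.1 • e₁ + p.2 • e₂) =
      binCubic (triForm t e₁ e₁ e₁) (triForm₂₁ t e₁ e₂) (triForm₂₁ t e₂ e₁) (triForm t e₂ e₂ e₂)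
        (triForm₂₁ t e₁ w) (triForm t w e₁ e₂ + triForm t w e₂ e₁ + triForm t e₁ w e₂ +
          triForm t e₂ w e₁ + triForm t e₁ e₂ w + triForm t e₂ e₁ w) (triForm₂₁ t e₂ w)
        (triForm₂₁ t w e₁) (triForm₂₁ t w e₂) (triForm t w w w) p := by
  simp only [triForm_add₁, triForm_add₂, triForm_add₃, triForm_smul₁, triForm_smul₂, triForm_smul₃,
    binCubic, triForm₂₁]
  ring

theorem exists_abs_triForm_le : ∃ τ : ℕ, ∀ (x y z : Fin n → ℤ) (a b c : ℤ), (∀ i, |x i| ≤ a) →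
    (∀ i, |y i| ≤ b) → (∀ i, |z i| ≤ c) → 0 ≤ a → 0 ≤ b → 0 ≤ c →
    |triForm t x y z| ≤ τ * (a * b * c) := by
  refine ⟨∑ i, ∑ j, ∑ k, (t i j k).natAbs, fun x y z a b c hx hy hz ha hb hc => ?_⟩
  push_cast
  simp only [triForm, Finset.sum_mul]
  refine (Finset.abs_sum_le_sum_abs _ _).trans (Finset.sum_le_sum fun i _ => ?_)
  refine (Finset.abs_sum_le_sum_abs _ _).trans (Finset.sum_le_sum fun j _ => ?_)
  refine (Finset.abs_sum_le_sum_abs _ _).trans (Finset.sum_le_sum fun k _ => ?_)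
  rw [abs_mul, abs_mul, abs_mul, mul_assoc, mul_assoc]
  refine mul_le_mul_of_nonneg_left ?_ (abs_nonneg _)
  rw [mul_assoc]
  exact mul_le_mul (hx i) (mul_le_mul (hy j) (hz k) (abs_nonneg _) hb) (by positivity) ha

end triForm

theorem exists_triForm {n : ℕ} {𝒞 : MvPolynomial (Fin n) ℤ} (h : 𝒞.IsHomogeneous 3) :
    ∃ t : Fin n → Fin n → Fin n → ℤ, ∀ x, eval x 𝒞 = triForm t x x x := by
  rw [𝒞.as_sum]
  refine Finset.sum_induction _ (fun p => ∃ t : Fin n → Fin n → Fin n → ℤ,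
    ∀ x, eval x p = triForm t x x x) ?_ ?_ ?_
  · rintro p q ⟨t, ht⟩ ⟨u, hu⟩
    refine ⟨fun i j k => t i j k + u i j k, fun x => ?_⟩
    rw [map_add, ht, hu]
    simp only [triForm, ← Finset.sum_add_distrib]
    exact Finset.sum_congr rfl fun i _ => Finset.sum_congr rfl fun j _ =>
      Finset.sum_congr rfl fun k _ => by ring
  · exact ⟨fun _ _ _ => 0, fun x => by simp [triForm]⟩
  · intro m hm
    have hdeg : m.degree = 3 := by
      have := h (mem_support_iff.mp hm)
      rw [Finsupp.degree_eq_weight_one (R := ℕ)]; exact this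
    have hcard : Multiset.card (Finsupp.toMultiset m) = 3 := by
      rw [Finsupp.card_toMultiset]; exact hdeg
    obtain ⟨i, j, k, hijk⟩ := Multiset.card_eq_three.mp hcard
    refine ⟨fun i' j' k' => if i' = i then if j' = j then if k' = k then coeff m 𝒞 else 0 else 0 else 0,
      fun x => ?_⟩
    have hm' : m = Finsupp.single i 1 + Finsupp.single j 1 + Finsupp.single k 1 := by
      apply Multiset.toFinsupp.symm.injective
      change Finsupp.toMultiset m = Finsupp.toMultiset _
      rw [hijk, map_add, map_add]
      simp only [Finsupp.toMultiset_single, one_smul]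
      rfl
    have e : eval x (monomial m (coeff m 𝒞)) = coeff m 𝒞 * x i * x j * x k := by
      rw [eval_monomial]
      have : (m.prod fun n e => x n ^ e) = x i * x j * x k := by
        rw [hm', Finsupp.prod_add_index', Finsupp.prod_add_index']
        · simp
        all_goals simp [pow_add]
      rw [this]; ring
    rw [e]
    simp [triForm, ite_mul]

/-- A nondegenerate cubic form has a binary restriction with nonvanishing leading and Hessian
coefficients. -/
theorem exists_directions {n : ℕ} {𝒞 : MvPolynomial (Fin n) ℤ}
    (hdeg : ¬ ∃ (a : ℚ) (b : Fin n → ℚ), MvPolynomial.map (Int.castRingHom ℚ) 𝒞 =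
      MvPolynomial.C a * (∑ i, MvPolynomial.C (b i) * MvPolynomial.X i) ^ 3)
    {t : Fin n → Fin n → Fin n → ℤ} (ht : ∀ x, eval x 𝒞 = triForm t x x x) :
    ∃ e₁ e₂ : Fin n → ℤ, triForm t e₁ e₁ e₁ ≠ 0 ∧
      triForm₂₁ t e₁ e₂ ^ 2 - 3 * triForm t e₁ e₁ e₁ * triForm₂₁ t e₂ e₁ ≠ 0 := by
  obtain ⟨e₁, he₁⟩ : ∃ e₁, triForm t e₁ e₁ e₁ ≠ 0 := by
    by_contra! h0
    refine hdeg ⟨0, 0, ?_⟩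
    have : 𝒞 = 0 := MvPolynomial.funext fun x => by rw [ht, h0, map_zero]
    simp [this]
  obtain ⟨e₂, he₂⟩ : ∃ e₂, ¬ (triForm₂₁ t e₁ e₂ ^ 2 - 3 * triForm t e₁ e₁ e₁ * triForm₂₁ t e₂ e₁ = 0 ∧
      triForm₂₁ t e₁ e₂ * triForm₂₁ t e₂ e₁ - 9 * triForm t e₁ e₁ e₁ * triForm t e₂ e₂ e₂ = 0) := by
    by_contra! h0
    set α := triForm t e₁ e₁ e₁ with hα
    set b : Fin n → ℤ := fun i => triForm₂₁ t e₁ (Pi.single i 1) with hb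
    have hlin : ∀ x, triForm₂₁ t e₁ x = ∑ i, b i * x i := by
      intro x
      set φ : (Fin n → ℤ) →+ ℤ := ⟨⟨fun x => triForm₂₁ t e₁ x, by simp [triForm₂₁, triForm]⟩, by
        intro x y
        simp only [triForm₂₁, triForm_add₁, triForm_add₂, triForm_add₃]
        ring⟩ with hφ
      have hx : x = ∑ i, x i • (Pi.single i 1 : Fin n → ℤ) := by
        ext j; simp [Finset.sum_apply, Pi.single_apply]
      have h1 : φ x = ∑ i, x i • φ (Pi.single i 1) := by
        conv_lhs => rw [hx]
        rw [map_sum]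
        exact Finset.sum_congr rfl fun i _ => map_zsmul _ _ _
      change φ x = _
      rw [h1]
      exact Finset.sum_congr rfl fun i _ => by rw [smul_eq_mul, mul_comm]; rfl
    have hpoly : MvPolynomial.C (27 * α ^ 2) * 𝒞 =
        (∑ i, MvPolynomial.C (b i) * MvPolynomial.X i) ^ 3 := by
      refine MvPolynomial.funext fun x => ?_
      simp only [map_mul, map_pow, map_sum, eval_C, eval_X]
      rw [← hlin, ht]
      obtain ⟨h1, h2⟩ := h0 x
      refine mul_left_cancel₀ he₁ ?_
      linear_combination (-(α * triForm₂₁ t e₁ x)) * h1 - (3 * α ^ 2) * h2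
    refine hdeg ⟨1 / (27 * (α : ℚ) ^ 2), fun i => b i, ?_⟩
    have h1 := congrArg (MvPolynomial.map (Int.castRingHom ℚ)) hpoly
    simp only [map_mul, map_pow, map_sum, map_C, map_X] at h1
    have hα' : (α : ℚ) ≠ 0 := by exact_mod_cast he₁
    have e : ∀ i, (Int.castRingHom ℚ) (b i) = (b i : ℚ) := fun i => rfl
    simp only [e] at h1
    rw [← h1, ← map_pow, ← map_mul, ← mul_assoc, ← map_mul]
    have : 1 / (27 * (α : ℚ) ^ 2) * ((Int.castRingHom ℚ) 27 * (Int.castRingHom ℚ) α ^ 2) = 1 := by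
      simp only [eq_intCast, Int.cast_ofNat]; field_simp
    rw [this, map_one, one_mul]
  set α := triForm t e₁ e₁ e₁ with hα
  set β := triForm₂₁ t e₁ e₂ with hβ
  set γ := triForm₂₁ t e₂ e₁ with hγ
  set κ := triForm t e₂ e₂ e₂ with hκ
  set p : Polynomial ℤ := Polynomial.C κ * Polynomial.X ^ 3 + Polynomial.C γ * Polynomial.X ^ 2 +
    Polynomial.C β * Polynomial.X + Polynomial.C α with hp
  set q : Polynomial ℤ := Polynomial.C (γ ^ 2 - 3 * β * κ) * Polynomial.X ^ 2 +
    Polynomial.C (β * γ - 9 * α * κ) * Polynomial.X + Polynomial.C (β ^ 2 - 3 * α * γ) with hq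
  have hp0 : p ≠ 0 := fun h => he₁ <| by
    have : p.coeff 0 = α := by simp [hp]
    rw [← this, h, Polynomial.coeff_zero]
  have hq0 : q ≠ 0 := fun h => he₂ <| by
    have h1 : q.coeff 0 = β ^ 2 - 3 * α * γ := by
      simp only [hq, Polynomial.coeff_add, Polynomial.coeff_C_mul, Polynomial.coeff_X_pow,
        Polynomial.coeff_X, Polynomial.coeff_C]
      norm_num
    have h2 : q.coeff 1 = β * γ - 9 * α * κ := by
      simp only [hq, Polynomial.coeff_add, Polynomial.coeff_C_mul, Polynomial.coeff_X_pow,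
        Polynomial.coeff_X, Polynomial.coeff_C]
      norm_num
    rw [← h1, ← h2, h, Polynomial.coeff_zero, Polynomial.coeff_zero]; exact ⟨rfl, rfl⟩
  obtain ⟨k, hk⟩ : ∃ k : ℤ, (p * q).eval k ≠ 0 := by
    by_contra! h
    exact mul_ne_zero hp0 hq0 (Polynomial.funext fun k => by rw [h k, Polynomial.eval_zero])
  rw [Polynomial.eval_mul] at hk
  have hpk : p.eval k = κ * k ^ 3 + γ * k ^ 2 + β * k + α := by simp [hp]
  have hqk : q.eval k = (γ ^ 2 - 3 * β * κ) * k ^ 2 + (β * γ - 9 * α * κ) * k +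
    (β ^ 2 - 3 * α * γ) := by simp [hq]
  rw [hpk, hqk] at hk
  have a1 : triForm t (e₁ + k • e₂) (e₁ + k • e₂) (e₁ + k • e₂) =
      κ * k ^ 3 + γ * k ^ 2 + β * k + α := by
    simp only [triForm_add₁, triForm_add₂, triForm_add₃, triForm_smul₁, triForm_smul₂,
      triForm_smul₃, hα, hβ, hγ, hκ, triForm₂₁]
    ring
  have a2 : triForm₂₁ t (e₁ + k • e₂) e₂ = β + 2 * γ * k + 3 * κ * k ^ 2 := by
    simp only [triForm_add₁, triForm_add₂, triForm_add₃, triForm_smul₁, triForm_smul₂,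
      triForm_smul₃, hβ, hγ, hκ, triForm₂₁]
    ring
  have a3 : triForm₂₁ t e₂ (e₁ + k • e₂) = γ + 3 * κ * k := by
    simp only [triForm_add₁, triForm_add₂, triForm_add₃, triForm_smul₁, triForm_smul₂,
      triForm_smul₃, hγ, hκ, triForm₂₁]
    ring
  refine ⟨e₁ + k • e₂, e₂, ?_, ?_⟩
  · rw [a1]; exact left_ne_zero_of_mul hk
  · rw [a1, a2, a3]
    convert right_ne_zero_of_mul hk using 1
    ring

/-- The integer points of the cube of half-side `B` in dimension `n`. -/
noncomputable def cubeBox (n B : ℕ) : Finset (Fin n → ℤ) := Fintype.piFinset fun _ => Finset.Icc (-(B : ℤ)) B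

theorem mem_cubeBox {n B : ℕ} {x : Fin n → ℤ} : x ∈ cubeBox n B ↔ ∀ i, |x i| ≤ B := by
  simp [cubeBox, abs_le]

theorem card_cubeBox (n B : ℕ) : (cubeBox n B).card = (2 * B + 1) ^ n := by
  have : ((B : ℤ) + 1 + (B : ℤ)).toNat = 2 * B + 1 := by omega
  simp [cubeBox, Fintype.card_piFinset, this]

/-- Averaging over planes: a bound over all translates of a plane gives a bound over the box. -/
theorem card_mul_sq_le_sum_planes {n : ℕ} (e₁ e₂ : Fin n → ℤ) {L : ℕ} (h₁ : ∀ i, |e₁ i| ≤ L)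
    (h₂ : ∀ i, |e₂ i| ≤ L) (Q : ℕ) (f : ℤ → (Fin n → ℤ) → Prop) [∀ a b, Decidable (f a b)] :
    ((Finset.Icc (-(Q : ℤ)) Q ×ˢ cubeBox n Q).filter fun z => f z.1 z.2).card * Q ^ 2 ≤
      ∑ w ∈ cubeBox n ((1 + 2 * L) * Q), ((Finset.Icc (-(Q : ℤ)) Q ×ˢ intBox Q).filter
        fun z => f z.1 (w + z.2.1 • e₁ + z.2.2 • e₂)).card := by
  set A := (Finset.Icc (-(Q : ℤ)) Q ×ˢ cubeBox n Q).filter fun z => f z.1 z.2 with hA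
  set I := Finset.Icc (1 : ℤ) Q with hI
  have hIc : I.card = Q := by simp [hI]
  have e : A.card * Q ^ 2 = (A ×ˢ (I ×ˢ I)).card := by
    rw [Finset.card_product, Finset.card_product, hIc, sq]
  rw [e, Finset.card_eq_sum_card_fiberwise
    (f := fun z : (ℤ × (Fin n → ℤ)) × (ℤ × ℤ) => z.1.2 - z.2.1 • e₁ - z.2.2 • e₂)
    (t := cubeBox n ((1 + 2 * L) * Q))]
  · refine Finset.sum_le_sum fun w _ => ?_
    refine Finset.card_le_card_of_injOn (fun z => (z.1.1, z.2)) ?_ ?_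
    · rintro ⟨⟨x, y⟩, a, b⟩ h
      simp only [hA, hI, Finset.coe_filter, Finset.mem_product, Finset.mem_filter, Finset.mem_Icc,
        Set.mem_ofPred_eq, mem_intBox, abs_le] at h ⊢
      obtain ⟨⟨⟨⟨hx, hy⟩, hf⟩, ⟨ha1, ha2⟩, hb1, hb2⟩, rfl⟩ := h
      refine ⟨⟨hx, ⟨by omega, ha2⟩, by omega, hb2⟩, ?_⟩
      convert hf using 1
      abel
    · rintro ⟨⟨x, y⟩, a, b⟩ h ⟨⟨x', y'⟩, a', b'⟩ h' heq
      simp only [Finset.coe_filter, Set.mem_ofPred_eq] at h h'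
      simp only [Prod.mk.injEq] at heq
      obtain ⟨rfl, rfl, rfl⟩ := heq
      have := h.2.trans h'.2.symm
      simp only [sub_left_inj] at this
      rw [this]
  · rintro ⟨⟨x, y⟩, a, b⟩ h
    simp only [hA, hI, Finset.coe_product, Finset.coe_filter, Set.mem_prod, Set.mem_ofPred_eq,
      Finset.mem_product, Finset.coe_Icc, Set.mem_Icc, mem_cubeBox] at h
    obtain ⟨⟨⟨_, hy⟩, _⟩, ⟨ha1, ha2⟩, hb1, hb2⟩ := h
    simp only [Finset.mem_coe, mem_cubeBox, Pi.sub_apply, Pi.smul_apply, smul_eq_mul]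
    intro i
    have i1 : |a * e₁ i| ≤ Q * L := by
      rw [abs_mul]
      exact mul_le_mul (by rw [abs_le]; constructor <;> omega) (h₁ i) (abs_nonneg _) (by positivity)
    have i2 : |b * e₂ i| ≤ Q * L := by
      rw [abs_mul]
      exact mul_le_mul (by rw [abs_le]; constructor <;> omega) (h₂ i) (abs_nonneg _) (by positivity)
    have i3 := hy i
    rw [abs_le] at *
    push_cast
    constructor <;> nlinarith

/-- The number of points of a box at which `c x³ + 𝒞(y)` lies in a sparse set. -/
theorem card_cube_add_eval_mem_le {n : ℕ} {c : ℤ} (hc : c ≠ 0) {𝒞 : MvPolynomial (Fin n) ℤ}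
    (hhom : 𝒞.IsHomogeneous 3)
    (hdeg : ¬ ∃ (a : ℚ) (b : Fin n → ℚ), MvPolynomial.map (Int.castRingHom ℚ) 𝒞 =
      MvPolynomial.C a * (∑ i, MvPolynomial.C (b i) * MvPolynomial.X i) ^ 3)
    {ε : ℝ} (hε : 0 < ε) :
    ∃ K : ℝ, 0 ≤ K ∧ ∀ (Q : ℕ) (T : Finset ℤ), 1 ≤ Q →
      ((((Finset.Icc (-(Q : ℤ)) Q ×ˢ cubeBox n Q).filter fun z =>
        c * z.1 ^ 3 + eval z.2 𝒞 ∈ T).card : ℕ) : ℝ) ^ 4 ≤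
        K * (T.card : ℝ) ^ 2 * (Q : ℝ) ^ (4 * (n : ℝ) - 1 + ε) := by
  obtain ⟨t, ht⟩ := exists_triForm hhom
  obtain ⟨e₁, e₂, hα, hH⟩ := exists_directions hdeg ht
  obtain ⟨τ, hτ⟩ := exists_abs_triForm_le t
  obtain ⟨L, h₁, h₂⟩ : ∃ L : ℕ, (∀ i, |e₁ i| ≤ L) ∧ ∀ i, |e₂ i| ≤ L := by
    refine ⟨∑ i, ((e₁ i).natAbs + (e₂ i).natAbs), ?_, ?_⟩ <;>
    · intro i
      have := Finset.single_le_sum (f := fun i => (e₁ i).natAbs + (e₂ i).natAbs)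
        (fun _ _ => Nat.zero_le _) (Finset.mem_univ i)
      rw [Int.abs_eq_natAbs]
      omega
  set R := 1 + 2 * L with hR
  obtain ⟨K, hK0, hK⟩ := card_cube_add_binCubic_mem_le (κ := triForm t e₂ e₂ e₂) hε hc hα hH
    (6 * τ * L ^ 2 * R + 3 * τ * L * R ^ 2)
  refine ⟨((2 * R + 1 : ℝ) ^ n) ^ 4 * K, by positivity, fun Q T hQ => ?_⟩
  have hQ0 : (0 : ℝ) < Q := by exact_mod_cast hQ
  have hQ1 : (1 : ℤ) ≤ Q := by exact_mod_cast hQ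
  set V := (K * (T.card : ℝ) ^ 2 * (Q : ℝ) ^ (7 + ε)) ^ (1 / 4 : ℝ) with hV
  have hX : 0 ≤ K * (T.card : ℝ) ^ 2 * (Q : ℝ) ^ (7 + ε) := by positivity
  have hV0 : 0 ≤ V := by positivity
  have hV4 : V ^ 4 = K * (T.card : ℝ) ^ 2 * (Q : ℝ) ^ (7 + ε) := by
    rw [hV, ← Real.rpow_natCast, ← Real.rpow_mul hX]; norm_num
  have hbound : ∀ w ∈ cubeBox n (R * Q), ((((Finset.Icc (-(Q : ℤ)) Q ×ˢ intBox Q).filter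
      fun z => c * z.1 ^ 3 + eval (w + z.2.1 • e₁ + z.2.2 • e₂) 𝒞 ∈ T).card : ℕ) : ℝ) ≤ V := by
    intro w hw
    rw [mem_cubeBox] at hw
    rw [← pow_le_pow_iff_left₀ (Nat.cast_nonneg _) hV0 (n := 4) (by norm_num), hV4]
    simp only [ht, triForm_diag_add_smul]
    have hL : (0 : ℤ) ≤ L := by positivity
    have hR0 : (0 : ℤ) ≤ ((R * Q : ℕ) : ℤ) := by positivity
    have hz : (0 : ℤ) ≤ 3 * τ * L * R ^ 2 * (Q : ℤ) ^ 2 := by positivity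
    have hz' : (0 : ℤ) ≤ 3 * τ * L ^ 2 * R * (Q : ℤ) ^ 2 := by positivity
    have hz'' : (τ : ℤ) * (L * L * (R * Q)) ≤ τ * L ^ 2 * R * (Q : ℤ) ^ 2 := by
      rw [show (τ : ℤ) * (L * L * (R * Q)) = τ * L ^ 2 * R * Q * 1 by ring,
        show (τ : ℤ) * L ^ 2 * R * (Q : ℤ) ^ 2 = τ * L ^ 2 * R * Q * Q by ring]
      exact mul_le_mul_of_nonneg_left hQ1 (by positivity)
    have b1 : ∀ u, (∀ i, |u i| ≤ (L : ℤ)) → |triForm₂₁ t u w| ≤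
        ((6 * τ * L ^ 2 * R + 3 * τ * L * R ^ 2 : ℕ) : ℤ) * (Q : ℤ) ^ 2 := by
      intro u hu
      have i1 := hτ u u w _ _ _ hu hu hw hL hL hR0
      have i2 := hτ u w u _ _ _ hu hw hu hL hR0 hL
      have i3 := hτ w u u _ _ _ hw hu hu hR0 hL hL
      push_cast at *
      refine (abs_add_three _ _ _).trans ?_
      linarith
    have b2 : ∀ u, (∀ i, |u i| ≤ (L : ℤ)) → |triForm₂₁ t w u| ≤
        ((6 * τ * L ^ 2 * R + 3 * τ * L * R ^ 2 : ℕ) : ℤ) * (Q : ℤ) ^ 2 := by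
      intro u hu
      have i1 := hτ w w u _ _ _ hw hw hu hR0 hR0 hL
      have i2 := hτ w u w _ _ _ hw hu hw hR0 hL hR0
      have i3 := hτ u w w _ _ _ hu hw hw hL hR0 hR0
      push_cast at *
      refine (abs_add_three _ _ _).trans ?_
      linarith
    refine hK Q _ _ _ _ _ _ hQ (b1 e₁ h₁) ?_ (b1 e₂ h₂) (b2 e₁ h₁) (b2 e₂ h₂) T
    have i1 := hτ w e₁ e₂ _ _ _ hw h₁ h₂ hR0 hL hL
    have i2 := hτ w e₂ e₁ _ _ _ hw h₂ h₁ hR0 hL hL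
    have i3 := hτ e₁ w e₂ _ _ _ h₁ hw h₂ hL hR0 hL
    have i4 := hτ e₂ w e₁ _ _ _ h₂ hw h₁ hL hR0 hL
    have i5 := hτ e₁ e₂ w _ _ _ h₁ h₂ hw hL hL hR0
    have i6 := hτ e₂ e₁ w _ _ _ h₂ h₁ hw hL hL hR0
    push_cast at *
    rw [abs_le] at *
    constructor <;> linarith [i1.1, i1.2]
  have hsum := card_mul_sq_le_sum_planes e₁ e₂ h₁ h₂ Q (fun x y => c * x ^ 3 + eval y 𝒞 ∈ T)
  set W := ((Finset.Icc (-(Q : ℤ)) Q ×ˢ cubeBox n Q).filter fun z =>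
    c * z.1 ^ 3 + eval z.2 𝒞 ∈ T).card with hW
  have h3 : (W : ℝ) * (Q : ℝ) ^ 2 ≤ ((2 * R + 1) * Q : ℝ) ^ n * V := by
    calc (W : ℝ) * (Q : ℝ) ^ 2 ≤ ∑ w ∈ cubeBox n (R * Q), V := by
          refine le_trans ?_ (Finset.sum_le_sum hbound)
          exact_mod_cast hsum
      _ = ((2 * (R * Q) + 1 : ℕ) : ℝ) ^ n * V := by
          rw [Finset.sum_const, nsmul_eq_mul, card_cubeBox, Nat.cast_pow]
      _ ≤ _ := by
          refine mul_le_mul_of_nonneg_right (pow_le_pow_left₀ (by positivity) ?_ n) hV0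
          push_cast
          have : (1 : ℝ) ≤ Q := by exact_mod_cast hQ
          linarith
  have h4 := pow_le_pow_left₀ (by positivity) h3 4
  have e1 : (Q : ℝ) ^ (4 * (n : ℝ) - 1 + ε) * (Q : ℝ) ^ 8 = ((Q : ℝ) ^ n) ^ 4 * (Q : ℝ) ^ (7 + ε) := by
    rw [← pow_mul, ← Real.rpow_natCast, ← Real.rpow_natCast, ← Real.rpow_add hQ0,
      ← Real.rpow_add hQ0]
    congr 1
    push_cast
    ring
  refine le_of_mul_le_mul_right ?_ (show (0 : ℝ) < (Q : ℝ) ^ 8 by positivity)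
  calc (W : ℝ) ^ 4 * (Q : ℝ) ^ 8 = (W * (Q : ℝ) ^ 2) ^ 4 := by ring
    _ ≤ _ := h4
    _ = ((2 * R + 1 : ℝ) ^ n) ^ 4 * ((Q : ℝ) ^ n) ^ 4 * V ^ 4 := by rw [mul_pow, mul_pow, mul_pow]
    _ = ((2 * R + 1 : ℝ) ^ n) ^ 4 * K * (T.card : ℝ) ^ 2 *
        (((Q : ℝ) ^ n) ^ 4 * (Q : ℝ) ^ (7 + ε)) := by rw [hV4]; ring
    _ = _ := by rw [← e1]; ring

/-- The number of zeros of `c x³ + 𝒞(y)` modulo `m`. -/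
noncomputable def numZeros {n : ℕ} (c : ℤ) (𝒞 : MvPolynomial (Fin n) ℤ) (m : ℕ) : ℕ :=
  Nat.card {y : ZMod m × (Fin n → ZMod m) // (c : ZMod m) * y.1 ^ 3 + aeval y.2 𝒞 = 0}

theorem map_cube_add_aeval {n : ℕ} (c : ℤ) (𝒞 : MvPolynomial (Fin n) ℤ) {R S : Type*} [CommRing R]
    [CommRing S] (φ : R →+* S) (x : R) (y : Fin n → R) :
    φ ((c : R) * x ^ 3 + aeval y 𝒞) = (c : S) * φ x ^ 3 + aeval (fun i => φ (y i)) 𝒞 := by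
  have := comp_aeval_apply (f := y) φ.toIntAlgHom 𝒞
  simp only [RingHom.toIntAlgHom_apply] at this
  rw [map_add, map_mul, map_pow, map_intCast, this]

theorem numZeros_one {n : ℕ} (c : ℤ) (𝒞 : MvPolynomial (Fin n) ℤ) : numZeros c 𝒞 1 = 1 := by
  rw [numZeros, Nat.card_eq_one_iff_unique]
  exact ⟨inferInstance, ⟨⟨0, Subsingleton.elim _ _⟩⟩⟩

theorem numZeros_mul {n : ℕ} (c : ℤ) (𝒞 : MvPolynomial (Fin n) ℤ) {k m : ℕ} (h : k.Coprime m) :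
    numZeros c 𝒞 (k * m) = numZeros c 𝒞 k * numZeros c 𝒞 m := by
  rw [numZeros, numZeros, numZeros, ← Nat.card_prod]
  let φ := ZMod.chineseRemainder h
  let φ₁ : ZMod (k * m) →+* ZMod k := (RingHom.fst _ _).comp φ.toRingHom
  let φ₂ : ZMod (k * m) →+* ZMod m := (RingHom.snd _ _).comp φ.toRingHom
  have hφ : ∀ x, φ x = (φ₁ x, φ₂ x) := fun x => rfl
  have hz : ∀ x, φ₁ x = 0 → φ₂ x = 0 → x = 0 := fun x h1 h2 => by
    apply φ.injective; rw [hφ, h1, h2, map_zero]; rfl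
  have hs₁ : ∀ a b, φ₁ (φ.symm (a, b)) = a := fun a b => by
    have := hφ (φ.symm (a, b)); rw [φ.apply_symm_apply] at this; exact (congrArg Prod.fst this).symm
  have hs₂ : ∀ a b, φ₂ (φ.symm (a, b)) = b := fun a b => by
    have := hφ (φ.symm (a, b)); rw [φ.apply_symm_apply] at this; exact (congrArg Prod.snd this).symm
  have hss : ∀ x, φ.symm (φ₁ x, φ₂ x) = x := fun x => by rw [← hφ, φ.symm_apply_apply]
  refine Nat.card_congr
    { toFun := fun y => (⟨(φ₁ y.1.1, fun i => φ₁ (y.1.2 i)), ?_⟩, ⟨(φ₂ y.1.1, fun i => φ₂ (y.1.2 i)), ?_⟩)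
      invFun := fun y => ⟨(φ.symm (y.1.1.1, y.2.1.1), fun i => φ.symm (y.1.1.2 i, y.2.1.2 i)), ?_⟩
      left_inv := ?_
      right_inv := ?_ }
  · rw [← map_cube_add_aeval, y.2, map_zero]
  · rw [← map_cube_add_aeval, y.2, map_zero]
  · apply hz
    · rw [map_cube_add_aeval]; simp only [hs₁]; exact y.1.2
    · rw [map_cube_add_aeval]; simp only [hs₂]; exact y.2.2
  · rintro ⟨⟨x, y⟩, h⟩; simp only [hss]
  · rintro ⟨⟨⟨x, y⟩, h⟩, ⟨x', y'⟩, h'⟩; simp only [hs₁, hs₂]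

theorem numZeros_le {n : ℕ} (c : ℤ) (𝒞 : MvPolynomial (Fin n) ℤ) {m : ℕ} (hm : m ≠ 0) :
    numZeros c 𝒞 m ≤ m ^ (n + 1) := by
  have : NeZero m := ⟨hm⟩
  refine (Nat.card_le_card_of_injective _ Subtype.val_injective).trans ?_
  rw [Nat.card_prod, Nat.card_pi]
  simp [pow_succ, mul_comm]

section primeSquare
variable {p : ℕ} [Fact p.Prime]

/-- Reduction from `ℤ/p²` to `ℤ/p`. -/
noncomputable def redSq (p : ℕ) : ZMod (p ^ 2) →+* ZMod p :=
  ZMod.castHom (dvd_pow_self p two_ne_zero) (ZMod p)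

theorem val_redSq (x : ZMod (p ^ 2)) : (redSq p x).val = x.val % p := by
  rw [redSq, ZMod.castHom_apply, ← ZMod.natCast_val, ZMod.val_natCast]

theorem eq_of_redSq_eq {x y : ZMod (p ^ 2)} (h : redSq p x = redSq p y)
    (h' : x.val / p = y.val / p) : x = y := by
  apply ZMod.val_injective
  rw [← Nat.div_add_mod x.val p, ← Nat.div_add_mod y.val p, ← val_redSq, ← val_redSq, h, h']

theorem val_div_lt (x : ZMod (p ^ 2)) : x.val / p < p := by
  have := ZMod.val_lt x
  exact Nat.div_lt_of_lt_mul (by rwa [← sq])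

theorem isUnit_of_redSq_ne_zero {x : ZMod (p ^ 2)} (h : redSq p x ≠ 0) : IsUnit x := by
  rw [← ZMod.natCast_zmod_val x, ZMod.isUnit_iff_coprime]
  refine Nat.Coprime.pow_right 2 (Nat.Coprime.symm ?_)
  rw [Nat.Prime.coprime_iff_not_dvd Fact.out]
  intro hd
  apply h
  rw [← ZMod.val_eq_zero, val_redSq]
  exact Nat.mod_eq_zero_of_dvd hd

/-- Cubes of units modulo `p²` determine the unit up to its residue modulo `p`. -/
theorem eq_of_cube_eq {c : ℤ} (h3 : (3 : ZMod p) ≠ 0) (hc : (c : ZMod p) ≠ 0) {x y : ZMod (p ^ 2)}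
    (hx : redSq p x ≠ 0) (h : redSq p x = redSq p y)
    (he : (c : ZMod (p ^ 2)) * x ^ 3 = (c : ZMod (p ^ 2)) * y ^ 3) : x = y := by
  have hu : IsUnit ((c : ZMod (p ^ 2)) * (x ^ 2 + x * y + y ^ 2)) := by
    apply isUnit_of_redSq_ne_zero
    simp only [map_mul, map_add, map_pow, map_intCast, ← h]
    have : redSq p x ^ 2 + redSq p x * redSq p x + redSq p x ^ 2 = 3 * redSq p x ^ 2 := by ring
    rw [this]
    exact mul_ne_zero hc (mul_ne_zero h3 (pow_ne_zero 2 hx))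
  rw [← sub_eq_zero]
  refine hu.mul_left_cancel ?_
  rw [mul_zero]
  linear_combination he

theorem card_cube_roots_le {c : ℤ} (hc : (c : ZMod p) ≠ 0) (a : ZMod p) :
    Nat.card {x : ZMod p // (c : ZMod p) * x ^ 3 + a = 0} ≤ 3 := by
  classical
  set q : Polynomial (ZMod p) := Polynomial.C (c : ZMod p) * Polynomial.X ^ 3 + Polynomial.C a with hq
  have hq0 : q ≠ 0 := fun h => hc <| by
    have : q.coeff 3 = c := by rw [hq]; compute_degree!
    rw [← this, h, Polynomial.coeff_zero]
  rw [Nat.card_eq_fintype_card, Fintype.card_subtype]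
  refine (Finset.card_le_card (t := q.roots.toFinset) fun x hx => ?_).trans
    ((Multiset.toFinset_card_le _).trans ((Polynomial.card_roots' q).trans ?_))
  · rw [Finset.mem_filter] at hx
    rw [Multiset.mem_toFinset, Polynomial.mem_roots hq0]
    simp only [hq, Polynomial.IsRoot.def, Polynomial.eval_add, Polynomial.eval_mul, Polynomial.eval_C,
      Polynomial.eval_pow, Polynomial.eval_X]
    exact hx.2
  · rw [hq]; compute_degree

theorem card_zeros_mul_le {n : ℕ} {𝒞 : MvPolynomial (Fin n) ℤ} (hhom : 𝒞.IsHomogeneous 3)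
    (hp : MvPolynomial.map (Int.castRingHom (ZMod p)) 𝒞 ≠ 0) :
    Nat.card {y : Fin n → ZMod p // aeval y 𝒞 = 0} * p ≤ 3 * p ^ n := by
  classical
  have h := MvPolynomial.schwartz_zippel_totalDegree hp Finset.univ
  have hp0 : (0 : ℚ≥0) < p := by exact_mod_cast (Fact.out : p.Prime).pos
  rw [Finset.card_univ, ZMod.card, div_le_div_iff₀ (by positivity) hp0] at h
  have hd : (MvPolynomial.map (Int.castRingHom (ZMod p)) 𝒞).totalDegree ≤ 3 :=
    (hhom.map _).totalDegree_le
  have e : Nat.card {y : Fin n → ZMod p // aeval y 𝒞 = 0} =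
      (Finset.filter (fun f => eval f (MvPolynomial.map (Int.castRingHom (ZMod p)) 𝒞) = 0)
        (Fintype.piFinset fun _ : Fin n => (Finset.univ : Finset (ZMod p)))).card := by
    rw [Nat.card_eq_fintype_card, Fintype.card_subtype, Fintype.piFinset_univ]
    simp only [aeval_def, eval₂_eq_eval_map]
    rfl
  rw [e]
  have h' : (Finset.filter (fun f => eval f (MvPolynomial.map (Int.castRingHom (ZMod p)) 𝒞) = 0)
        (Fintype.piFinset fun _ : Fin n => (Finset.univ : Finset (ZMod p)))).card * p ≤
      (MvPolynomial.map (Int.castRingHom (ZMod p)) 𝒞).totalDegree * p ^ n := by exact_mod_cast h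
  exact h'.trans (Nat.mul_le_mul_right _ hd)

theorem card_lifts_le {n : ℕ} (A : (Fin n → ZMod p) → Prop) :
    Nat.card {y : Fin n → ZMod (p ^ 2) // A fun i => redSq p (y i)} ≤
      Nat.card {y : Fin n → ZMod p // A y} * p ^ n := by
  have e : Nat.card {y : Fin n → ZMod p // A y} * p ^ n =
      Nat.card ({y : Fin n → ZMod p // A y} × (Fin n → Fin p)) := by
    rw [Nat.card_prod, Nat.card_pi]; simp
  rw [e]
  refine Nat.card_le_card_of_injective
    (fun y => (⟨fun i => redSq p (y.1 i), y.2⟩, fun i => ⟨(y.1 i).val / p, val_div_lt _⟩)) ?_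
  rintro ⟨y, hy⟩ ⟨y', hy'⟩ h
  simp only [Prod.mk.injEq, Subtype.mk.injEq, funext_iff, Fin.mk.injEq] at h
  exact Subtype.ext (funext fun i => eq_of_redSq_eq (h.1 i) (h.2 i))

theorem card_redSq_eq_zero_le : Nat.card {x : ZMod (p ^ 2) // redSq p x = 0} ≤ p := by
  conv_rhs => rw [← Nat.card_fin p]
  refine Nat.card_le_card_of_injective (fun x => ⟨x.1.val / p, val_div_lt _⟩) ?_
  rintro ⟨x, hx⟩ ⟨y, hy⟩ h
  exact Subtype.ext (eq_of_redSq_eq (hx.trans hy.symm) (by simpa using h))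

theorem numZeros_prime_sq_le {n : ℕ} {c : ℤ} {𝒞 : MvPolynomial (Fin n) ℤ} (hhom : 𝒞.IsHomogeneous 3)
    (h3 : (3 : ZMod p) ≠ 0) (hc : (c : ZMod p) ≠ 0)
    (hp : MvPolynomial.map (Int.castRingHom (ZMod p)) 𝒞 ≠ 0) :
    numZeros c 𝒞 (p ^ 2) ≤ 6 * p ^ (2 * n) := by
  classical
  set Z₁ := {y : Fin n → ZMod (p ^ 2) // aeval (fun i => redSq p (y i)) 𝒞 = 0}
  set Z₀ := {x : ZMod (p ^ 2) // redSq p x = 0}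
  set V := Σ y : Fin n → ZMod (p ^ 2), {x : ZMod p // (c : ZMod p) * x ^ 3 +
    aeval (fun i => redSq p (y i)) 𝒞 = 0}
  have hred : ∀ y : {y : ZMod (p ^ 2) × (Fin n → ZMod (p ^ 2)) //
      (c : ZMod (p ^ 2)) * y.1 ^ 3 + aeval y.2 𝒞 = 0},
      (c : ZMod p) * redSq p y.1.1 ^ 3 + aeval (fun i => redSq p (y.1.2 i)) 𝒞 = 0 := fun y => by
    rw [← map_cube_add_aeval, y.2, map_zero]
  have hV : Nat.card V ≤ 3 * p ^ (2 * n) := by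
    rw [Nat.card_sigma]
    refine (Finset.sum_le_sum fun y _ => card_cube_roots_le hc _).trans ?_
    simp only [Finset.sum_const, Finset.card_univ, Fintype.card_pi, ZMod.card, Finset.prod_const,
      Fintype.card_fin, smul_eq_mul]
    rw [← pow_mul, mul_comm]
  have hZ : Nat.card (Z₀ × Z₁) ≤ 3 * p ^ (2 * n) := by
    rw [Nat.card_prod]
    calc Nat.card Z₀ * Nat.card Z₁ ≤ p * (Nat.card {y : Fin n → ZMod p // aeval y 𝒞 = 0} * p ^ n) :=
          Nat.mul_le_mul card_redSq_eq_zero_le (card_lifts_le fun y => aeval y 𝒞 = 0)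
      _ = Nat.card {y : Fin n → ZMod p // aeval y 𝒞 = 0} * p * p ^ n := by ring
      _ ≤ 3 * p ^ n * p ^ n := Nat.mul_le_mul_right _ (card_zeros_mul_le hhom hp)
      _ = _ := by ring
  have hinj : numZeros c 𝒞 (p ^ 2) ≤ Nat.card (V ⊕ Z₀ × Z₁) := by
    refine Nat.card_le_card_of_injective (fun y => if h : redSq p y.1.1 = 0 then
      Sum.inr (⟨y.1.1, h⟩, ⟨y.1.2, ?_⟩) else Sum.inl ⟨y.1.2, redSq p y.1.1, hred y⟩) ?_
    · have := hred y
      rw [h] at this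
      simpa using this
    · rintro ⟨⟨x, y⟩, h⟩ ⟨⟨x', y'⟩, h'⟩ heq
      simp only at heq h h'
      split_ifs at heq with h1 h2 h2
      · simp only [Sum.inr.injEq, Prod.mk.injEq] at heq
        rw [Subtype.mk.injEq, Prod.mk.injEq]
        exact ⟨congrArg Subtype.val heq.1, congrArg Subtype.val heq.2⟩
      · simp only [Sum.inl.injEq] at heq
        obtain rfl : y = y' := congrArg Sigma.fst heq
        have hx : redSq p x = redSq p x' :=
          congrArg (fun v : V => v.2.1) heq
        obtain rfl : x = x' := eq_of_cube_eq (c := c) h3 hc h1 hx (by linear_combination h - h')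
        rfl
  rw [Nat.card_sum] at hinj
  omega

end primeSquare

theorem exists_numZeros_prime_sq_le {n : ℕ} {c : ℤ} (hc : c ≠ 0) {𝒞 : MvPolynomial (Fin n) ℤ}
    (hhom : 𝒞.IsHomogeneous 3) (h0 : 𝒞 ≠ 0) :
    ∃ k : ℕ, ∀ p : ℕ, p.Prime → numZeros c 𝒞 (p ^ 2) ≤ 2 ^ k * p ^ (2 * n) := by
  obtain ⟨m, hm⟩ := MvPolynomial.ne_zero_iff.mp h0
  set E := (3 * c * coeff m 𝒞).natAbs with hE
  have hE0 : E ≠ 0 := by rw [hE, Int.natAbs_ne_zero]; positivity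
  refine ⟨6 + E ^ 2, fun p hp => ?_⟩
  have hk : 6 + E ^ 2 ≤ 2 ^ (6 + E ^ 2) := Nat.lt_two_pow_self.le
  have := Fact.mk hp
  by_cases hd : p ∣ E
  · calc numZeros c 𝒞 (p ^ 2) ≤ (p ^ 2) ^ (n + 1) := numZeros_le c 𝒞 (pow_ne_zero 2 hp.ne_zero)
      _ = p ^ 2 * p ^ (2 * n) := by ring
      _ ≤ 2 ^ (6 + E ^ 2) * p ^ (2 * n) := by
          refine Nat.mul_le_mul_right _ (le_trans ?_ hk)
          have := Nat.pow_le_pow_left (Nat.le_of_dvd (Nat.pos_of_ne_zero hE0) hd) 2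
          omega
  · have hz : ((3 * c * coeff m 𝒞 : ℤ) : ZMod p) ≠ 0 := by
      rw [Ne, ZMod.intCast_zmod_eq_zero_iff_dvd, ← Int.natCast_dvd_natCast] at *
      rwa [hE, Int.dvd_natAbs] at hd
    push_cast at hz
    have h1 := left_ne_zero_of_mul hz
    refine (numZeros_prime_sq_le hhom (left_ne_zero_of_mul h1) (right_ne_zero_of_mul h1) ?_).trans
      (Nat.mul_le_mul_right _ (by omega))
    intro h
    apply right_ne_zero_of_mul hz
    have := congrArg (coeff m) h
    rwa [coeff_map, coeff_zero, eq_intCast] at this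

theorem numZeros_sq_le_card_divisors {n : ℕ} {c : ℤ} {𝒞 : MvPolynomial (Fin n) ℤ} {k : ℕ}
    (hk : ∀ p : ℕ, p.Prime → numZeros c 𝒞 (p ^ 2) ≤ 2 ^ k * p ^ (2 * n)) (d : ℕ) :
    Squarefree d → numZeros c 𝒞 (d ^ 2) ≤ d.divisors.card ^ k * d ^ (2 * n) := by
  induction d using Nat.recOnPosPrimePosCoprime with
  | prime_pow p j hp hj =>
    intro hs
    obtain rfl : j = 1 := by
      rcases (Nat.squarefree_pow_iff hp.ne_one hj.ne').mp hs with ⟨_, h⟩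
      exact h
    have : (p ^ 1).divisors.card = 2 := by
      rw [Nat.divisors_prime_pow hp]; simp
    rw [this, pow_one]
    exact hk p hp
  | zero => intro h; exact absurd h not_squarefree_zero
  | one => intro _; simp [numZeros_one]
  | coprime a b ha hb hab iha ihb =>
    intro hs
    rw [mul_pow, numZeros_mul c 𝒞 (Nat.Coprime.pow 2 2 hab), hab.card_divisors_mul, mul_pow, mul_pow]
    calc _ ≤ _ := Nat.mul_le_mul (iha hs.of_mul_left) (ihb hs.of_mul_right)
      _ = _ := by ring

theorem exists_numZeros_sq_le_rpow {n : ℕ} {c : ℤ} (hc : c ≠ 0) {𝒞 : MvPolynomial (Fin n) ℤ}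
    (hhom : 𝒞.IsHomogeneous 3) (h0 : 𝒞 ≠ 0) {ε : ℝ} (hε : 0 < ε) :
    ∃ K : ℝ, 1 ≤ K ∧ ∀ d : ℕ, Squarefree d →
      (numZeros c 𝒞 (d ^ 2) : ℝ) ≤ K * (d : ℝ) ^ ε * (d : ℝ) ^ (2 * n) := by
  obtain ⟨k, hk⟩ := exists_numZeros_prime_sq_le hc hhom h0
  obtain ⟨K, hK1, hK⟩ := card_divisors_le_rpow (ε := ε / (k + 1)) (by positivity)
  refine ⟨K ^ (k + 1), one_le_pow₀ hK1, fun d hd => ?_⟩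
  have hd0 : d ≠ 0 := hd.ne_zero
  have hdp : (1 : ℝ) ≤ d := by exact_mod_cast Nat.one_le_iff_ne_zero.mpr hd0
  have h1 : (numZeros c 𝒞 (d ^ 2) : ℝ) ≤ (d.divisors.card : ℝ) ^ k * (d : ℝ) ^ (2 * n) := by
    exact_mod_cast numZeros_sq_le_card_divisors hk d hd
  refine h1.trans (mul_le_mul_of_nonneg_right ?_ (by positivity))
  have hc1 : (1 : ℝ) ≤ d.divisors.card := by
    exact_mod_cast Finset.card_pos.mpr ⟨1, Nat.one_mem_divisors.mpr hd0⟩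
  calc (d.divisors.card : ℝ) ^ k ≤ (d.divisors.card : ℝ) ^ (k + 1) :=
        pow_le_pow_right₀ hc1 (Nat.le_succ k)
    _ ≤ (K * (d : ℝ) ^ (ε / (k + 1))) ^ (k + 1) := pow_le_pow_left₀ (by positivity) (hK d hd0) _
    _ = K ^ (k + 1) * (d : ℝ) ^ ε := by
        rw [mul_pow, ← Real.rpow_natCast ((d : ℝ) ^ (ε / (k + 1))), ← Real.rpow_mul (by positivity)]
        congr 2
        push_cast
        field_simp

/-- The general term `μ(d) ρ(d²) / d^{2s}` of the singular series. -/
noncomputable def seriesTerm {n : ℕ} (c : ℤ) (𝒞 : MvPolynomial (Fin n) ℤ) (d : ℕ) : ℝ :=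
  (ArithmeticFunction.moebius d : ℝ) * (numZeros c 𝒞 (d ^ 2) / (d : ℝ) ^ (2 * (n + 1)))

theorem exists_abs_seriesTerm_le {n : ℕ} {c : ℤ} (hc : c ≠ 0) {𝒞 : MvPolynomial (Fin n) ℤ}
    (hhom : 𝒞.IsHomogeneous 3) (h0 : 𝒞 ≠ 0) {ε : ℝ} (hε : 0 < ε) :
    ∃ K : ℝ, 1 ≤ K ∧ ∀ d : ℕ, |seriesTerm c 𝒞 d| ≤ K * (d : ℝ) ^ (-2 + ε) := by
  obtain ⟨K, hK1, hK⟩ := exists_numZeros_sq_le_rpow hc hhom h0 hε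
  refine ⟨K, hK1, fun d => ?_⟩
  by_cases hd : Squarefree d
  · have hd0 : (0 : ℝ) < d := by exact_mod_cast Nat.pos_of_ne_zero hd.ne_zero
    have hμ : |(ArithmeticFunction.moebius d : ℝ)| ≤ 1 := by
      exact_mod_cast ArithmeticFunction.abs_moebius_le_one (n := d)
    rw [seriesTerm, abs_mul]
    refine (mul_le_of_le_one_left (abs_nonneg _) hμ).trans ?_
    rw [abs_of_nonneg (by positivity), div_le_iff₀ (by positivity)]
    refine (hK d hd).trans (le_of_eq ?_)
    rw [mul_assoc, mul_assoc]
    congr 1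
    rw [← Real.rpow_natCast, ← Real.rpow_natCast, ← Real.rpow_add hd0, ← Real.rpow_add hd0]
    congr 1
    push_cast
    ring
  · rw [seriesTerm, ArithmeticFunction.moebius_eq_zero_of_not_squarefree hd, Int.cast_zero, zero_mul,
      abs_zero]
    positivity

theorem summable_seriesTerm {n : ℕ} {c : ℤ} (hc : c ≠ 0) {𝒞 : MvPolynomial (Fin n) ℤ}
    (hhom : 𝒞.IsHomogeneous 3) (h0 : 𝒞 ≠ 0) : Summable fun d => ‖seriesTerm c 𝒞 d‖ := by
  obtain ⟨K, hK1, hK⟩ := exists_abs_seriesTerm_le hc hhom h0 (ε := 1 / 2) (by norm_num)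
  refine Summable.of_nonneg_of_le (fun _ => norm_nonneg _) hK (Summable.mul_left K ?_)
  exact Real.summable_nat_rpow.mpr (by norm_num)

theorem tprod_eq_tsum_seriesTerm {n : ℕ} {c : ℤ} (hc : c ≠ 0) {𝒞 : MvPolynomial (Fin n) ℤ}
    (hhom : 𝒞.IsHomogeneous 3) (h0 : 𝒞 ≠ 0) :
    ∏' p : Nat.Primes, (1 - (numZeros c 𝒞 ((p : ℕ) ^ 2) : ℝ) / ((p : ℕ) : ℝ) ^ (2 * (n + 1))) =
      ∑' d, seriesTerm c 𝒞 d := by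
  have h := EulerProduct.eulerProduct_hasProd (f := seriesTerm c 𝒞) ?_ ?_
    (summable_seriesTerm hc hhom h0) ?_
  · rw [← h.tprod_eq]
    refine tprod_congr fun p => ?_
    rw [tsum_eq_sum (s := Finset.range 2)]
    · rw [Finset.sum_range_succ, Finset.sum_range_one]
      simp [seriesTerm, numZeros_one, ArithmeticFunction.moebius_apply_prime p.2]
      ring
    · intro e he
      rw [Finset.mem_range, not_lt] at he
      rw [seriesTerm, ArithmeticFunction.moebius_apply_prime_pow p.2 (by omega), if_neg (by omega)]
      simp
  · simp [seriesTerm, numZeros_one]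
  · intro a b hab
    simp only [seriesTerm]
    rw [ArithmeticFunction.isMultiplicative_moebius.map_mul_of_coprime hab, mul_pow,
      numZeros_mul c 𝒞 (Nat.Coprime.pow 2 2 hab)]
    push_cast
    rw [mul_pow]
    ring
  · simp [seriesTerm]

/-- Truncating the singular series at `D`. -/
theorem exists_tsum_sub_sum_seriesTerm_le {n : ℕ} {c : ℤ} (hc : c ≠ 0) {𝒞 : MvPolynomial (Fin n) ℤ}
    (hhom : 𝒞.IsHomogeneous 3) (h0 : 𝒞 ≠ 0) {ε : ℝ} (hε : 0 < ε) :
    ∃ K : ℝ, 0 ≤ K ∧ ∀ D : ℕ, |∑' d, seriesTerm c 𝒞 d - ∑ d ∈ Finset.range (D + 1), seriesTerm c 𝒞 d| ≤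
      K * ((D : ℝ) + 1) ^ (-1 + ε) := by
  wlog hε1 : ε < 1 generalizing ε
  · obtain ⟨K, hK0, hK⟩ := this (ε := 1 / 2) (by norm_num) (by norm_num)
    refine ⟨K, hK0, fun D => (hK D).trans (mul_le_mul_of_nonneg_left ?_ hK0)⟩
    exact Real.rpow_le_rpow_of_exponent_le (by simp) (by linarith)
  obtain ⟨K, hK1, hK⟩ := exists_abs_seriesTerm_le hc hhom h0 (half_pos hε)
  have hs : Summable (seriesTerm c 𝒞) := (summable_seriesTerm hc hhom h0).of_norm
  have hb : Summable fun d : ℕ => (d : ℝ) ^ (-1 - ε / 2) := Real.summable_nat_rpow.mpr (by linarith)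
  refine ⟨K * ∑' d : ℕ, (d : ℝ) ^ (-1 - ε / 2), by positivity, fun D => ?_⟩
  have hD : (0 : ℝ) < (D : ℝ) + 1 := by positivity
  have hb' := (summable_nat_add_iff (D + 1)).mpr hb
  rw [← hs.sum_add_tsum_nat_add (D + 1), add_sub_cancel_left]
  have hterm : ∀ i : ℕ, ‖seriesTerm c 𝒞 (i + (D + 1))‖ ≤
      K * ((D : ℝ) + 1) ^ (-1 + ε) * ((i + (D + 1) : ℕ) : ℝ) ^ (-1 - ε / 2) := by
    intro i
    refine (hK _).trans ?_
    have hx : (0 : ℝ) < ((i + (D + 1) : ℕ) : ℝ) := by positivity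
    rw [mul_assoc, show (-2 + ε / 2 : ℝ) = (-1 + ε) + (-1 - ε / 2) by ring, Real.rpow_add hx]
    refine mul_le_mul_of_nonneg_left (mul_le_mul_of_nonneg_right ?_ (by positivity)) (by linarith)
    refine Real.rpow_le_rpow_of_nonpos hD ?_ (by linarith)
    push_cast
    linarith [(Nat.cast_nonneg i : (0 : ℝ) ≤ i)]
  have := tsum_of_norm_bounded (hb'.mul_left _).hasSum hterm
  rw [Real.norm_eq_abs, tsum_mul_left] at this
  refine this.trans ?_
  have h2 : ∑' i : ℕ, ((i + (D + 1) : ℕ) : ℝ) ^ (-1 - ε / 2) ≤ ∑' d : ℕ, (d : ℝ) ^ (-1 - ε / 2) := by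
    rw [← hb.sum_add_tsum_nat_add (D + 1)]
    exact le_add_of_nonneg_left (Finset.sum_nonneg fun _ _ => by positivity)
  calc _ ≤ K * ((D : ℝ) + 1) ^ (-1 + ε) * ∑' d : ℕ, (d : ℝ) ^ (-1 - ε / 2) :=
        mul_le_mul_of_nonneg_left h2 (by positivity)
    _ = _ := by ring

theorem abs_card_residue_sub_le {q : ℕ} (hq : 0 < q) (Q : ℕ) (a : ZMod q) :
    |((((Finset.Icc (-(Q : ℤ)) Q).filter fun x : ℤ => (x : ZMod q) = a).card : ℕ) : ℝ) -
      (2 * Q + 1) / q| ≤ 1 := by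
  have : NeZero q := ⟨hq.ne'⟩
  have e : ((Finset.Icc (-(Q : ℤ)) Q).filter fun x : ℤ => (x : ZMod q) = a) =
      (Finset.Ioc (-(Q : ℤ) - 1) Q).filter fun x => x ≡ (a.val : ℤ) [ZMOD (q : ℤ)] := by
    ext x
    simp only [Finset.mem_filter, Finset.mem_Icc, Finset.mem_Ioc, ← ZMod.intCast_eq_intCast_iff,
      Int.cast_natCast, ZMod.natCast_zmod_val]
    constructor <;> rintro ⟨h1, h2⟩ <;> exact ⟨by omega, h2⟩
  have hq' : (0 : ℝ) < q := by exact_mod_cast hq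
  have h := Int.Ioc_filter_modEq_card (-(Q : ℤ) - 1) Q (r := q) (by exact_mod_cast hq) (a.val : ℤ)
  rw [← e] at h
  set N := ((Finset.Icc (-(Q : ℤ)) Q).filter fun x : ℤ => (x : ZMod q) = a).card
  have hQ : (0 : ℚ) ≤ Q := Nat.cast_nonneg Q
  have hqq : (0 : ℚ) < q := by exact_mod_cast hq
  have hmono : ⌊(((-(Q : ℤ) - 1 : ℤ) : ℚ) - ((a.val : ℤ) : ℚ)) / ((q : ℤ) : ℚ)⌋ ≤
      ⌊(((Q : ℤ) : ℚ) - ((a.val : ℤ) : ℚ)) / ((q : ℤ) : ℚ)⌋ := by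
    refine Int.floor_le_floor ?_
    push_cast
    exact div_le_div_of_nonneg_right (by linarith) hqq.le
  rw [max_eq_left (by linarith)] at h
  have u1 := Int.floor_le ((((Q : ℤ) : ℚ) - ((a.val : ℤ) : ℚ)) / ((q : ℤ) : ℚ))
  have u2 := Int.lt_floor_add_one ((((Q : ℤ) : ℚ) - ((a.val : ℤ) : ℚ)) / ((q : ℤ) : ℚ))
  have v1 := Int.floor_le ((((-(Q : ℤ) - 1 : ℤ) : ℚ) - ((a.val : ℤ) : ℚ)) / ((q : ℤ) : ℚ))
  have v2 := Int.lt_floor_add_one ((((-(Q : ℤ) - 1 : ℤ) : ℚ) - ((a.val : ℤ) : ℚ)) / ((q : ℤ) : ℚ))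
  have h' : (N : ℚ) = ⌊(((Q : ℤ) : ℚ) - ((a.val : ℤ) : ℚ)) / ((q : ℤ) : ℚ)⌋ -
      ⌊(((-(Q : ℤ) - 1 : ℤ) : ℚ) - ((a.val : ℤ) : ℚ)) / ((q : ℤ) : ℚ)⌋ := by exact_mod_cast h
  have e2 : (((Q : ℤ) : ℚ) - ((a.val : ℤ) : ℚ)) / ((q : ℤ) : ℚ) -
      (((-(Q : ℤ) - 1 : ℤ) : ℚ) - ((a.val : ℤ) : ℚ)) / ((q : ℤ) : ℚ) = (2 * Q + 1) / q := by
    push_cast; ring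
  have key : |(N : ℚ) - (2 * Q + 1) / q| ≤ 1 := by
    rw [abs_le]; constructor <;> linarith
  have key' : (((|(N : ℚ) - (2 * Q + 1) / q| : ℚ)) : ℝ) ≤ ((1 : ℚ) : ℝ) := Rat.cast_le.mpr key
  push_cast at key'
  exact key'

theorem abs_prod_sub_pow_mul_le {t : ℝ} (ht : 0 ≤ t) : ∀ (n : ℕ) (x : Fin n → ℝ), (∀ i, 0 ≤ x i) →
    (∀ i, |x i - t| ≤ 1) → |∏ i, x i - t ^ n| * (t + 1) ≤ n * (t + 1) ^ n := by
  intro n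
  induction n with
  | zero => intro x _ _; simp
  | succ n ih =>
    intro x h0 h1
    have h2 := ih (fun i => x i.succ) (fun i => h0 _) (fun i => h1 _)
    rw [Fin.prod_univ_succ]
    set y := ∏ i : Fin n, x i.succ
    have hy : |y| ≤ (t + 1) ^ n := by
      rw [Finset.abs_prod]
      refine (Finset.prod_le_prod (fun _ _ => abs_nonneg _) fun i _ =>
        (?_ : |x (Fin.succ i)| ≤ t + 1)).trans (by simp)
      have := h1 i.succ
      rw [abs_of_nonneg (h0 _)]
      linarith [(abs_le.mp this).2]
    have e : x 0 * y - t ^ (n + 1) = (x 0 - t) * y + t * (y - t ^ n) := by ring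
    have h3 : |x 0 * y - t ^ (n + 1)| ≤ (t + 1) ^ n + t * |y - t ^ n| := by
      rw [e]
      refine (abs_add_le _ _).trans (add_le_add ?_ ?_)
      · rw [abs_mul]
        calc _ ≤ 1 * (t + 1) ^ n := mul_le_mul (h1 0) hy (abs_nonneg _) zero_le_one
          _ = _ := one_mul _
      · rw [abs_mul, abs_of_nonneg ht]
    calc |x 0 * y - t ^ (n + 1)| * (t + 1) ≤ ((t + 1) ^ n + t * |y - t ^ n|) * (t + 1) :=
          mul_le_mul_of_nonneg_right h3 (by linarith)
      _ = (t + 1) ^ (n + 1) + t * (|y - t ^ n| * (t + 1)) := by ring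
      _ ≤ (t + 1) ^ (n + 1) + (t + 1) * (n * (t + 1) ^ n) := by
          refine add_le_add_right ?_ _
          exact mul_le_mul (by linarith) h2 (by positivity) (by linarith)
      _ = _ := by push_cast; ring

theorem abs_mul_prod_sub_pow_le {t : ℝ} (ht : 0 ≤ t) {n : ℕ} {x₀ : ℝ} {x : Fin n → ℝ} (h₀ : 0 ≤ x₀)
    (h : ∀ i, 0 ≤ x i) (h₀' : |x₀ - t| ≤ 1) (h' : ∀ i, |x i - t| ≤ 1) :
    |x₀ * ∏ i, x i - t ^ (n + 1)| ≤ (n + 1) * (t + 1) ^ n := by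
  have := abs_prod_sub_pow_mul_le ht (n + 1) (Fin.cons x₀ x : Fin (n + 1) → ℝ)
    (Fin.cases (by simpa) (by simpa)) (Fin.cases (by simpa) (by simpa))
  rw [Fin.prod_univ_succ] at this
  simp only [Fin.cons_zero, Fin.cons_succ] at this
  refine le_of_mul_le_mul_right ?_ (show 0 < t + 1 by linarith)
  refine this.trans (le_of_eq ?_)
  push_cast
  ring

/-- The number of points of the box at which `c x³ + 𝒞(y)` is divisible by `q`. -/
noncomputable def boxDvdCount {n : ℕ} (c : ℤ) (𝒞 : MvPolynomial (Fin n) ℤ) (Q q : ℕ) : ℕ :=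
  ((Finset.Icc (-(Q : ℤ)) Q ×ˢ cubeBox n Q).filter fun z => (q : ℤ) ∣ c * z.1 ^ 3 + eval z.2 𝒞).card

theorem abs_boxDvdCount_sub_le {n : ℕ} (c : ℤ) (𝒞 : MvPolynomial (Fin n) ℤ) (Q : ℕ) {q : ℕ}
    (hq : 0 < q) : |(boxDvdCount c 𝒞 Q q : ℝ) - numZeros c 𝒞 q * ((2 * Q + 1) / q) ^ (n + 1)| ≤
      numZeros c 𝒞 q * ((n + 1) * ((2 * Q + 1) / q + 1) ^ n) := by
  classical
  have : NeZero q := ⟨hq.ne'⟩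
  set I := Finset.Icc (-(Q : ℤ)) Q with hI
  set Z := (Finset.univ : Finset (ZMod q × (Fin n → ZMod q))).filter
    fun y => (c : ZMod q) * y.1 ^ 3 + aeval y.2 𝒞 = 0 with hZ
  have hZc : numZeros c 𝒞 q = Z.card := by
    rw [numZeros, Nat.card_eq_fintype_card, Fintype.card_subtype]
  have hdvd : ∀ z : ℤ × (Fin n → ℤ), (q : ℤ) ∣ c * z.1 ^ 3 + eval z.2 𝒞 ↔
      (c : ZMod q) * (z.1 : ZMod q) ^ 3 + aeval (fun i => (z.2 i : ZMod q)) 𝒞 = 0 := by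
    intro z
    rw [← ZMod.intCast_zmod_eq_zero_iff_dvd]
    have := map_cube_add_aeval c 𝒞 (Int.castRingHom (ZMod q)) z.1 z.2
    simp only [aeval_eq_eval, eq_intCast, Int.cast_id] at this
    rw [← this]
  have hcount : boxDvdCount c 𝒞 Q q = ∑ y ∈ Z, (I.filter fun x : ℤ => (x : ZMod q) = y.1).card *
      ∏ i, (I.filter fun x : ℤ => (x : ZMod q) = y.2 i).card := by
    rw [boxDvdCount, Finset.card_eq_sum_card_fiberwise
      (f := fun z : ℤ × (Fin n → ℤ) => ((z.1 : ZMod q), fun i => (z.2 i : ZMod q))) (t := Z)]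
    · refine Finset.sum_congr rfl fun y hy => ?_
      rw [← Fintype.card_piFinset, ← Finset.card_product]
      refine congrArg Finset.card (Finset.ext fun z => ?_)
      rw [hZ, Finset.mem_filter] at hy
      simp only [Finset.mem_filter, Finset.mem_product, cubeBox, Fintype.mem_piFinset, ← hI, hdvd]
      constructor
      · rintro ⟨⟨⟨h1, h2⟩, h3⟩, rfl⟩
        exact ⟨⟨h1, rfl⟩, fun i => ⟨h2 i, rfl⟩⟩
      · rintro ⟨⟨h1, h2⟩, h3⟩
        have h4 : (fun i => (z.2 i : ZMod q)) = y.2 := funext fun i => (h3 i).2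
        refine ⟨⟨⟨h1, fun i => (h3 i).1⟩, ?_⟩, Prod.ext h2 h4⟩
        rw [h2, h4]; exact hy.2
    · intro z hz
      simp only [Finset.coe_filter, Set.mem_ofPred_eq, hdvd] at hz
      simp only [hZ, Finset.coe_filter, Set.mem_ofPred_eq, Finset.mem_univ, true_and]
      exact hz.2
  rw [hcount, hZc]
  push_cast
  rw [← nsmul_eq_mul, ← Finset.sum_const, ← Finset.sum_sub_distrib, ← nsmul_eq_mul,
    ← Finset.sum_const]
  refine (Finset.abs_sum_le_sum_abs _ _).trans (Finset.sum_le_sum fun y _ => ?_)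
  exact abs_mul_prod_sub_pow_le (by positivity) (Nat.cast_nonneg _) (fun i => Nat.cast_nonneg _)
    (abs_card_residue_sub_le hq Q _) (fun i => abs_card_residue_sub_le hq Q _)

theorem Nat.sq_dvd_sq_mul_squarefree_iff {a b d : ℕ} (ha : Squarefree a) (hb : b ≠ 0) :
    d ^ 2 ∣ b ^ 2 * a ↔ d ∣ b := by
  refine ⟨fun h => ?_, fun h => (pow_dvd_pow_of_dvd h 2).mul_right a⟩
  obtain ⟨g, d', b', hg, hcop, rfl, rfl⟩ := Nat.exists_coprime' (m := d) (n := b)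
    (Nat.gcd_pos_of_pos_right _ (Nat.pos_of_ne_zero hb))
  rw [mul_pow, mul_pow, mul_right_comm] at h
  have h1 : d' ^ 2 ∣ b' ^ 2 * a := Nat.dvd_of_mul_dvd_mul_right (by positivity) h
  have h2 : d' ^ 2 ∣ a := (Nat.Coprime.pow 2 2 hcop).dvd_of_dvd_mul_left h1
  have h3 : d' = 1 := Nat.isUnit_iff.mp (ha d' (by rwa [← sq]))
  rw [h3, one_mul]
  exact dvd_mul_left _ _

/-- The Möbius sum over square divisors detects squarefree integers; truncating it at `D` costs at
most the number of divisors, and nothing if there is no large square divisor. -/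
theorem abs_indicator_squarefree_sub_le {N : ℤ} (hN : N ≠ 0) (D : ℕ) [Decidable (Squarefree N)]
    [Decidable (∃ d : ℕ, D < d ∧ (d : ℤ) ^ 2 ∣ N)] :
    |(if Squarefree N then (1 : ℝ) else 0) - ∑ d ∈ Finset.range (D + 1),
      if (d : ℤ) ^ 2 ∣ N then (ArithmeticFunction.moebius d : ℝ) else 0| ≤
      if ∃ d : ℕ, D < d ∧ (d : ℤ) ^ 2 ∣ N then (N.natAbs.divisors.card : ℝ) else 0 := by
  classical
  obtain ⟨a, b, hab, ha⟩ := Nat.sq_mul_squarefree N.natAbs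
  have hb : b ≠ 0 := by
    rintro rfl
    apply hN
    rw [← Int.natAbs_eq_zero, ← hab]
    simp
  have hdvd : ∀ d : ℕ, (d : ℤ) ^ 2 ∣ N ↔ d ∣ b := by
    intro d
    rw [← Nat.sq_dvd_sq_mul_squarefree_iff ha hb, hab, ← Int.natCast_dvd]
    push_cast
    rfl
  have hsq : Squarefree N ↔ b = 1 := by
    rw [← Int.squarefree_natAbs, ← hab]
    constructor
    · intro h
      exact Nat.isUnit_iff.mp (h b (by rw [← sq]; exact dvd_mul_right _ _))
    · rintro rfl
      simpa using ha
  have hfull : ∑ d ∈ b.divisors, (ArithmeticFunction.moebius d : ℝ) = if Squarefree N then 1 else 0 := by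
    have h := congrArg (fun f : ArithmeticFunction ℤ => f b) ArithmeticFunction.coe_zeta_mul_moebius
    simp only [ArithmeticFunction.coe_zeta_mul_apply, ArithmeticFunction.one_apply] at h
    rw [← Int.cast_sum, h]
    simp only [hsq]
    split_ifs <;> simp
  have htrunc : (∑ d ∈ Finset.range (D + 1),
      if (d : ℤ) ^ 2 ∣ N then (ArithmeticFunction.moebius d : ℝ) else 0) =
      ∑ d ∈ b.divisors with ¬ D < d, (ArithmeticFunction.moebius d : ℝ) := by
    rw [← Finset.sum_filter]
    refine Finset.sum_congr (Finset.ext fun d => ?_) fun _ _ => rfl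
    simp only [Finset.mem_filter, Finset.mem_range, hdvd, Nat.mem_divisors, not_lt, Nat.lt_succ_iff]
    tauto
  rw [← hfull, htrunc, ← Finset.sum_filter_add_sum_filter_not b.divisors (fun d => D < d),
    add_sub_cancel_right]
  split_ifs with h
  · calc |∑ d ∈ b.divisors with D < d, (ArithmeticFunction.moebius d : ℝ)|
        ≤ ∑ d ∈ b.divisors with D < d, |(ArithmeticFunction.moebius d : ℝ)| :=
          Finset.abs_sum_le_sum_abs _ _
      _ ≤ ∑ d ∈ b.divisors with D < d, 1 := Finset.sum_le_sum fun d _ => by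
          exact_mod_cast ArithmeticFunction.abs_moebius_le_one (n := d)
      _ = ((b.divisors.filter fun d => D < d).card : ℝ) := by simp
      _ ≤ (N.natAbs.divisors.card : ℝ) := by
          refine Nat.cast_le.mpr (Finset.card_le_card ((Finset.filter_subset _ _).trans ?_))
          refine Nat.divisors_subset_of_dvd (Int.natAbs_ne_zero.mpr hN) ?_
          rw [← hab, sq, mul_assoc]
          exact dvd_mul_right _ _
  · rw [Finset.filter_eq_empty_iff.mpr, Finset.sum_empty, abs_zero]
    intro d hd hD
    exact h ⟨d, hD, (hdvd d).mpr (Nat.dvd_of_mem_divisors hd)⟩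

/-- Integers with a large square divisor are sparse. -/
theorem card_large_square_divisor_le (B D : ℕ)
    [DecidablePred fun N : ℤ => N ≠ 0 ∧ ∃ d : ℕ, D < d ∧ (d : ℤ) ^ 2 ∣ N] :
    ((((Finset.Icc (-(B : ℤ)) B).filter
      fun N => N ≠ 0 ∧ ∃ d : ℕ, D < d ∧ (d : ℤ) ^ 2 ∣ N).card : ℕ) : ℝ) ≤ 4 * B / ((D : ℝ) + 1) := by
  classical
  set A : ℕ → Finset ℤ := fun d => ((Finset.Icc (-((B / d ^ 2 : ℕ) : ℤ)) ((B / d ^ 2 : ℕ) : ℤ)).erase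
    0).image fun m => (d : ℤ) ^ 2 * m with hA
  have hAc : ∀ d, (A d).card ≤ 2 * (B / d ^ 2) := by
    intro d
    refine Finset.card_image_le.trans ?_
    rw [Finset.card_erase_of_mem (by simp; positivity), Int.card_Icc]
    omega
  have hsub : ((Finset.Icc (-(B : ℤ)) B).filter
      fun N => N ≠ 0 ∧ ∃ d : ℕ, D < d ∧ (d : ℤ) ^ 2 ∣ N) ⊆ (Finset.Ioo D (B + 1)).biUnion A := by
    intro N hN
    rw [Finset.mem_filter, Finset.mem_Icc] at hN
    obtain ⟨⟨h1, h2⟩, h0, d, hd, m, rfl⟩ := hN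
    have hm : m ≠ 0 := right_ne_zero_of_mul h0
    have hd0 : 0 < d ^ 2 := by have : 0 < d := by omega
                               positivity
    have habs : d ^ 2 * m.natAbs ≤ B := by
      have h3 : ((d : ℤ) ^ 2 * m).natAbs = d ^ 2 * m.natAbs := by
        rw [Int.natAbs_mul, Int.natAbs_pow, Int.natAbs_natCast]
      omega
    have hm1 : 1 ≤ m.natAbs := Nat.one_le_iff_ne_zero.mpr (Int.natAbs_ne_zero.mpr hm)
    have hmB : m.natAbs ≤ B / d ^ 2 := by
      rw [Nat.le_div_iff_mul_le hd0, mul_comm]; exact habs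
    have hdB : d ≤ B := by nlinarith
    rw [Finset.mem_biUnion]
    refine ⟨d, Finset.mem_Ioo.mpr ⟨hd, by omega⟩, ?_⟩
    simp only [hA, Finset.mem_image, Finset.mem_erase, Finset.mem_Icc]
    exact ⟨m, ⟨hm, by omega, by omega⟩, rfl⟩
  calc ((((Finset.Icc (-(B : ℤ)) B).filter
      fun N => N ≠ 0 ∧ ∃ d : ℕ, D < d ∧ (d : ℤ) ^ 2 ∣ N).card : ℕ) : ℝ)
      ≤ ((∑ d ∈ Finset.Ioo D (B + 1), (A d).card : ℕ) : ℝ) :=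
        Nat.cast_le.mpr ((Finset.card_le_card hsub).trans Finset.card_biUnion_le)
    _ ≤ ∑ d ∈ Finset.Ioo D (B + 1), 2 * (B : ℝ) * ((d : ℝ) ^ 2)⁻¹ := by
        push_cast
        refine Finset.sum_le_sum fun d _ => ?_
        calc ((A d).card : ℝ) ≤ 2 * ((B / d ^ 2 : ℕ) : ℝ) := by exact_mod_cast hAc d
          _ ≤ 2 * ((B : ℝ) / ((d ^ 2 : ℕ) : ℝ)) :=
              mul_le_mul_of_nonneg_left Nat.cast_div_le zero_le_two
          _ = _ := by push_cast; ring
    _ ≤ 2 * B * (2 / ((D : ℝ) + 1)) := by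
        rw [← Finset.mul_sum]
        exact mul_le_mul_of_nonneg_left (sum_Ioo_inv_sq_le D (B + 1)) (by positivity)
    _ = _ := by ring

theorem exists_abs_cube_add_eval_le {n : ℕ} (c : ℤ) {𝒞 : MvPolynomial (Fin n) ℤ}
    (hhom : 𝒞.IsHomogeneous 3) : ∃ M : ℕ, 1 ≤ M ∧ ∀ (Q : ℕ),
      ∀ z ∈ Finset.Icc (-(Q : ℤ)) Q ×ˢ cubeBox n Q, |c * z.1 ^ 3 + eval z.2 𝒞| ≤ M * (Q : ℤ) ^ 3 := by
  obtain ⟨t, ht⟩ := exists_triForm hhom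
  obtain ⟨τ, hτ⟩ := exists_abs_triForm_le t
  refine ⟨c.natAbs + τ + 1, by omega, fun Q z hz => ?_⟩
  rw [Finset.mem_product, mem_cubeBox, Finset.mem_Icc, ← abs_le] at hz
  have hQ : (0 : ℤ) ≤ Q := by positivity
  have h1 := hτ z.2 z.2 z.2 Q Q Q hz.2 hz.2 hz.2 hQ hQ hQ
  have h2 : |c * z.1 ^ 3| ≤ c.natAbs * (Q : ℤ) ^ 3 := by
    rw [abs_mul, abs_pow, Int.abs_eq_natAbs c]
    exact mul_le_mul_of_nonneg_left (pow_le_pow_left₀ (abs_nonneg _) hz.1 3) (by positivity)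
  rw [ht]
  refine (abs_add_le _ _).trans ?_
  have h3 : (0 : ℤ) ≤ (Q : ℤ) ^ 3 := by positivity
  push_cast at h2 ⊢
  nlinarith

theorem card_zeros_box_le {n : ℕ} {c : ℤ} (hc : c ≠ 0) (𝒞 : MvPolynomial (Fin n) ℤ) (Q : ℕ) :
    ((Finset.Icc (-(Q : ℤ)) Q ×ˢ cubeBox n Q).filter fun z => c * z.1 ^ 3 + eval z.2 𝒞 = 0).card ≤
      3 * (2 * Q + 1) ^ n := by
  rw [Finset.card_eq_sum_card_fiberwise (f := Prod.snd) (t := cubeBox n Q)]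
  · have h : ∀ w ∈ cubeBox n Q, (((Finset.Icc (-(Q : ℤ)) Q ×ˢ cubeBox n Q).filter
        fun z => c * z.1 ^ 3 + eval z.2 𝒞 = 0).filter fun z => z.2 = w).card ≤ 3 := by
      intro w _
      set p : Polynomial ℤ := Polynomial.C c * Polynomial.X ^ 3 + Polynomial.C (eval w 𝒞) with hp
      have hp0 : p ≠ 0 := fun h => hc <| by
        have : p.coeff 3 = c := by rw [hp]; compute_degree!
        rw [← this, h, Polynomial.coeff_zero]
      refine le_trans (Finset.card_le_card_of_injOn Prod.fst
        (t := (Finset.Icc (-(Q : ℤ)) Q).filter fun x => c * x ^ 3 + eval w 𝒞 = 0) ?_ ?_)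
        (card_roots_filter_le hp0 (d := 3) (by rw [hp]; compute_degree) _ _ fun x hx => ?_)
      · intro z hz
        simp only [Finset.coe_filter, Set.mem_ofPred_eq, Finset.mem_filter, Finset.mem_product] at hz ⊢
        obtain ⟨⟨⟨h1, _⟩, h2⟩, rfl⟩ := hz
        exact ⟨h1, h2⟩
      · intro z hz z' hz' h
        simp only [Finset.coe_filter, Set.mem_ofPred_eq] at hz hz'
        exact Prod.ext h (hz.2.trans hz'.2.symm)
      · simpa [hp] using hx
    refine (Finset.sum_le_sum h).trans ?_
    rw [Finset.sum_const, card_cubeBox, smul_eq_mul, mul_comm]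
  · intro z hz
    simp only [Finset.coe_filter, Set.mem_ofPred_eq, Finset.mem_product] at hz
    exact hz.1.2

theorem card_large_square_box_le {n : ℕ} {c : ℤ} (hc : c ≠ 0) {𝒞 : MvPolynomial (Fin n) ℤ}
    (hhom : 𝒞.IsHomogeneous 3)
    (hdeg : ¬ ∃ (a : ℚ) (b : Fin n → ℚ), MvPolynomial.map (Int.castRingHom ℚ) 𝒞 =
      MvPolynomial.C a * (∑ i, MvPolynomial.C (b i) * MvPolynomial.X i) ^ 3)
    {ε : ℝ} (hε : 0 < ε) :
    ∃ K : ℝ, 0 ≤ K ∧ ∀ Q D : ℕ, 1 ≤ Q →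
      ∀ [DecidablePred fun z : ℤ × (Fin n → ℤ) => c * z.1 ^ 3 + eval z.2 𝒞 ≠ 0 ∧
        ∃ d : ℕ, D < d ∧ (d : ℤ) ^ 2 ∣ c * z.1 ^ 3 + eval z.2 𝒞],
      ((((Finset.Icc (-(Q : ℤ)) Q ×ˢ cubeBox n Q).filter fun z => c * z.1 ^ 3 + eval z.2 𝒞 ≠ 0 ∧
        ∃ d : ℕ, D < d ∧ (d : ℤ) ^ 2 ∣ c * z.1 ^ 3 + eval z.2 𝒞).card : ℕ) : ℝ) ^ 4 *
        ((D : ℝ) + 1) ^ 2 ≤ K * (Q : ℝ) ^ (4 * (n : ℝ) + 5 + ε) := by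
  classical
  obtain ⟨M, hM1, hM⟩ := exists_abs_cube_add_eval_le c hhom
  obtain ⟨K, hK0, hK⟩ := card_cube_add_eval_mem_le hc hhom hdeg hε
  refine ⟨K * (4 * M) ^ 2, by positivity, fun Q D hQ _ => ?_⟩
  have hQ0 : (0 : ℝ) < Q := by exact_mod_cast hQ
  have hD : (0 : ℝ) < (D : ℝ) + 1 := by positivity
  set T := (Finset.Icc (-((M * Q ^ 3 : ℕ) : ℤ)) ((M * Q ^ 3 : ℕ) : ℤ)).filter
      fun N => N ≠ 0 ∧ ∃ d : ℕ, D < d ∧ (d : ℤ) ^ 2 ∣ N with hT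
  have hTc : (T.card : ℝ) * ((D : ℝ) + 1) ≤ 4 * M * (Q : ℝ) ^ 3 := by
    have := card_large_square_divisor_le (M * Q ^ 3) D
    rw [le_div_iff₀ hD] at this
    refine this.trans (le_of_eq ?_)
    push_cast
    ring
  have h1 := hK Q T hQ
  have hsub : (Finset.Icc (-(Q : ℤ)) Q ×ˢ cubeBox n Q).filter (fun z => c * z.1 ^ 3 + eval z.2 𝒞 ≠ 0 ∧
      ∃ d : ℕ, D < d ∧ (d : ℤ) ^ 2 ∣ c * z.1 ^ 3 + eval z.2 𝒞) ⊆
      (Finset.Icc (-(Q : ℤ)) Q ×ˢ cubeBox n Q).filter fun z => c * z.1 ^ 3 + eval z.2 𝒞 ∈ T := by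
    intro z hz
    rw [Finset.mem_filter] at hz ⊢
    refine ⟨hz.1, ?_⟩
    rw [hT, Finset.mem_filter, Finset.mem_Icc, ← abs_le]
    refine ⟨?_, hz.2⟩
    push_cast
    exact hM Q z hz.1
  have h2 : ((((Finset.Icc (-(Q : ℤ)) Q ×ˢ cubeBox n Q).filter
      fun z => c * z.1 ^ 3 + eval z.2 𝒞 ≠ 0 ∧
      ∃ d : ℕ, D < d ∧ (d : ℤ) ^ 2 ∣ c * z.1 ^ 3 + eval z.2 𝒞).card : ℕ) : ℝ) ^ 4 ≤
      K * (T.card : ℝ) ^ 2 * (Q : ℝ) ^ (4 * (n : ℝ) - 1 + ε) :=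
    (pow_le_pow_left₀ (by positivity) (Nat.cast_le.mpr (Finset.card_le_card hsub)) 4).trans h1
  calc _ ≤ K * (T.card : ℝ) ^ 2 * (Q : ℝ) ^ (4 * (n : ℝ) - 1 + ε) * ((D : ℝ) + 1) ^ 2 :=
        mul_le_mul_of_nonneg_right h2 (by positivity)
    _ = K * (T.card * ((D : ℝ) + 1)) ^ 2 * (Q : ℝ) ^ (4 * (n : ℝ) - 1 + ε) := by ring
    _ ≤ K * (4 * M * (Q : ℝ) ^ 3) ^ 2 * (Q : ℝ) ^ (4 * (n : ℝ) - 1 + ε) := by gcongr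
    _ = K * (4 * M) ^ 2 * ((Q : ℝ) ^ 6 * (Q : ℝ) ^ (4 * (n : ℝ) - 1 + ε)) := by ring
    _ = _ := by
        rw [← Real.rpow_natCast (Q : ℝ) 6, ← Real.rpow_add hQ0]
        congr 2
        push_cast
        ring

/-- The main term: the contribution of moduli up to `D`. -/
theorem exists_abs_sum_boxDvdCount_sub_le {n : ℕ} {c : ℤ} (hc : c ≠ 0) {𝒞 : MvPolynomial (Fin n) ℤ}
    (hhom : 𝒞.IsHomogeneous 3) (h0 : 𝒞 ≠ 0) {ε : ℝ} (hε : 0 < ε) :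
    ∃ K : ℝ, 0 ≤ K ∧ ∀ Q D : ℕ, 1 ≤ Q →
      |∑ d ∈ Finset.range (D + 1), (ArithmeticFunction.moebius d : ℝ) * boxDvdCount c 𝒞 Q (d ^ 2) -
        (2 * Q + 1 : ℝ) ^ (n + 1) * ∑ d ∈ Finset.range (D + 1), seriesTerm c 𝒞 d| ≤
      K * (((D : ℝ) + 1) ^ (1 + ε) * (Q : ℝ) ^ n + ((D : ℝ) + 1) ^ (2 * (n : ℝ) + 1 + ε)) := by
  obtain ⟨K, hK1, hK⟩ := exists_numZeros_sq_le_rpow hc hhom h0 hε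
  refine ⟨K * ((n + 1) * 2 ^ n * 3 ^ n), by positivity, fun Q D hQ => ?_⟩
  have hQ1 : (1 : ℝ) ≤ Q := by exact_mod_cast hQ
  have hD : (0 : ℝ) < (D : ℝ) + 1 := by positivity
  rw [Finset.mul_sum, ← Finset.sum_sub_distrib]
  have hterm : ∀ d ∈ Finset.range (D + 1), |(ArithmeticFunction.moebius d : ℝ) *
      boxDvdCount c 𝒞 Q (d ^ 2) - (2 * Q + 1 : ℝ) ^ (n + 1) * seriesTerm c 𝒞 d| ≤
      K * ((n + 1) * 2 ^ n * 3 ^ n) * (((D : ℝ) + 1) ^ ε * ((Q : ℝ) ^ n + ((D : ℝ) + 1) ^ (2 * n))) := by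
    intro d hd
    by_cases hs : Squarefree d
    · have hd0 : 0 < d := Nat.pos_of_ne_zero hs.ne_zero
      have hd0' : (0 : ℝ) < d := by exact_mod_cast hd0
      have hdD : (d : ℝ) ≤ D + 1 := by
        have := Finset.mem_range.mp hd
        exact_mod_cast this.le
      have hμ : |(ArithmeticFunction.moebius d : ℝ)| ≤ 1 := by
        exact_mod_cast ArithmeticFunction.abs_moebius_le_one (n := d)
      have h1 := abs_boxDvdCount_sub_le c 𝒞 Q (q := d ^ 2) (by positivity)
      have e : (ArithmeticFunction.moebius d : ℝ) * boxDvdCount c 𝒞 Q (d ^ 2) -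
          (2 * Q + 1 : ℝ) ^ (n + 1) * seriesTerm c 𝒞 d = (ArithmeticFunction.moebius d : ℝ) *
          ((boxDvdCount c 𝒞 Q (d ^ 2) : ℝ) - numZeros c 𝒞 (d ^ 2) *
            ((2 * Q + 1) / ((d ^ 2 : ℕ) : ℝ)) ^ (n + 1)) := by
        rw [seriesTerm, div_pow]
        push_cast
        rw [← pow_mul]
        ring
      rw [e, abs_mul]
      refine (mul_le_of_le_one_left (abs_nonneg _) hμ).trans (h1.trans ?_)
      have h2 : ((2 * (Q : ℝ) + 1) / ((d ^ 2 : ℕ) : ℝ) + 1) ^ n * (d : ℝ) ^ (2 * n) ≤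
          2 ^ n * 3 ^ n * ((Q : ℝ) ^ n + ((D : ℝ) + 1) ^ (2 * n)) := by
        have e2 : ((2 * (Q : ℝ) + 1) / ((d ^ 2 : ℕ) : ℝ) + 1) ^ n * (d : ℝ) ^ (2 * n) =
            (2 * Q + 1 + (d : ℝ) ^ 2) ^ n := by
          rw [pow_mul, ← mul_pow]
          congr 1
          push_cast
          field_simp
        rw [e2]
        calc (2 * (Q : ℝ) + 1 + (d : ℝ) ^ 2) ^ n ≤ (3 * (Q + ((D : ℝ) + 1) ^ 2)) ^ n := by
              refine pow_le_pow_left₀ (by positivity) ?_ n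
              have := pow_le_pow_left₀ hd0'.le hdD 2
              nlinarith
          _ ≤ 3 ^ n * (2 ^ (n - 1) * ((Q : ℝ) ^ n + (((D : ℝ) + 1) ^ 2) ^ n)) := by
              rw [mul_pow]
              exact mul_le_mul_of_nonneg_left (add_pow_le (by positivity) (by positivity) n)
                (by positivity)
          _ ≤ 3 ^ n * (2 ^ n * ((Q : ℝ) ^ n + (((D : ℝ) + 1) ^ 2) ^ n)) := by
              gcongr
              · norm_num
              · omega
          _ = _ := by rw [← pow_mul]; ring
      calc (numZeros c 𝒞 (d ^ 2) : ℝ) * (((n : ℝ) + 1) * ((2 * Q + 1) / ((d ^ 2 : ℕ) : ℝ) + 1) ^ n)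
          ≤ K * (d : ℝ) ^ ε * (d : ℝ) ^ (2 * n) *
            (((n : ℝ) + 1) * ((2 * Q + 1) / ((d ^ 2 : ℕ) : ℝ) + 1) ^ n) :=
            mul_le_mul_of_nonneg_right (hK d hs) (by positivity)
        _ = K * (n + 1) * (d : ℝ) ^ ε *
            (((2 * Q + 1) / ((d ^ 2 : ℕ) : ℝ) + 1) ^ n * (d : ℝ) ^ (2 * n)) := by ring
        _ ≤ K * (n + 1) * ((D : ℝ) + 1) ^ ε *
            (2 ^ n * 3 ^ n * ((Q : ℝ) ^ n + ((D : ℝ) + 1) ^ (2 * n))) := by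
            gcongr
        _ = _ := by ring
    · rw [seriesTerm, ArithmeticFunction.moebius_eq_zero_of_not_squarefree hs]
      simp only [Int.cast_zero, zero_mul, mul_zero, sub_zero, abs_zero]
      positivity
  refine (Finset.abs_sum_le_sum_abs _ _).trans ((Finset.sum_le_sum hterm).trans (le_of_eq ?_))
  rw [Finset.sum_const, Finset.card_range, nsmul_eq_mul, Real.rpow_add hD, Real.rpow_one,
    Real.rpow_add hD, Real.rpow_add hD, Real.rpow_one,
    show (2 * (n : ℝ)) = ((2 * n : ℕ) : ℝ) by push_cast; ring, Real.rpow_natCast]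
  push_cast
  ring

open Classical in
/-- The number of points of the box at which `c x³ + 𝒞(y)` is squarefree. -/
noncomputable def squarefreeCount {n : ℕ} (c : ℤ) (𝒞 : MvPolynomial (Fin n) ℤ) (Q : ℕ) : ℕ :=
  ((Finset.Icc (-(Q : ℤ)) Q ×ˢ cubeBox n Q).filter fun z => Squarefree (c * z.1 ^ 3 + eval z.2 𝒞)).card

open Classical in
/-- Truncating the Möbius detection of squarefree values. -/
theorem abs_squarefreeCount_sub_le {n : ℕ} {c : ℤ} {𝒞 : MvPolynomial (Fin n) ℤ} {Q D : ℕ} {V : ℝ}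
    (hV : ∀ z ∈ Finset.Icc (-(Q : ℤ)) Q ×ˢ cubeBox n Q, c * z.1 ^ 3 + eval z.2 𝒞 ≠ 0 →
      ((c * z.1 ^ 3 + eval z.2 𝒞).natAbs.divisors.card : ℝ) ≤ V) :
    |(squarefreeCount c 𝒞 Q : ℝ) - ∑ d ∈ Finset.range (D + 1),
        (ArithmeticFunction.moebius d : ℝ) * boxDvdCount c 𝒞 Q (d ^ 2)| ≤
      ((Finset.Icc (-(Q : ℤ)) Q ×ˢ cubeBox n Q).filter
        fun z => c * z.1 ^ 3 + eval z.2 𝒞 = 0).card * ((D : ℝ) + 1) +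
      ((Finset.Icc (-(Q : ℤ)) Q ×ˢ cubeBox n Q).filter fun z => c * z.1 ^ 3 + eval z.2 𝒞 ≠ 0 ∧
        ∃ d : ℕ, D < d ∧ (d : ℤ) ^ 2 ∣ c * z.1 ^ 3 + eval z.2 𝒞).card * V := by
  set S := Finset.Icc (-(Q : ℤ)) Q ×ˢ cubeBox n Q
  have e1 : (squarefreeCount c 𝒞 Q : ℝ) =
      ∑ z ∈ S, if Squarefree (c * z.1 ^ 3 + eval z.2 𝒞) then (1 : ℝ) else 0 := by
    rw [squarefreeCount, Finset.sum_boole]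
  have e2 : ∑ d ∈ Finset.range (D + 1),
      (ArithmeticFunction.moebius d : ℝ) * boxDvdCount c 𝒞 Q (d ^ 2) =
      ∑ z ∈ S, ∑ d ∈ Finset.range (D + 1), if (d : ℤ) ^ 2 ∣ c * z.1 ^ 3 + eval z.2 𝒞 then
        (ArithmeticFunction.moebius d : ℝ) else 0 := by
    rw [Finset.sum_comm]
    refine Finset.sum_congr rfl fun d _ => ?_
    rw [← Finset.sum_filter, Finset.sum_const, nsmul_eq_mul, mul_comm, boxDvdCount]
    push_cast
    congr!
  rw [e1, e2, ← Finset.sum_sub_distrib, ← nsmul_eq_mul, ← nsmul_eq_mul, ← Finset.sum_const,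
    ← Finset.sum_const, Finset.sum_filter, Finset.sum_filter, ← Finset.sum_add_distrib]
  refine (Finset.abs_sum_le_sum_abs _ _).trans (Finset.sum_le_sum fun z hz => ?_)
  by_cases h0 : c * z.1 ^ 3 + eval z.2 𝒞 = 0
  · rw [h0, if_neg not_squarefree_zero, if_pos rfl, if_neg (by simp), add_zero, zero_sub, abs_neg]
    refine (Finset.abs_sum_le_sum_abs _ _).trans ((Finset.sum_le_card_nsmul _ _ 1
      fun d _ => ?_).trans (by simp))
    split_ifs
    · exact_mod_cast ArithmeticFunction.abs_moebius_le_one (n := d)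
    · simp
  · rw [if_neg h0, zero_add]
    refine (abs_indicator_squarefree_sub_le h0 D).trans ?_
    by_cases h : ∃ d : ℕ, D < d ∧ (d : ℤ) ^ 2 ∣ c * z.1 ^ 3 + eval z.2 𝒞
    · rw [if_pos h, if_pos ⟨h0, h⟩]; exact hV z hz h0
    · rw [if_neg h, if_neg fun hd => h hd.2]

/-- The asymptotic formula for boxes with integral side. -/
theorem exists_abs_squarefreeCount_sub_le {n : ℕ} {c : ℤ} (hc : c ≠ 0) {𝒞 : MvPolynomial (Fin n) ℤ}
    (hhom : 𝒞.IsHomogeneous 3)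
    (hdeg : ¬ ∃ (a : ℚ) (b : Fin n → ℚ), MvPolynomial.map (Int.castRingHom ℚ) 𝒞 =
      MvPolynomial.C a * (∑ i, MvPolynomial.C (b i) * MvPolynomial.X i) ^ 3)
    {ε : ℝ} (hε : 0 < ε) :
    ∃ K : ℝ, 0 ≤ K ∧ ∀ Q : ℕ, 1 ≤ Q →
      |(squarefreeCount c 𝒞 Q : ℝ) - (2 * Q + 1 : ℝ) ^ (n + 1) * ∑' d, seriesTerm c 𝒞 d| ≤
        K * (Q : ℝ) ^ ((n : ℝ) + 1 - 1 / (8 * (n : ℝ) + 6) + ε) := by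
  classical
  have h0 : 𝒞 ≠ 0 := fun h => hdeg ⟨0, 0, by simp [h]⟩
  obtain ⟨η, hη⟩ : ∃ η, η = ε / 4 := ⟨_, rfl⟩
  have hη0 : 0 < η := by rw [hη]; positivity
  obtain ⟨K₁, hK₁, hdiv⟩ := card_divisors_le_rpow hη0
  obtain ⟨M, hM1, hM⟩ := exists_abs_cube_add_eval_le c hhom
  obtain ⟨K₂, hK₂, hW⟩ := card_large_square_box_le hc hhom hdeg hη0
  obtain ⟨K₃, hK₃, hB⟩ := exists_abs_sum_boxDvdCount_sub_le hc hhom h0 hη0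
  obtain ⟨K₄, hK₄, hC⟩ := exists_tsum_sub_sum_seriesTerm_le hc hhom h0 hη0
  obtain ⟨δ, hδ⟩ : ∃ δ : ℝ, δ = 1 / (8 * (n : ℝ) + 6) := ⟨_, rfl⟩
  have hn0 : (0 : ℝ) ≤ n := Nat.cast_nonneg n
  have hδ0 : 0 < δ := by rw [hδ]; positivity
  have hδn : δ * (8 * n + 6) = 1 := by rw [hδ]; field_simp
  have hδ6 : δ ≤ 1 / 6 := by nlinarith
  obtain ⟨τ, hτ⟩ : ∃ τ : ℝ, τ = 1 / 2 + 2 * δ := ⟨_, rfl⟩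
  have hτ0 : 0 < τ := by rw [hτ]; positivity
  have hτ1 : τ ≤ 1 := by linarith
  have hτη : τ * η ≤ η := mul_le_of_le_one_left hη0.le hτ1
  have hτn : τ * (2 * n + 1) = n + 1 - δ := by rw [hτ]; linarith
  rw [← hδ]
  refine ⟨6 * 3 ^ n + (K₂ + 1) * (K₁ * (M : ℝ) ^ η) +
    K₃ * ((2 : ℝ) ^ (1 + η) + (2 : ℝ) ^ (2 * (n : ℝ) + 1 + η)) + 3 ^ (n + 1) * K₄ * (2 : ℝ) ^ η,
    by positivity, fun Q hQ => ?_⟩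
  have hQ1 : (1 : ℝ) ≤ Q := by exact_mod_cast hQ
  have hQ0 : (0 : ℝ) < Q := by linarith
  have hmono : ∀ a b : ℝ, a ≤ b → (Q : ℝ) ^ a ≤ (Q : ℝ) ^ b := fun a b h =>
    Real.rpow_le_rpow_of_exponent_le hQ1 h
  set X := (Q : ℝ) ^ τ with hX
  have hX1 : 1 ≤ X := Real.one_le_rpow hQ1 hτ0.le
  have hX0 : 0 < X := by linarith
  have hXpow : ∀ a : ℝ, X ^ a = (Q : ℝ) ^ (τ * a) := fun a => by rw [hX, ← Real.rpow_mul hQ0.le]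
  set D := ⌊X⌋₊
  have hD1 : X ≤ (D : ℝ) + 1 := (Nat.lt_floor_add_one X).le
  have hD2 : (D : ℝ) + 1 ≤ 2 * X := by linarith [Nat.floor_le hX0.le]
  have hD0 : (0 : ℝ) < (D : ℝ) + 1 := by positivity
  have hQn : (2 * Q + 1 : ℝ) ^ n ≤ 3 ^ n * (Q : ℝ) ^ n := by
    rw [← mul_pow]; exact pow_le_pow_left₀ (by positivity) (by linarith) n
  have hQn1 : (2 * Q + 1 : ℝ) ^ (n + 1) ≤ 3 ^ (n + 1) * (Q : ℝ) ^ (n + 1) := by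
    rw [← mul_pow]; exact pow_le_pow_left₀ (by positivity) (by linarith) (n + 1)
  set θ := (n : ℝ) + 1 - δ + ε with hθ
  have hV : ∀ z ∈ Finset.Icc (-(Q : ℤ)) Q ×ˢ cubeBox n Q, c * z.1 ^ 3 + eval z.2 𝒞 ≠ 0 →
      ((c * z.1 ^ 3 + eval z.2 𝒞).natAbs.divisors.card : ℝ) ≤
        K₁ * (M : ℝ) ^ η * (Q : ℝ) ^ (3 * η) := by
    intro z hz hz0
    refine (hdiv _ (Int.natAbs_ne_zero.mpr hz0)).trans ?_
    rw [mul_assoc]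
    refine mul_le_mul_of_nonneg_left ?_ (by linarith)
    have e : (M : ℝ) ^ η * (Q : ℝ) ^ (3 * η) = (M * (Q : ℝ) ^ 3) ^ η := by
      rw [Real.mul_rpow (by positivity) (by positivity), Real.rpow_mul hQ0.le]
      norm_num
    rw [e]
    refine Real.rpow_le_rpow (by positivity) ?_ hη0.le
    have := hM Q z hz
    rw [Int.abs_eq_natAbs] at this
    exact_mod_cast this
  have hA := abs_squarefreeCount_sub_le (D := D) hV
  have hZ : ((((Finset.Icc (-(Q : ℤ)) Q ×ˢ cubeBox n Q).filter
      fun z => c * z.1 ^ 3 + eval z.2 𝒞 = 0).card : ℕ) : ℝ) ≤ 3 * (2 * Q + 1) ^ n := by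
    exact_mod_cast card_zeros_box_le hc 𝒞 Q
  have hWQ := hW Q D hQ
  set Z := ((Finset.Icc (-(Q : ℤ)) Q ×ˢ cubeBox n Q).filter
      fun z => c * z.1 ^ 3 + eval z.2 𝒞 = 0).card
  set W := ((Finset.Icc (-(Q : ℤ)) Q ×ˢ cubeBox n Q).filter fun z => c * z.1 ^ 3 + eval z.2 𝒞 ≠ 0 ∧
        ∃ d : ℕ, D < d ∧ (d : ℤ) ^ 2 ∣ c * z.1 ^ 3 + eval z.2 𝒞).card
  have b1 : (Z : ℝ) * ((D : ℝ) + 1) ≤ 6 * 3 ^ n * (Q : ℝ) ^ θ := by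
    calc (Z : ℝ) * ((D : ℝ) + 1) ≤ (3 * (3 ^ n * (Q : ℝ) ^ n)) * (2 * X) := by
          gcongr
          exact hZ.trans (by gcongr)
      _ = 6 * 3 ^ n * (Q : ℝ) ^ ((n : ℝ) + τ) := by
          rw [Real.rpow_add hQ0, Real.rpow_natCast]; ring
      _ ≤ _ := mul_le_mul_of_nonneg_left (hmono _ _ (by linarith)) (by positivity)
  have b2 : (W : ℝ) * (K₁ * (M : ℝ) ^ η * (Q : ℝ) ^ (3 * η)) ≤
      (K₂ + 1) * (K₁ * (M : ℝ) ^ η) * (Q : ℝ) ^ θ := by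
    have hW' : (W : ℝ) ≤ (K₂ + 1) * (Q : ℝ) ^ ((n : ℝ) + 1 - δ + η / 4) := by
      rw [← pow_le_pow_iff_left₀ (Nat.cast_nonneg _) (by positivity) (n := 4) (by norm_num)]
      refine le_of_mul_le_mul_right ?_ (show 0 < X ^ 2 by positivity)
      calc (W : ℝ) ^ 4 * X ^ 2 ≤ (W : ℝ) ^ 4 * ((D : ℝ) + 1) ^ 2 := by gcongr
        _ ≤ K₂ * (Q : ℝ) ^ (4 * (n : ℝ) + 5 + η) := hWQ
        _ ≤ (K₂ + 1) ^ 4 * (Q : ℝ) ^ (4 * (n : ℝ) + 5 + η) := by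
            gcongr
            nlinarith [sq_nonneg (K₂ ^ 2), pow_nonneg hK₂ 3, pow_nonneg hK₂ 2]
        _ = _ := by
            rw [mul_pow, mul_assoc, ← Real.rpow_natCast ((Q : ℝ) ^ _) 4, ← Real.rpow_mul hQ0.le, hX,
              ← Real.rpow_natCast ((Q : ℝ) ^ τ) 2, ← Real.rpow_mul hQ0.le, ← Real.rpow_add hQ0]
            congr 2
            rw [hτ]
            push_cast
            ring
    calc _ ≤ (K₂ + 1) * (Q : ℝ) ^ ((n : ℝ) + 1 - δ + η / 4) *
          (K₁ * (M : ℝ) ^ η * (Q : ℝ) ^ (3 * η)) := by gcongr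
      _ = (K₂ + 1) * (K₁ * (M : ℝ) ^ η) * (Q : ℝ) ^ ((n : ℝ) + 1 - δ + η / 4 + 3 * η) := by
          rw [Real.rpow_add hQ0 _ (3 * η)]; ring
      _ ≤ _ := mul_le_mul_of_nonneg_left (hmono _ _ (by linarith)) (by positivity)
  have b3 : K₃ * (((D : ℝ) + 1) ^ (1 + η) * (Q : ℝ) ^ n + ((D : ℝ) + 1) ^ (2 * (n : ℝ) + 1 + η)) ≤
      K₃ * ((2 : ℝ) ^ (1 + η) + (2 : ℝ) ^ (2 * (n : ℝ) + 1 + η)) * (Q : ℝ) ^ θ := by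
    rw [mul_assoc]
    refine mul_le_mul_of_nonneg_left ?_ hK₃
    rw [add_mul]
    refine add_le_add ?_ ?_
    · calc ((D : ℝ) + 1) ^ (1 + η) * (Q : ℝ) ^ n ≤ (2 * X) ^ (1 + η) * (Q : ℝ) ^ n := by gcongr
        _ = (2 : ℝ) ^ (1 + η) * (Q : ℝ) ^ (τ * (1 + η) + n) := by
            rw [Real.mul_rpow zero_le_two hX0.le, hXpow, Real.rpow_add hQ0 _ (n : ℝ),
              Real.rpow_natCast, mul_assoc]
        _ ≤ _ := mul_le_mul_of_nonneg_left (hmono _ _ (by linarith)) (by positivity)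
    · calc ((D : ℝ) + 1) ^ (2 * (n : ℝ) + 1 + η) ≤ (2 * X) ^ (2 * (n : ℝ) + 1 + η) := by gcongr
        _ = (2 : ℝ) ^ (2 * (n : ℝ) + 1 + η) * (Q : ℝ) ^ (τ * (2 * (n : ℝ) + 1 + η)) := by
            rw [Real.mul_rpow zero_le_two hX0.le, hXpow]
        _ ≤ _ := mul_le_mul_of_nonneg_left (hmono _ _ (by linarith)) (by positivity)
  have b4 : (2 * Q + 1 : ℝ) ^ (n + 1) * (K₄ * ((D : ℝ) + 1) ^ (-1 + η)) ≤
      3 ^ (n + 1) * K₄ * (2 : ℝ) ^ η * (Q : ℝ) ^ θ := by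
    have h1 : ((D : ℝ) + 1) ^ (-1 + η) ≤ (2 : ℝ) ^ η * (Q : ℝ) ^ (-τ + τ * η) := by
      calc ((D : ℝ) + 1) ^ (-1 + η) = ((D : ℝ) + 1) ^ (-1 : ℝ) * ((D : ℝ) + 1) ^ η :=
            Real.rpow_add hD0 _ _
        _ ≤ X ^ (-1 : ℝ) * (2 * X) ^ η := by
            refine mul_le_mul ?_ (by gcongr) (by positivity) (by positivity)
            exact Real.rpow_le_rpow_of_nonpos hX0 hD1 (by norm_num)
        _ = _ := by
            rw [Real.mul_rpow zero_le_two hX0.le, hXpow, hXpow, Real.rpow_add hQ0, mul_neg_one]; ring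
    calc _ ≤ 3 ^ (n + 1) * (Q : ℝ) ^ (n + 1) * (K₄ * ((2 : ℝ) ^ η * (Q : ℝ) ^ (-τ + τ * η))) := by
          gcongr
      _ = 3 ^ (n + 1) * K₄ * (2 : ℝ) ^ η * (Q : ℝ) ^ (((n + 1 : ℕ) : ℝ) + (-τ + τ * η)) := by
          rw [Real.rpow_add hQ0 (((n + 1 : ℕ) : ℝ)), Real.rpow_natCast]; ring
      _ ≤ _ := by
          refine mul_le_mul_of_nonneg_left (hmono _ _ ?_) (by positivity)
          push_cast
          linarith
  have hBQ := hB Q D hQ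
  have hCQ : |(2 * Q + 1 : ℝ) ^ (n + 1) * (∑' d, seriesTerm c 𝒞 d) -
      (2 * Q + 1 : ℝ) ^ (n + 1) * ∑ d ∈ Finset.range (D + 1), seriesTerm c 𝒞 d| ≤
      (2 * Q + 1 : ℝ) ^ (n + 1) * (K₄ * ((D : ℝ) + 1) ^ (-1 + η)) := by
    rw [← mul_sub, abs_mul, abs_of_nonneg (by positivity : (0 : ℝ) ≤ (2 * Q + 1 : ℝ) ^ (n + 1))]
    exact mul_le_mul_of_nonneg_left (hC D) (by positivity)
  have t1 := abs_le.mp (hA.trans (add_le_add b1 b2))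
  have t2 := abs_le.mp (hBQ.trans b3)
  have t3 := abs_le.mp (hCQ.trans b4)
  rw [abs_le, add_mul, add_mul, add_mul]
  constructor <;> linarith [t1.1, t1.2, t2.1, t2.2, t3.1, t3.2]

theorem natCard_squarefree_eq_squarefreeCount {n : ℕ} (c : ℤ) (𝒞 : MvPolynomial (Fin n) ℤ)
    {P : ℝ} (hP : 0 ≤ P) :
    Nat.card {x : ℤ × (Fin n → ℤ) // (|x.1| : ℝ) ≤ P ∧ (∀ j, (|x.2 j| : ℝ) ≤ P) ∧
      Squarefree (c * x.1 ^ 3 + eval x.2 𝒞)} = squarefreeCount c 𝒞 ⌊P⌋₊ := by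
  have key (m : ℤ) : |(m : ℝ)| ≤ P ↔ |m| ≤ (⌊P⌋₊ : ℤ) := by
    rw [Int.abs_eq_natAbs, Nat.cast_le, Nat.le_floor_iff hP, Nat.cast_natAbs, Int.cast_abs]
  rw [squarefreeCount]
  refine Nat.subtype_card _ fun x => ?_
  simp only [Finset.mem_filter, Finset.mem_product, Finset.mem_Icc, mem_cubeBox, key, ← abs_le,
    and_assoc]

theorem exists_abs_natCard_squarefree_sub_le {n : ℕ} {c : ℤ} (hc : c ≠ 0)
    {𝒞 : MvPolynomial (Fin n) ℤ} (hhom : 𝒞.IsHomogeneous 3)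
    (hdeg : ¬ ∃ (a : ℚ) (b : Fin n → ℚ), MvPolynomial.map (Int.castRingHom ℚ) 𝒞 =
      MvPolynomial.C a * (∑ i, MvPolynomial.C (b i) * MvPolynomial.X i) ^ 3)
    {ε : ℝ} (hε : 0 < ε) :
    ∃ K : ℝ, ∀ P : ℝ, 2 ≤ P →
      |(Nat.card {x : ℤ × (Fin n → ℤ) // (|x.1| : ℝ) ≤ P ∧ (∀ j, (|x.2 j| : ℝ) ≤ P) ∧
          Squarefree (c * x.1 ^ 3 + eval x.2 𝒞)} : ℝ) -
        2 ^ (n + 1) * P ^ (n + 1) * ∏' p : Nat.Primes,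
          (1 - (numZeros c 𝒞 ((p : ℕ) ^ 2) : ℝ) / ((p : ℕ) : ℝ) ^ (2 * (n + 1)))| ≤
        K * P ^ (((n + 1 : ℕ) : ℝ) - 1 / (8 * ((n + 1 : ℕ) : ℝ) - 2) + ε) := by
  have h0 : 𝒞 ≠ 0 := fun h => hdeg ⟨0, 0, by simp [h]⟩
  obtain ⟨K, hK, hQ⟩ := exists_abs_squarefreeCount_sub_le hc hhom hdeg hε
  have hθ : ((n + 1 : ℕ) : ℝ) - 1 / (8 * ((n + 1 : ℕ) : ℝ) - 2) + ε =
      (n : ℝ) + 1 - 1 / (8 * (n : ℝ) + 6) + ε := by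
    push_cast; ring_nf
  rw [hθ, tprod_eq_tsum_seriesTerm hc hhom h0]
  set σ := ∑' d, seriesTerm c 𝒞 d
  set θ := (n : ℝ) + 1 - 1 / (8 * (n : ℝ) + 6) + ε with hθ'
  have hnθ : (n : ℝ) ≤ θ := by
    have : 1 / (8 * (n : ℝ) + 6) ≤ 1 := by
      rw [div_le_one (by positivity)]; linarith [(n.cast_nonneg : (0 : ℝ) ≤ n)]
    linarith
  have hθ0 : 0 ≤ θ := n.cast_nonneg.trans hnθ
  refine ⟨K + (n + 1) * 3 ^ n * |σ|, fun P hP => ?_⟩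
  have hP0 : 0 ≤ P := by linarith
  rw [natCard_squarefree_eq_squarefreeCount c 𝒞 hP0]
  have hfl := Nat.floor_le hP0
  have hlt := Nat.lt_floor_add_one P
  have h1 : 1 ≤ ⌊P⌋₊ := Nat.le_floor (by norm_num; linarith)
  have h2 := hQ _ h1
  have h3 : K * (⌊P⌋₊ : ℝ) ^ θ ≤ K * P ^ θ := by gcongr
  have h4 := abs_prod_sub_pow_mul_le (t := 2 * P) (by linarith) (n + 1)
    (fun _ => (2 * (⌊P⌋₊ : ℝ) + 1)) (fun _ => by positivity)
    (fun _ => abs_le.2 ⟨by linarith, by linarith⟩)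
  rw [Finset.prod_const, Finset.card_univ, Fintype.card_fin, pow_succ (2 * P + 1), ← mul_assoc] at h4
  have h5 := le_of_mul_le_mul_right h4 (by linarith)
  have h6 : ((n + 1 : ℕ) : ℝ) * (2 * P + 1) ^ n ≤ (n + 1) * 3 ^ n * P ^ θ := by
    push_cast
    rw [mul_assoc]
    gcongr
    calc (2 * P + 1) ^ n ≤ (3 * P) ^ n := by gcongr; linarith
      _ = 3 ^ n * P ^ (n : ℝ) := by rw [mul_pow, Real.rpow_natCast]
      _ ≤ _ := by gcongr; linarith
  calc _ = |((squarefreeCount c 𝒞 ⌊P⌋₊ : ℝ) - (2 * ⌊P⌋₊ + 1 : ℝ) ^ (n + 1) * σ) +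
        ((2 * ⌊P⌋₊ + 1 : ℝ) ^ (n + 1) - (2 * P) ^ (n + 1)) * σ| := by
        rw [mul_pow]; ring_nf
    _ ≤ _ := (abs_add_le _ _).trans (add_le_add (h2.trans h3)
        ((abs_mul _ _).trans_le (mul_le_mul_of_nonneg_right (h5.trans h6) (abs_nonneg σ))))
    _ = _ := by ring

/-- **Squarefree density of polynomials, Theorem 4 (case k = 3).**
For `s ≥ 3`, `c ≠ 0` and a non-degenerate integral cubic form `𝒞*` in `s-1` variables,
with `𝓟(x) = c x₁³ + 𝒞*(x₂,…,x_s)`, the number of `x ∈ [-P,P]^s` with `𝓟(x)` squarefree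
is `2^s P^s 𝔖_𝓟 + O(P^(s - 1/(8s-2) + ε))`. -/
theorem squarefree_density_thm4_cubic (s : ℕ) (hs : 3 ≤ s) (c : ℤ) (hc : c ≠ 0)
    (𝒞 : MvPolynomial (Fin (s - 1)) ℤ) (hhom : 𝒞.IsHomogeneous 3)
    (hdeg : ¬ ∃ (a : ℚ) (b : Fin (s - 1) → ℚ),
      MvPolynomial.map (Int.castRingHom ℚ) 𝒞 =
        MvPolynomial.C a * (∑ i, MvPolynomial.C (b i) * MvPolynomial.X i) ^ 3)
    (ε : ℝ) (hε : 0 < ε) :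
    ∃ K : ℝ, ∀ P : ℝ, 2 ≤ P →
      |(Nat.card {x : ℤ × (Fin (s - 1) → ℤ) //
            (|x.1| : ℝ) ≤ P ∧ (∀ j, (|x.2 j| : ℝ) ≤ P) ∧
            Squarefree (c * x.1 ^ 3 + eval x.2 𝒞)} : ℝ) -
          2 ^ s * P ^ s *
            ∏' p : Nat.Primes,
              (1 - (Nat.card {y : ZMod ((p : ℕ) ^ 2) × (Fin (s - 1) → ZMod ((p : ℕ) ^ 2)) //
                  (c : ZMod ((p : ℕ) ^ 2)) * y.1 ^ 3 + aeval y.2 𝒞 = 0} : ℝ) /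
                ((p : ℕ) : ℝ) ^ (2 * s))|
        ≤ K * P ^ ((s : ℝ) - 1 / (8 * (s : ℝ) - 2) + ε) := by
  obtain ⟨n, rfl⟩ : ∃ n, s = n + 1 := ⟨s - 1, by omega⟩
  exact exists_abs_natCard_squarefree_sub_le (n := n) hc hhom hdeg hε
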